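/- arXiv:2512.13967 — 2 statements merged into one kernel-verified Lean document; each statement's English description precedes it below -/
import Mathlib

section
/- In the free group F₂ = FreeGroup (Fin 2), the number of potentially positive elements of reduced length n is Θ(λ₁ⁿ): there exist constants c, C > 0 such that c·λ₁ⁿ ≤ 𝔤_n({w ∈ F₂ : w is potentially positive}) ≤ C·λ₁ⁿ for all sufficiently large n, where λ₁ ≈ 2.50506841362147 is the largest real root of the polynomial X⁴ − 3X³ + X² + X − 1. -/
abbrev F2 := FreeGroup (Fin 2)

/-- An element of `F₂` is positive if it lies in the submonoid generated by the generators. -/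
def Positive2 (w : F2) : Prop :=
  w ∈ Submonoid.closure (Set.range (FreeGroup.of : Fin 2 → F2))

/-- An element is potentially positive if some automorphism sends it to a positive element. -/
def PotPos2 (w : F2) : Prop := ∃ φ : F2 ≃* F2, Positive2 (φ w)

/-- Growth function: number of elements of `S` of reduced length `n`. -/
noncomputable def growth2 (S : Set F2) (n : ℕ) : ℕ :=
  Nat.card {w : F2 // w ∈ S ∧ FreeGroup.norm w = n}

namespace PPG
open FreeGroup

lemma red_sub {l m : List (Fin 2 × Bool)} (h : FreeGroup.IsReduced m) (hi : l <:+: m) :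
    FreeGroup.IsReduced l := by
  obtain ⟨s, t, rfl⟩ := hi
  unfold FreeGroup.IsReduced at *
  exact (List.isChain_append.mp (List.isChain_append.mp h).1).2.1

/-- length of the longest common initial segment -/
def lcp {α : Type*} [DecidableEq α] : List α → List α → ℕ
  | x :: xs, y :: ys => if x = y then lcp xs ys + 1 else 0
  | _, _ => 0

lemma lcp_comm {α : Type*} [DecidableEq α] (l m : List α) : lcp l m = lcp m l := by
  induction l generalizing m with
  | nil => cases m <;> simp [lcp]
  | cons x xs ih => cases m with
    | nil => simp [lcp]
    | cons y ys => simp only [lcp, ih ys, eq_comm]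

lemma lcp_spec {α : Type*} [DecidableEq α] (l m : List α) :
    ∃ p s t, l = p ++ s ∧ m = p ++ t ∧ p.length = lcp l m ∧
      (∀ a ∈ s.head?, ∀ b ∈ t.head?, a ≠ b) := by
  induction l generalizing m with
  | nil => exact ⟨[], [], m, by simp [lcp]⟩
  | cons x xs ih => cases m with
    | nil => exact ⟨[], x :: xs, [], by simp [lcp]⟩
    | cons y ys =>
      by_cases h : x = y
      · subst h
        obtain ⟨p, s, t, h1, h2, h3, h4⟩ := ih ys
        exact ⟨x :: p, s, t, by simp [h1], by simp [h2], by simp [lcp, h3], h4⟩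
      · exact ⟨[], x :: xs, y :: ys, by simp, by simp, by simp [lcp, h], by simpa using h⟩

lemma lcp_ultra {α : Type*} [DecidableEq α] (l m n : List α) :
    min (lcp l m) (lcp m n) ≤ lcp l n := by
  induction l generalizing m n with
  | nil => cases m <;> simp [lcp]
  | cons x xs ih => cases m with
    | nil => simp [lcp]
    | cons y ys => cases n with
      | nil => simp [lcp]
      | cons z zs =>
        simp only [lcp]
        have := ih ys zs
        split_ifs with h1 h2 h3 h4 h5 <;> simp_all

lemma isReduced_invRev_append (s t : List (Fin 2 × Bool)) (hs : IsReduced (invRev s))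
    (ht : IsReduced t) (h : ∀ a ∈ s.head?, ∀ b ∈ t.head?, a ≠ b) :
    IsReduced (invRev s ++ t) := by
  refine List.IsChain.append hs ht ?_
  cases s with
  | nil => simp
  | cons x xs =>
    cases t with
    | nil => simp
    | cons y ys =>
      simp [invRev] at h ⊢
      intro h1
      by_contra h2
      apply h
      ext
      · rw [h1]
      · cases hx : x.2 <;> cases hy : y.2 <;> simp_all

/-- Gromov product at the identity. -/
def gp (g h : F2) : ℕ := lcp g.toWord h.toWord

lemma gp_comm (g h : F2) : gp g h = gp h g := lcp_comm _ _
lemma gp_ultra (g h k : F2) : min (gp g h) (gp h k) ≤ gp g k := lcp_ultra _ _ _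

lemma norm_inv_mul (g h : F2) : norm (g⁻¹ * h) + 2 * gp g h = norm g + norm h := by
  obtain ⟨p, s, t, h1, h2, h3, h4⟩ := lcp_spec g.toWord h.toWord
  have hg := isReduced_toWord (x := g)
  have hh := isReduced_toWord (x := h)
  have e : g⁻¹ * h = mk (invRev s ++ t) := by
    rw [← mk_toWord (x := g), ← mk_toWord (x := h), h1, h2, ← mul_mk, ← mul_mk, ← mul_mk,
      ← inv_mk]
    group
  have hr : IsReduced (invRev s ++ t) := by
    apply isReduced_invRev_append _ _ _ (red_sub hh ⟨p, [], by simp [h2]⟩) h4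
    have : IsReduced (invRev g.toWord) := by rw [← toWord_inv]; exact isReduced_toWord
    rw [h1, invRev_append] at this
    exact red_sub this ⟨[], invRev p, by simp⟩
  unfold gp FreeGroup.norm
  rw [e, toWord_mk, hr.reduce_eq, ← h3, h1, h2]
  simp; ring

lemma gp_le_left (g h : F2) : gp g h ≤ norm g := by
  obtain ⟨p, s, t, h1, h2, h3, h4⟩ := lcp_spec g.toWord h.toWord
  unfold gp FreeGroup.norm; rw [← h3, h1]; simp

lemma gp_take_eq (g h : F2) (m : ℕ) (hm : m ≤ gp g h) : g.toWord.take m = h.toWord.take m := by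
  obtain ⟨p, s, t, h1, h2, h3, h4⟩ := lcp_spec g.toWord h.toWord
  unfold gp at hm
  rw [← h3] at hm
  rw [h1, h2, List.take_append_of_le_length hm, List.take_append_of_le_length hm]

/-- cancellation in the product `u * v` -/
def cn (u v : F2) : ℕ := gp u⁻¹ v

lemma norm_mul_cn (u v : F2) : norm (u * v) + 2 * cn u v = norm u + norm v := by
  have := norm_inv_mul u⁻¹ v
  simpa [cn] using this

lemma cn_inv (u v : F2) : cn v⁻¹ u⁻¹ = cn u v := by
  unfold cn; rw [gp_comm]; simp

lemma cn_self_lt (y : F2) (hy : y ≠ 1) : 2 * cn y y < norm y := by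
  have h := norm_mul_cn y y
  have hr := isReduced_toWord (x := y)
  have h2 := reduceCyclically.reduce_flatten_replicate_succ hr 1
  have h3 := reduceCyclically.conj_conjugator_reduceCyclically y.toWord
  have h4 : norm (y * y) = 2 * (reduceCyclically.conjugator y.toWord).length +
      2 * (reduceCyclically y.toWord).length := by
    rw [← pow_two, FreeGroup.norm, toWord_pow, h2]; simp; ring
  have h5 : norm y = 2 * (reduceCyclically.conjugator y.toWord).length +
      (reduceCyclically y.toWord).length := by
    rw [FreeGroup.norm]; conv_lhs => rw [← h3]
    simp; ring
  have h6 : 0 < (reduceCyclically y.toWord).length := by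
    rw [List.length_pos_iff]
    intro h7
    rw [h7] at h3
    apply hy
    rw [← mk_toWord (x := y), ← h3, List.append_nil, ← mul_mk, ← inv_mk, mul_inv_cancel]
  omega

/-- the key tree step -/
lemma norm_step (w v u : F2) (h : cn v u + cn (w * v⁻¹) v < norm v) :
    cn w u = cn v u := by
  -- w⁻¹, v⁻¹, u
  have h1 : gp w⁻¹ v⁻¹ + cn (w * v⁻¹) v = norm v := by
    have e1 := norm_inv_mul w⁻¹ v⁻¹
    have e2 := norm_mul_cn (w * v⁻¹) v
    simp at e1 e2
    omega
  unfold cn at *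
  have a1 := gp_ultra w⁻¹ v⁻¹ u
  have a2 := gp_ultra v⁻¹ w⁻¹ u
  rw [gp_comm v⁻¹ w⁻¹] at a2
  have hlt : gp v⁻¹ u < gp w⁻¹ v⁻¹ := by omega
  rw [min_eq_right hlt.le] at a1
  rcases le_total (gp w⁻¹ v⁻¹) (gp w⁻¹ u) with h5 | h5
  · rw [min_eq_left h5] at a2; omega
  · rw [min_eq_right h5] at a2; omega

end PPG

namespace PPG
open FreeGroup

lemma step_left (u v w : F2) (h : cn u v + cn v (v⁻¹ * w) < FreeGroup.norm v) :
    cn u w = cn u v := by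
  have := norm_step w⁻¹ v⁻¹ u⁻¹ (by
    rw [cn_inv, norm_inv_eq]
    have : cn (w⁻¹ * v⁻¹⁻¹) v⁻¹ = cn v (v⁻¹ * w) := by
      rw [← cn_inv v]; simp
    omega)
  rwa [cn_inv, cn_inv] at this

lemma cn_one (u : F2) : cn u 1 = 0 := by
  have := norm_mul_cn u 1
  simp at this; exact this

/-- the two letters do not cancel -/
def adj (s t : Fin 2 × Bool) : Prop := s.1 = t.1 → s.2 = t.2


lemma nred_aux (f : F2 →* F2)
  (h1 : ∀ s t, adj s t → cn (f (mk [s])) (f (mk [t])) < FreeGroup.norm (f (mk [s])) ∧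
    cn (f (mk [s])) (f (mk [t])) < FreeGroup.norm (f (mk [t])))
  (h2 : ∀ s t r, adj s t → adj t r →
    cn (f (mk [s])) (f (mk [t])) + cn (f (mk [t])) (f (mk [r])) < FreeGroup.norm (f (mk [t])))
    (L : List (Fin 2 × Bool)) : ∀ s, IsReduced (s :: L) →
    cn (f (mk [s])) (f (mk L)) = (match L with | [] => 0 | t :: _ => cn (f (mk [s])) (f (mk [t]))) ∧
    L.length + FreeGroup.norm (f (mk [s])) ≤ FreeGroup.norm (f (mk (s :: L))) +
      cn (f (mk [s])) (f (mk L)) := by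
  induction L with
  | nil =>
    intro s _
    have : f (mk []) = 1 := by rw [← one_eq_mk, _root_.map_one]
    simp [this, cn_one]
  | cons t L ih =>
    intro s hs
    rw [isReduced_cons_cons] at hs
    obtain ⟨hst, hL⟩ := hs
    obtain ⟨i1, i2⟩ := ih t hL
    have e1 : f (mk (t :: L)) = f (mk [t]) * f (mk L) := by
      rw [← _root_.map_mul, mul_mk]; rfl
    have e2 : f (mk (s :: t :: L)) = f (mk [s]) * f (mk (t :: L)) := by
      rw [← _root_.map_mul, mul_mk]; rfl
    have key : cn (f (mk [s])) (f (mk [t])) + cn (f (mk [t])) (f (mk L)) <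
        FreeGroup.norm (f (mk [t])) := by
      rw [i1]
      cases L with
      | nil => simpa using (h1 s t hst).2
      | cons r L =>
        rw [isReduced_cons_cons] at hL
        exact h2 s t r hst hL.1
    have e3 : cn (f (mk [s])) (f (mk (t :: L))) = cn (f (mk [s])) (f (mk [t])) := by
      apply step_left
      rw [e1]; simpa using key
    refine ⟨e3, ?_⟩
    have e4 := norm_mul_cn (f (mk [s])) (f (mk (t :: L)))
    rw [← e2] at e4
    rw [List.length_cons]
    omega

lemma nred (f : F2 →* F2)
  (h1 : ∀ s t, adj s t → cn (f (mk [s])) (f (mk [t])) < FreeGroup.norm (f (mk [s])) ∧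
    cn (f (mk [s])) (f (mk [t])) < FreeGroup.norm (f (mk [t])))
  (h2 : ∀ s t r, adj s t → adj t r →
    cn (f (mk [s])) (f (mk [t])) + cn (f (mk [t])) (f (mk [r])) < FreeGroup.norm (f (mk [t])))
    (L : List (Fin 2 × Bool)) (hL : IsReduced L) : L.length ≤ FreeGroup.norm (f (mk L)) := by
  cases L with
  | nil => simp
  | cons s L =>
    obtain ⟨i1, i2⟩ := nred_aux f h1 h2 L s hL
    have : cn (f (mk [s])) (f (mk L)) < FreeGroup.norm (f (mk [s])) := by
      rw [i1]
      cases L with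
      | nil => have := (h1 s s (fun _ => rfl)).1; simp; omega
      | cons t L => rw [isReduced_cons_cons] at hL; exact (h1 s t hL.1).1
    simp; omega

def Gen (x y : F2) : Prop := ∀ H : Subgroup F2, x ∈ H → y ∈ H → H = ⊤

lemma Gen.swap {x y : F2} (h : Gen x y) : Gen y x := fun H a b => h H b a
lemma Gen.inv {x y : F2} (h : Gen x y) : Gen x⁻¹ y :=
  fun H a b => h H (by simpa using a) b
lemma Gen.mul {x y : F2} (h : Gen x y) : Gen x (x * y) :=
  fun H a b => h H a (by simpa using H.mul_mem (H.inv_mem a) b)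
lemma Gen.conj {x y : F2} (g : F2) (h : Gen x y) : Gen (g * x * g⁻¹) (g * y * g⁻¹) := by
  intro H a b
  have := h (H.comap (MulAut.conj g).toMonoidHom) (by simpa using a) (by simpa using b)
  rw [eq_top_iff]
  intro z _
  have hz : g⁻¹ * z * g ∈ H.comap (MulAut.conj g).toMonoidHom := by rw [this]; trivial
  rw [Subgroup.mem_comap] at hz
  simpa [mul_assoc] using hz

lemma of_ne : (of 0 : F2) ≠ of 1 := fun h => by simpa using of_injective h

lemma not_gen_one (x : F2) : ¬ Gen x 1 := by
  intro h
  have h1 := h (Subgroup.zpowers x) (Subgroup.mem_zpowers x) (Subgroup.one_mem _)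
  have ha : (of 0 : F2) ∈ Subgroup.zpowers x := by rw [h1]; trivial
  have hb : (of 1 : F2) ∈ Subgroup.zpowers x := by rw [h1]; trivial
  obtain ⟨i, hi⟩ := ha
  obtain ⟨j, hj⟩ := hb
  have : (of 0 : F2) * of 1 = of 1 * of 0 := by
    rw [← hi, ← hj]; simp only [← zpow_add, add_comm]
  have := congrArg toWord this
  revert this; decide

/-- failure of N2: conjugation makes the pair shorter -/
lemma n2_conj (u v : F2) (hv : v ≠ 1) (h1 : 2 * cn u v ≤ FreeGroup.norm v)
    (h2 : 2 * cn v u ≤ FreeGroup.norm v) (h3 : 2 * cn u v ≤ FreeGroup.norm u)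
    (h4 : FreeGroup.norm v ≤ cn u v + cn v u) :
    ∃ q : F2, FreeGroup.norm (q⁻¹ * (u * v) * q) + FreeGroup.norm (q⁻¹ * v * q) <
      FreeGroup.norm u + FreeGroup.norm v := by
  obtain ⟨m, hm⟩ : ∃ m, m = cn u v := ⟨_, rfl⟩
  have hm2 : m = cn v u := by omega
  have hvn : FreeGroup.norm v = 2 * m := by omega
  have hvp : 0 < FreeGroup.norm v := by
    rw [Nat.pos_iff_ne_zero, Ne, FreeGroup.norm_eq_zero]; exact hv
  have p1 := gp_take_eq _ _ m hm.le
  have p2 := gp_take_eq _ _ m hm2.le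
  set P := v.toWord.take m with hP
  set Q := u.toWord.take m with hQ
  have lv : v.toWord.length = 2 * m := hvn
  have lu : 2 * m ≤ u.toWord.length := by rw [hm]; exact h3
  have hPl : P.length = m := by rw [hP, List.length_take]; omega
  have hQl : Q.length = m := by rw [hQ, List.length_take]; omega
  have hv1 : v = mk P * (mk Q)⁻¹ := by
    have : invRev v.toWord = Q ++ invRev P := by
      conv_lhs => rw [← List.take_append_drop m (invRev v.toWord)]
      rw [← toWord_inv, p2, toWord_inv]
      congr 1
      conv_lhs => rw [← List.take_append_drop m v.toWord, ← hP, invRev_append]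
      rw [List.drop_append_of_le_length (by simp; omega), List.drop_eq_nil_of_le (by simp; omega)]
      rfl
    rw [← inv_inj, mul_inv_rev, inv_inv, ← mk_toWord (x := v), inv_mk, this, ← mul_mk, inv_mk]
  have hu1 : ∃ S, u.toWord = Q ++ S ++ invRev P := by
    have h5 : invRev u.toWord = P ++ (invRev u.toWord).drop m := by
      conv_lhs => rw [← List.take_append_drop m (invRev u.toWord)]
      rw [← toWord_inv, p1]
    have h6 : u.toWord = invRev ((invRev u.toWord).drop m) ++ invRev P := by
      rw [← invRev_append, ← h5, invRev_invRev]
    set T := invRev ((invRev u.toWord).drop m) with hT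
    have hTl : m ≤ T.length := by rw [hT]; simp; omega
    refine ⟨T.drop m, ?_⟩
    have : Q = T.take m := by
      rw [hQ]; conv_lhs => rw [h6]
      exact List.take_append_of_le_length hTl
    rw [this, List.take_append_drop]; exact h6
  obtain ⟨S, hS⟩ := hu1
  have hu2 : u = mk Q * mk S * (mk P)⁻¹ := by
    rw [inv_mk, mul_mk, mul_mk, ← hS, mk_toWord]
  refine ⟨mk Q, ?_⟩
  have e1 : (mk Q)⁻¹ * (u * v) * mk Q = mk S := by
    rw [hu2, hv1]; group
  have e2 : (mk Q)⁻¹ * v * mk Q = mk (invRev Q ++ P) := by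
    rw [hv1, ← mul_mk, ← inv_mk]; group
  rw [e1, e2]
  have n1 := norm_mk_le (L₁ := S)
  have n2 := norm_mk_le (L₁ := invRev Q ++ P)
  have n3 : u.norm = m + S.length + m := by
    rw [FreeGroup.norm, hS]; simp [hPl, hQl]; ring
  simp [hPl, hQl] at n2
  omega

lemma n2_inv (u v : F2) (hv : v ≠ 1) (h1 : 2 * cn u v ≤ FreeGroup.norm v)
    (h2 : 2 * cn v u⁻¹ ≤ FreeGroup.norm v) : cn u v + cn v u⁻¹ < FreeGroup.norm v := by
  by_contra h4
  have := gp_ultra v⁻¹ u⁻¹ v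
  have hs := cn_self_lt v hv
  unfold cn at *
  omega

theorem nielsen (Q : F2 → F2 → Prop)
    (hconj : ∀ g x y, Q x y → Q (g * x * g⁻¹) (g * y * g⁻¹))
    (hswap : ∀ x y, Q x y → Q y x) (hinv : ∀ x y, Q x y → Q x⁻¹ y)
    (hmul : ∀ x y, Q x y → Q x (x * y)) (hbase : Q (of 0) (of 1)) :
    ∀ n x y, FreeGroup.norm x + FreeGroup.norm y = n → Gen x y → Q x y := by
  intro n
  induction n using Nat.strong_induction_on with
  | _ n ih =>
  have hinv2 : ∀ x y, Q x y → Q x y⁻¹ := fun x y h => hswap _ _ (hinv _ _ (hswap _ _ h))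
  have hmul' : ∀ x y, Q x (x * y) → Q x y := by
    intro x y h
    have := hinv _ _ (hmul _ _ (hinv _ _ h))
    simpa using this
  let bad (u v : F2) : Prop := Gen u v ∧ ¬ Q u v ∧ FreeGroup.norm u + FreeGroup.norm v = n
  have bswap : ∀ u v, bad u v → bad v u := fun u v h =>
    ⟨h.1.swap, fun h' => h.2.1 (hswap _ _ h'), by rw [add_comm]; exact h.2.2⟩
  have binv : ∀ u v, bad u v → bad u⁻¹ v := fun u v h =>
    ⟨h.1.inv, fun h' => h.2.1 (by simpa using hinv _ _ h'), by rw [norm_inv_eq]; exact h.2.2⟩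
  have binv2 : ∀ u v, bad u v → bad u v⁻¹ := fun u v h => bswap _ _ (binv _ _ (bswap _ _ h))
  have bne : ∀ u v, bad u v → v ≠ 1 := by
    rintro u v h rfl; exact not_gen_one _ h.1
  have b1 : ∀ u v, bad u v → 2 * cn u v ≤ FreeGroup.norm u := by
    intro u v h
    by_contra hc
    have := norm_mul_cn u v
    exact h.2.1 (hmul' _ _ (ih _ (by have := h.2.2; omega) u (u * v) rfl h.1.mul))
  have b2 : ∀ u v, bad u v → 2 * cn u v ≤ FreeGroup.norm v := by
    intro u v h
    have := b1 _ _ (binv2 _ _ (binv _ _ (bswap _ _ h)))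
    rwa [cn_inv, norm_inv_eq] at this
  have b3 : ∀ u v, bad u v → cn u v + cn v u < FreeGroup.norm v := by
    intro u v h
    by_contra hc
    obtain ⟨q, hq⟩ := n2_conj u v (bne _ _ h) (b2 _ _ h) (b1 _ _ (bswap _ _ h)) (b1 _ _ h)
      (by omega)
    have hg : Gen (u * v) v := by
      have := h.1.swap.inv.swap.inv.swap.mul.swap.inv.swap.inv.swap
      simpa using this
    have hg2 := hg.conj q⁻¹
    rw [inv_inv] at hg2
    have hQ := ih _ (by have := h.2.2; omega) _ _ rfl hg2
    have hQ2 := hconj q _ _ hQ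
    have hQ3 : Q (u * v) v := by
      convert hQ2 using 1 <;> group
    apply h.2.1
    have h6 := hswap _ _ (hmul _ _ (hinv2 _ _ (hswap _ _ hQ3)))
    have h7 := hinv _ _ h6
    have : (v * (u * v)⁻¹)⁻¹ = u := by group
    rwa [this] at h7
  have b4 : ∀ u v, bad u v → cn u v + cn v u⁻¹ < FreeGroup.norm v := fun u v h =>
    n2_inv u v (bne _ _ h) (b2 _ _ h) (b1 _ _ (bswap _ _ (binv _ _ h)))
  intro x y hn hgen
  by_contra hQ
  have hb : bad x y := ⟨hgen, hQ, hn⟩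
  let f : F2 →* F2 := lift ![x, y]
  have f0 : f (mk [(0, true)]) = x := by simp [f]
  have f0' : f (mk [(0, false)]) = x⁻¹ := by simp [f]
  have f1 : f (mk [(1, true)]) = y := by simp [f]
  have f1' : f (mk [(1, false)]) = y⁻¹ := by simp [f]
  have hbad : ∀ s t : Fin 2 × Bool, s.1 ≠ t.1 → bad (f (mk [s])) (f (mk [t])) := by
    rintro ⟨i, e⟩ ⟨j, e'⟩ h
    have c1 := hb
    have c2 := binv _ _ c1
    have c3 := binv2 _ _ c1
    have c4 := binv2 _ _ c2
    fin_cases i <;> fin_cases j <;> first | exact absurd rfl h | skip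
    all_goals
      cases e <;> cases e' <;> simp only [Fin.zero_eta, Fin.mk_one, f0, f0', f1, f1']
    all_goals first | assumption | (apply bswap; assumption)
  have hne : ∀ s, f (mk [s]) ≠ 1 := by
    intro s
    have : ∃ t : Fin 2 × Bool, t.1 ≠ s.1 := ⟨(s.1 + 1, true), by simp⟩
    obtain ⟨t, ht⟩ := this
    exact bne _ _ (hbad t s ht)
  have hpos : ∀ s, 0 < FreeGroup.norm (f (mk [s])) := by
    intro s
    rw [Nat.pos_iff_ne_zero, Ne, FreeGroup.norm_eq_zero]; exact hne s
  have hinvl : ∀ s t : Fin 2 × Bool, s.1 = t.1 → s = t ∨ f (mk [s]) = (f (mk [t]))⁻¹ := by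
    rintro ⟨i, e⟩ ⟨j, e'⟩ h
    simp only at h; subst h
    cases e <;> cases e' <;> simp <;> rw [← _root_.map_inv, inv_mk] <;> simp [invRev]
  have hadj : ∀ s t : Fin 2 × Bool, adj s t → s = t ∨ s.1 ≠ t.1 := by
    rintro ⟨i, e⟩ ⟨j, e'⟩ h
    by_cases hij : i = j
    · left; exact Prod.ext hij (h hij)
    · right; exact hij
  have h1 : ∀ s t, adj s t → 2 * cn (f (mk [s])) (f (mk [t])) ≤ FreeGroup.norm (f (mk [s])) ∧
    2 * cn (f (mk [s])) (f (mk [t])) ≤ FreeGroup.norm (f (mk [t])) := by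
    intro s t hst
    rcases hadj s t hst with rfl | h
    · have := cn_self_lt _ (hne s); omega
    · exact ⟨b1 _ _ (hbad s t h), b2 _ _ (hbad s t h)⟩
  have hred := nred f (fun s t hst => by
      have := h1 s t hst; have := hpos s; have := hpos t; omega) (by
    intro s t r hst htr
    have e1 := h1 s t hst
    have e2 := h1 t r htr
    rcases hadj s t hst with rfl | h
    · have := cn_self_lt _ (hne s); omega
    rcases hadj t r htr with rfl | h'
    · have := cn_self_lt _ (hne t); omega
    have : s.1 = r.1 := by
      revert h h'; generalize s.1 = i; generalize t.1 = j; generalize r.1 = k; revert i j k; decide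
    rcases hinvl r s this.symm with rfl | h''
    · exact b3 _ _ (hbad _ _ h)
    · rw [h'']; exact b4 _ _ (hbad _ _ h))
  have hsurj : ∀ z, ∃ w, f w = z := by
    have : f.range = ⊤ := hgen _ ⟨_, f0⟩ ⟨_, f1⟩
    intro z
    have hz : z ∈ f.range := by rw [this]; trivial
    exact hz
  have hlet : ∀ i : Fin 2, ∃ s, f (mk [s]) = of i := by
    intro i
    obtain ⟨w, hw⟩ := hsurj (of i)
    have := hred w.toWord isReduced_toWord
    rw [mk_toWord, hw, norm_of] at this
    match hL : w.toWord with
    | [] =>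
      have hw1 : w = 1 := toWord_eq_nil_iff.1 hL
      rw [hw1, _root_.map_one] at hw
      exact absurd hw.symm (of_ne_one i)
    | [s] => exact ⟨s, by rw [← hL, mk_toWord, hw]⟩
    | s :: t :: L => rw [hL] at this; simp at this
  obtain ⟨⟨i, e⟩, hs⟩ := hlet 0
  obtain ⟨⟨j, e'⟩, ht⟩ := hlet 1
  have hsq : ∀ u v, Q u v → (u = x ∨ u = x⁻¹) → (v = y ∨ v = y⁻¹) → False := by
    rintro u v h (rfl | rfl) (rfl | rfl)
    · exact hQ h
    · exact hQ (by simpa using hinv2 _ _ h)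
    · exact hQ (by simpa using hinv _ _ h)
    · exact hQ (by simpa using hinv _ _ (hinv2 _ _ h))
  have nab : (of 0 : F2) ≠ of 1 ∧ (of 0 : F2) ≠ (of 1)⁻¹ := ⟨of_ne, by
    intro h; have := congrArg toWord h; revert this; decide⟩
  by_cases hij : i = j
  · subst hij
    rcases hinvl (i, e) (i, e') rfl with h | h
    · rw [h, ht] at hs; exact nab.1 hs.symm
    · rw [hs, ht] at h; exact nab.2 h
  · have hx : ∀ e, (f (mk [(0, e)])) = x ∨ (f (mk [(0, e)])) = x⁻¹ := by
      intro e; cases e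
      · exact Or.inr f0'
      · exact Or.inl f0
    have hy : ∀ e, (f (mk [(1, e)])) = y ∨ (f (mk [(1, e)])) = y⁻¹ := by
      intro e; cases e
      · exact Or.inr f1'
      · exact Or.inl f1
    have hc : (i = 0 ∧ j = 1) ∨ (i = 1 ∧ j = 0) := by
      clear * - hij
      revert i j; decide
    rcases hc with ⟨rfl, rfl⟩ | ⟨rfl, rfl⟩
    · have h3 := hx e
      have h4 := hy e'
      rw [hs] at h3; rw [ht] at h4
      exact hsq _ _ hbase h3 h4
    · have h3 := hx e'
      have h4 := hy e
      rw [ht] at h3; rw [hs] at h4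
      exact hsq _ _ (hswap _ _ hbase) h3 h4

end PPG

namespace PPG
open FreeGroup

abbrev Lt := Fin 2 × Bool

/-! ### Signed permutations of the basis -/

def IsSym (f : Equiv.Perm Lt) : Prop := ∀ i e, f (i, !e) = ((f (i, e)).1, !(f (i, e)).2)

instance (f : Equiv.Perm Lt) : Decidable (IsSym f) := by unfold IsSym; infer_instance

def symHom (f : Equiv.Perm Lt) : F2 →* F2 := lift fun i => mk [f (i, true)]

lemma mk_cons (s : Lt) (L : List Lt) : (mk (s :: L) : F2) = mk [s] * mk L := by
  rw [mul_mk]; rfl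

lemma symHom_letter {f : Equiv.Perm Lt} (hf : IsSym f) (s : Lt) : symHom f (mk [s]) = mk [f s] := by
  obtain ⟨i, e⟩ := s
  cases e
  · have h := hf i true
    simp only [Bool.not_true] at h
    rw [h]
    simp [symHom, invRev]
  · simp [symHom]

lemma symHom_mk {f : Equiv.Perm Lt} (hf : IsSym f) (L : List Lt) :
    symHom f (mk L) = mk (L.map f) := by
  induction L with
  | nil => simp [← one_eq_mk]
  | cons s L ih =>
    rw [mk_cons, _root_.map_mul, ih, symHom_letter hf, List.map_cons, ← mk_cons]

lemma IsSym.flip {f : Equiv.Perm Lt} (hf : IsSym f) (s : Lt) : f (s.1, !s.2) = ((f s).1, !(f s).2) :=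
  hf s.1 s.2

lemma IsSym.adj {f : Equiv.Perm Lt} (hf : IsSym f) {s t : Lt} (h : s.1 = t.1 → s.2 = t.2) :
    (f s).1 = (f t).1 → (f s).2 = (f t).2 := by
  intro h1
  by_contra h2
  have h3 : f s = f (t.1, !t.2) := by
    rw [hf.flip]; ext1
    · exact h1
    · simp only; revert h2; cases (f s).2 <;> cases (f t).2 <;> simp
  have h4 := f.injective h3
  have h5 := h (by rw [h4])
  rw [h4] at h5
  simp at h5

lemma isReduced_map {f : Equiv.Perm Lt} (hf : IsSym f) {L : List Lt} (h : FreeGroup.IsReduced L) :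
    FreeGroup.IsReduced (L.map f) := by
  unfold FreeGroup.IsReduced at *
  rw [List.isChain_map]
  exact h.imp fun s t => hf.adj

lemma toWord_symHom {f : Equiv.Perm Lt} (hf : IsSym f) (w : F2) :
    (symHom f w).toWord = w.toWord.map f := by
  conv_lhs => rw [← mk_toWord (x := w), symHom_mk hf, toWord_mk]
  exact (isReduced_map hf isReduced_toWord).reduce_eq

lemma IsSym.mul {f g : Equiv.Perm Lt} (hf : IsSym f) (hg : IsSym g) : IsSym (f * g) := by
  intro i e
  simp only [Equiv.Perm.mul_apply]
  rw [hg.flip (i, e), hf.flip]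

lemma IsSym.inv {f : Equiv.Perm Lt} (hf : IsSym f) : IsSym f⁻¹ := by
  intro i e
  apply f.injective
  rw [hf.flip]
  simp

lemma symHom_comp {f g : Equiv.Perm Lt} (hf : IsSym f) (hg : IsSym g) (w : F2) :
    symHom f (symHom g w) = symHom (f * g) w := by
  rw [← mk_toWord (x := w), symHom_mk hg, symHom_mk hf, symHom_mk (hf.mul hg)]
  simp

lemma isSym_one : IsSym 1 := fun i e => by simp

lemma symHom_one (w : F2) : symHom 1 w = w := by
  rw [← mk_toWord (x := w), symHom_mk isSym_one]; simp

/-- `a → B, b → A` -/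
def sg : Equiv.Perm Lt where
  toFun s := (s.1 + 1, !s.2)
  invFun s := (s.1 + 1, !s.2)
  left_inv := by decide
  right_inv := by decide
/-- `a → A` -/
def ta : Equiv.Perm Lt where
  toFun s := if s.1 = 0 then (s.1, !s.2) else s
  invFun s := if s.1 = 0 then (s.1, !s.2) else s
  left_inv := by decide
  right_inv := by decide
/-- `b → B` -/
def tb : Equiv.Perm Lt where
  toFun s := if s.1 = 1 then (s.1, !s.2) else s
  invFun s := if s.1 = 1 then (s.1, !s.2) else s
  left_inv := by decide
  right_inv := by decide
/-- inversion of both generators -/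
def io : Equiv.Perm Lt where
  toFun s := (s.1, !s.2)
  invFun s := (s.1, !s.2)
  left_inv := by decide
  right_inv := by decide

lemma sg_sym : IsSym sg := by decide
lemma ta_sym : IsSym ta := by decide
lemma tb_sym : IsSym tb := by decide
lemma io_sym : IsSym io := by decide

abbrev ga : F2 := of 0
abbrev gb : F2 := of 1

def Lh : F2 →* F2 := lift ![ga, ga * gb]
def Rh : F2 →* F2 := lift ![ga * gb, gb]
@[simp] lemma Lh_a : Lh ga = ga := by simp [Lh]
@[simp] lemma Lh_b : Lh gb = ga * gb := by simp [Lh]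
@[simp] lemma Rh_a : Rh ga = ga * gb := by simp [Rh]
@[simp] lemma Rh_b : Rh gb = gb := by simp [Rh]

lemma sg_a : symHom sg ga = gb⁻¹ := by simp [symHom, sg, invRev, of]
lemma sg_b : symHom sg gb = ga⁻¹ := by simp [symHom, sg, invRev, of]
lemma ta_a : symHom ta ga = ga⁻¹ := by simp [symHom, ta, invRev, of]
lemma ta_b : symHom ta gb = gb := by simp [symHom, ta, invRev, of]
lemma tb_a : symHom tb ga = ga := by simp [symHom, tb, invRev, of]
lemma tb_b : symHom tb gb = gb⁻¹ := by simp [symHom, tb, invRev, of]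
lemma io_a : symHom io ga = ga⁻¹ := by simp [symHom, io, invRev, of]
lemma io_b : symHom io gb = gb⁻¹ := by simp [symHom, io, invRev, of]

inductive PM : (F2 →* F2) → Prop
  | id : PM (MonoidHom.id _)
  | L (f : F2 →* F2) : PM f → PM (f.comp Lh)
  | R (f : F2 →* F2) : PM f → PM (f.comp Rh)

inductive Good : F2 → F2 → Prop
  | base (f : F2 →* F2) : PM f → Good (f ga) (f gb)
  | conj (g x y : F2) : Good x y → Good (g * x * g⁻¹) (g * y * g⁻¹)
  | swap (x y : F2) : Good x y → Good y x
  | inv (x y : F2) : Good x y → Good x⁻¹ y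
  | sym (f : Equiv.Perm Lt) (x y : F2) : IsSym f → Good x y → Good (symHom f x) (symHom f y)

lemma Good.inv2 {x y : F2} (h : Good x y) : Good x y⁻¹ := (h.swap.inv).swap
lemma Good.cast {x y x' y' : F2} (h : Good x y) (h1 : x = x') (h2 : y = y') : Good x' y' := by
  subst h1 h2; exact h
lemma Good.symm' {x y : F2} (h : Good x y) (f : Equiv.Perm Lt) (hf : IsSym f) :
    Good (symHom f x) (symHom f y) := Good.sym f x y hf h
lemma Good.swap' {x y : F2} (h : Good x y) : Good y x := h.swap

lemma Good.right {x y : F2} (h : Good x (x * y)) : Good x (y * x) :=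
  (h.conj x⁻¹).cast (by group) (by group)
lemma Good.left {x y : F2} (h : Good x (y * x)) : Good x (x * y) :=
  (h.conj x).cast (by group) (by group)

lemma good_L {f : F2 →* F2} (h : PM f) : Good (f ga) (f ga * f gb) :=
  (Good.base _ (PM.L f h)).cast (by simp) (by simp)
lemma good_R {f : F2 →* F2} (h : PM f) : Good (f ga * f gb) (f gb) :=
  (Good.base _ (PM.R f h)).cast (by simp) (by simp)

lemma good_all {x y : F2} (h : Good x y) :
    Good x (x * y) ∧ Good x (x⁻¹ * y) ∧ Good y (y * x) ∧ Good y (y⁻¹ * x) := by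
  induction h with
  | base f hf =>
    refine ⟨good_L hf, ?_, (good_R hf).swap'.left, ?_⟩
    · cases hf with
      | id =>
        have := ((Good.base _ (PM.L _ PM.id)).symm' ta ta_sym).inv
        refine this.cast ?_ ?_ <;> simp [ta_a, ta_b]
      | L f hf => exact (Good.base f hf).cast (by simp) (by simp)
      | R f hf =>
        exact ((good_L hf).swap'.inv2.conj (f ga * f gb)⁻¹).cast (by simp) (by simp [mul_assoc])
    · cases hf with
      | id =>
        have := ((Good.base _ (PM.R _ PM.id)).symm' tb tb_sym).swap'.inv.conj gb⁻¹
        refine this.cast ?_ ?_ <;> simp [tb_a, tb_b, mul_assoc]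
      | L f hf => exact (good_R hf).inv2.cast (by simp) (by simp)
      | R f hf => exact (((Good.base f hf).swap').conj (f gb)⁻¹).cast (by simp) (by simp [mul_assoc])
  | conj g x y _ ih =>
    obtain ⟨h1, h2, h3, h4⟩ := ih
    exact ⟨(h1.conj g).cast rfl (by group), (h2.conj g).cast rfl (by group),
      (h3.conj g).cast rfl (by group), (h4.conj g).cast rfl (by group)⟩
  | swap x y _ ih => exact ⟨ih.2.2.1, ih.2.2.2, ih.1, ih.2.1⟩
  | inv x y _ ih =>
    obtain ⟨h1, h2, h3, h4⟩ := ih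
    exact ⟨h2.inv, h1.inv.cast rfl (by simp),
      (h4.conj y).inv2.cast (by group) (by group),
      (h3.conj y⁻¹).inv2.cast (by group) (by group)⟩
  | sym f x y hf _ ih =>
    obtain ⟨h1, h2, h3, h4⟩ := ih
    exact ⟨(h1.symm' f hf).cast rfl (by simp), (h2.symm' f hf).cast rfl (by simp),
      (h3.symm' f hf).cast rfl (by simp), (h4.symm' f hf).cast rfl (by simp)⟩

lemma good_of_gen {x y : F2} (h : Gen x y) : Good x y :=
  nielsen Good (fun g _ _ h => h.conj g) (fun _ _ h => h.swap) (fun _ _ h => h.inv)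
    (fun _ _ h => (good_all h).1) ((Good.base _ PM.id).cast rfl rfl) _ x y rfl h

end PPG

namespace PPG
open FreeGroup

def tr (N : ℤ) : Option Bool → ℤ → Bool → Prop
  | none, _, true => True
  | none, k, false => k ≤ 0
  | some true, k, true => k ≤ N + 1
  | some false, k, false => k ≤ -N
  | some true, k, false => k ≤ -1
  | some false, k, true => k ≤ -1

def fin (N : ℤ) : Option Bool → ℤ → Prop
  | none, _ => True
  | some true, k => k ≤ N + 1
  | some false, k => k ≤ 0

def bs (e : Bool) : ℤ := if e then 1 else -1
@[simp] lemma bs_t : bs true = 1 := rfl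
@[simp] lemma bs_f : bs false = -1 := rfl

def ok (N : ℤ) : Option Bool → ℤ → List Lt → Prop
  | p, k, [] => fin N p k
  | p, k, s :: l => if s.1 = 0 then tr N p k s.2 ∧ ok N (some s.2) 0 l else ok N p (k + bs s.2) l

@[simp] lemma ok_nil (N p k) : ok N p k [] = fin N p k := rfl
@[simp] lemma ok_a (N p k e l) : ok N p k ((0, e) :: l) = (tr N p k e ∧ ok N (some e) 0 l) := rfl
@[simp] lemma ok_b (N p k e l) : ok N p k ((1, e) :: l) = ok N p (k + bs e) l := rfl

lemma lt_cases (s : Lt) : (∃ e, s = (0, e)) ∨ (∃ e, s = (1, e)) := by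
  obtain ⟨i, e⟩ := s
  fin_cases i
  · exact Or.inl ⟨e, rfl⟩
  · exact Or.inr ⟨e, rfl⟩

lemma ok_cancel (N : ℤ) (p k) (s : Lt) (l) (h : ok N p k (s :: (s.1, !s.2) :: l)) : ok N p k l := by
  rcases lt_cases s with ⟨e, rfl⟩ | ⟨e, rfl⟩
  · cases e <;> simp [tr] at h
  · cases e <;> simpa using h

lemma ok_step (N : ℤ) {l l' : List Lt} (h : Red.Step l l') : ∀ p k, ok N p k l → ok N p k l' := by
  obtain ⟨⟩ := h
  rename_i L1 L2 x b
  induction L1 with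
  | nil => intro p k; exact ok_cancel N p k (x, b) L2
  | cons s L ih =>
    intro p k
    rcases lt_cases s with ⟨e, rfl⟩ | ⟨e, rfl⟩
    · simp only [List.cons_append, ok_a]; exact fun h => ⟨h.1, ih _ _ h.2⟩
    · simp only [List.cons_append, ok_b]; exact ih _ _

lemma ok_red (N : ℤ) {l l' : List Lt} (h : Red l l') (p k) : ok N p k l → ok N p k l' := by
  induction h with
  | refl => exact id
  | tail _ h ih => exact fun h' => ok_step N h _ _ (ih h')

def X (N : ℤ) (w : F2) : Prop := ok N none 0 w.toWord

lemma X_of (N : ℤ) (l : List Lt) (h : ok N none 0 l) : X N (mk l) := by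
  unfold X; rw [toWord_mk]; exact ok_red N reduce.red _ _ h

def Rl : List Lt → List Lt
  | [] => []
  | s :: l => (if s.1 = 0 then (if s.2 then [(0, true), (1, true)] else [(1, false), (0, false)])
      else [s]) ++ Rl l

lemma mk_Rl (l : List Lt) : (mk (Rl l) : F2) = Rh (mk l) := by
  induction l with
  | nil => simp [Rl, ← one_eq_mk]
  | cons s l ih =>
    rw [mk_cons, _root_.map_mul, ← ih, Rl, ← mul_mk]
    congr 1
    rcases lt_cases s with ⟨e, rfl⟩ | ⟨e, rfl⟩
    · cases e
      · have : (mk [(0, false)] : F2) = ga⁻¹ := by simp [of, invRev]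
        rw [this, _root_.map_inv, Rh_a]; simp [of, invRev]
      · have : (mk [(0, true)] : F2) = ga := rfl
        rw [this, Rh_a]; simp [of]
    · cases e
      · have : (mk [(1, false)] : F2) = gb⁻¹ := by simp [of, invRev]
        simp [this]
      · have : (mk [(1, true)] : F2) = gb := rfl
        simp [this]

def sh : Option Bool → ℤ
  | some true => 1
  | _ => 0

lemma ok_R (N : ℤ) (l : List Lt) : ∀ p k, ok N p k l → ok (N + 1) p (k + sh p) (Rl l) := by
  induction l with
  | nil => rintro (_ | _ | _) k <;> simp [fin, sh, Rl]
  | cons s l ih =>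
    intro p k h
    rcases lt_cases s with ⟨e, rfl⟩ | ⟨e, rfl⟩
    · rw [ok_a] at h
      have := ih _ _ h.2
      obtain ⟨h, -⟩ := h
      cases e
      · simp only [Rl, if_true, sh] at *
        simp
        refine ⟨?_, by simpa using this⟩
        rcases p with _ | _ | _ <;> simp [tr, sh] at * <;> omega
      · simp only [Rl, if_true, sh] at *
        simp
        refine ⟨?_, by simpa using this⟩
        rcases p with _ | _ | _ <;> simp [tr, sh] at * <;> omega
    · rw [ok_b] at h
      have := ih _ _ h
      simp [Rl]
      convert this using 1; ring

lemma X_R {N : ℤ} {w : F2} (h : X N w) : X (N + 1) (Rh w) := by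
  have := ok_R N _ _ _ h
  rw [← mk_toWord (x := w), ← mk_Rl]
  exact X_of _ _ (by simpa [sh] using this)

/-- consecutive letters with no `bA`, `Ab` -/
def nb (s t : Lt) : Prop := ¬ (s = (1, true) ∧ t = (0, false)) ∧ ¬ (s = (0, false) ∧ t = (1, true))

/-- reduced and no `bA`, `Ab`, `AA` -/
def r1 (s t : Lt) : Prop := (s.1 = t.1 → s.2 = t.2) ∧ nb s t ∧ ¬ (s = (0, false) ∧ t = (0, false))
def r2 (s t : Lt) : Prop := (s.1 = t.1 → s.2 = t.2) ∧ nb s t ∧ ¬ (s = (1, true) ∧ t = (1, true))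

/-- compatibility of the state with the previous letter -/
def cmp (s : Lt) (p : Option Bool) (k : ℤ) : Prop :=
  (s.1 = 0 → p = some s.2 ∧ k = 0) ∧ (s.1 = 1 → s.2 = true → 0 < k) ∧
  (s.1 = 1 → s.2 = false → k < 0)

lemma ok_neg_pos {N : ℤ} (hN : 1 ≤ N) (k : ℤ) (hk : 0 < k) (l : List Lt)
    (hl : FreeGroup.IsReduced ((1, true) :: l)) :
    ¬ ok N (some false) k l := by
  induction l generalizing k with
  | nil => simp [fin]; omega
  | cons s l ih =>
    intro h
    rcases lt_cases s with ⟨e, rfl⟩ | ⟨e, rfl⟩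
    · cases e <;> simp [tr] at h <;> omega
    · rw [isReduced_cons_cons] at hl
      simp at hl
      obtain ⟨rfl, hl⟩ := hl
      exact ih (k + 1) (by omega) hl (by simpa using h)

lemma lem1_aux {N : ℤ} (hN : 1 ≤ N) (l : List Lt) : ∀ s p k, cmp s p k → ok N p k l →
    FreeGroup.IsReduced (s :: l) → List.IsChain r1 (s :: l) := by
  induction l with
  | nil => intros; simp
  | cons t l ih =>
    intro s p k hc h hr
    rw [isReduced_cons_cons] at hr
    rw [List.isChain_cons_cons]
    obtain ⟨h1, h2, h3⟩ := hc
    obtain ⟨hst, hr⟩ := hr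
    rcases lt_cases t with ⟨e, rfl⟩ | ⟨e, rfl⟩
    · rw [ok_a] at h
      refine ⟨⟨hst, ?_⟩, ih _ (some e) 0 ⟨by simp, by simp, by simp⟩ h.2 hr⟩
      obtain ⟨h, -⟩ := h
      cases e
      · unfold nb
        rcases lt_cases s with ⟨e, rfl⟩ | ⟨e, rfl⟩
        · simp at h1; obtain ⟨rfl, rfl⟩ := h1
          cases e
          · simp [tr] at h; omega
          · simp
        · cases e
          · simp
          · simp at h2
            rcases p with _ | _ | _ <;> simp [tr] at h <;> omega
      · simp [nb]
    · rw [ok_b] at h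
      refine ⟨⟨hst, ?_⟩, ih _ p (k + bs e) ⟨by simp, ?_, ?_⟩ h hr⟩
      · unfold nb
        refine ⟨⟨by simp, ?_⟩, by simp⟩
        rintro ⟨rfl, h5⟩
        simp at h5; subst h5
        simp at h1; obtain ⟨rfl, rfl⟩ := h1
        exact ok_neg_pos hN 1 (by norm_num) l hr (by simpa using h)
      · rintro - h5; simp at h5; subst h5
        rcases lt_cases s with ⟨e, rfl⟩ | ⟨e, rfl⟩
        · simp at h1; simp; omega
        · simp at hst; subst hst; simp at h2; simp; omega
      · rintro - h5; simp at h5; subst h5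
        rcases lt_cases s with ⟨e, rfl⟩ | ⟨e, rfl⟩
        · simp at h1; simp; omega
        · simp at hst; subst hst; simp at h3; simp; omega

lemma lem1 {N : ℤ} (hN : 1 ≤ N) (l : List Lt) (h : ok N none 0 l)
    (hr : FreeGroup.IsReduced l) : List.IsChain r1 l := by
  cases l with
  | nil => simp
  | cons s l =>
    rcases lt_cases s with ⟨e, rfl⟩ | ⟨e, rfl⟩
    · rw [ok_a] at h
      exact lem1_aux hN l _ (some e) 0 ⟨by simp, by simp, by simp⟩ h.2 hr
    · rw [ok_b] at h
      exact lem1_aux hN l _ none (0 + bs e) ⟨by simp, by rintro - h; simp at h; simp [h],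
        by rintro - h; simp at h; simp [h]⟩ h hr

/-- state invariant for lemma 2 -/
def inv2 (s : Lt) (p : Option Bool) (k : ℤ) : Prop :=
  (s.1 = 0 → p = some s.2 ∧ k = 0) ∧ (s = (1, true) → k = 1 ∧ p ≠ some false) ∧
  (s = (1, false) → k < 0)

lemma lem2_aux (l : List Lt) : ∀ s p k, inv2 s p k → List.IsChain r2 (s :: l) → ok 0 p k l := by
  induction l with
  | nil =>
    intro s p k ⟨h1, h2, h3⟩ _
    rcases lt_cases s with ⟨e, rfl⟩ | ⟨e, rfl⟩
    · simp at h1; obtain ⟨rfl, rfl⟩ := h1; cases e <;> simp [fin]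
    · cases e
      · simp at h3; rcases p with _ | _ | _ <;> simp [fin] <;> omega
      · simp at h2; rcases p with _ | _ | _ <;> simp [fin] at * <;> omega
  | cons t l ih =>
    intro s p k ⟨h1, h2, h3⟩ hr
    rw [List.isChain_cons_cons] at hr
    obtain ⟨⟨hst, ⟨n1, n2⟩, n3⟩, hr⟩ := hr
    rcases lt_cases t with ⟨e, rfl⟩ | ⟨e, rfl⟩
    · rw [ok_a]
      refine ⟨?_, ih _ _ _ ⟨by simp, by simp, by simp⟩ hr⟩
      rcases lt_cases s with ⟨e', rfl⟩ | ⟨e', rfl⟩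
      · simp at h1; obtain ⟨rfl, rfl⟩ := h1; simp at hst; subst hst; cases e' <;> simp [tr]
      · cases e'
        · simp at h3; rcases p with _ | _ | _ <;> cases e <;> simp [tr] at * <;> omega
        · simp at h2; rcases p with _ | _ | _ <;> cases e <;> simp [tr] at * <;> omega
    · rw [ok_b]
      refine ih _ _ _ ⟨by simp, ?_, ?_⟩ hr
      · intro h; simp at h; subst h
        rcases lt_cases s with ⟨e', rfl⟩ | ⟨e', rfl⟩
        · simp at h1; obtain ⟨rfl, rfl⟩ := h1; simp at n2; simp [n2]
        · simp at hst; subst hst; simp at n3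
      · intro h; simp at h; subst h
        rcases lt_cases s with ⟨e', rfl⟩ | ⟨e', rfl⟩
        · simp at h1; obtain ⟨rfl, rfl⟩ := h1; simp
        · simp at hst; subst hst; simp at h3; simp; omega

lemma lem2 (l : List Lt) (h : List.IsChain r2 l) : ok 0 none 0 l := by
  cases l with
  | nil => simp [fin]
  | cons s l =>
    rcases lt_cases s with ⟨e, rfl⟩ | ⟨e, rfl⟩
    · rw [ok_a]
      exact ⟨by cases e <;> simp [tr], lem2_aux l _ _ _ ⟨by simp, by simp, by simp⟩ h⟩
    · rw [ok_b]
      exact lem2_aux l _ _ _ ⟨by simp, by intro h; simp at h; simp [h],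
        by intro h; simp at h; simp [h]⟩ h

instance (s t : Lt) : Decidable (nb s t) := by unfold nb; infer_instance
instance (s t : Lt) : Decidable (r1 s t) := by unfold r1; infer_instance
instance (s t : Lt) : Decidable (r2 s t) := by unfold r2; infer_instance

lemma r1_sg {s t : Lt} (h : r1 s t) : r2 (sg s) (sg t) := by
  have : ∀ s t : Lt, r1 s t → r2 (sg s) (sg t) := by decide
  exact this s t h

lemma X_flip {N : ℤ} (hN : 1 ≤ N) {w : F2} (h : X N w) : X 0 (symHom sg w) := by
  unfold X
  rw [toWord_symHom sg_sym]
  apply lem2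
  rw [List.isChain_map]
  exact (lem1 hN _ h isReduced_toWord).imp fun s t => r1_sg

lemma sg_sg (w : F2) : symHom sg (symHom sg w) = w := by
  rw [symHom_comp sg_sym sg_sym]
  have : sg * sg = 1 := by decide
  rw [this, symHom_one]

lemma Lh_eq (w : F2) : Lh w = symHom sg (Rh (symHom sg w)) := by
  have : Lh = ((symHom sg).comp Rh).comp (symHom sg) := by
    apply FreeGroup.ext_hom
    intro i; fin_cases i
    · change Lh ga = symHom sg (Rh (symHom sg ga)); simp [sg_a, sg_b]
    · change Lh gb = symHom sg (Rh (symHom sg gb)); simp [sg_a, sg_b]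
  rw [this]; rfl

def PP (v : F2) : Prop := ∃ N : ℤ, 1 ≤ N ∧
  ((∀ k : ℕ, X N (v ^ k)) ∨ (∀ k : ℕ, X N (symHom sg (v ^ k))))

lemma PP_R {v : F2} (h : PP v) : PP (Rh v) := by
  obtain ⟨N, hN, h | h⟩ := h
  · exact ⟨N + 1, by omega, Or.inl fun k => by rw [← map_pow]; exact X_R (h k)⟩
  · refine ⟨1, le_rfl, Or.inl fun k => ?_⟩
    rw [← map_pow]
    have := X_flip hN (h k)
    rw [sg_sg] at this
    simpa using X_R this

lemma PP_sg {v : F2} (h : PP v) : PP (symHom sg v) := by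
  obtain ⟨N, hN, h | h⟩ := h
  · exact ⟨N, hN, Or.inr fun k => by rw [← map_pow, sg_sg]; exact h k⟩
  · exact ⟨N, hN, Or.inl fun k => by rw [← map_pow]; exact h k⟩

lemma PP_L {v : F2} (h : PP v) : PP (Lh v) := by
  rw [Lh_eq]; exact PP_sg (PP_R (PP_sg h))

lemma PP_PM {f : F2 →* F2} (hf : PM f) : ∀ v, PP v → PP (f v) := by
  induction hf with
  | id => exact fun v h => h
  | L f _ ih => exact fun v h => ih _ (PP_L h)
  | R f _ ih => exact fun v h => ih _ (PP_R h)

lemma ok_base (l : List Lt) (h : ∀ s ∈ l, s = (0, true) ∨ s = (1, false)) :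
    ∀ p k, p ≠ some false → k ≤ 0 → ok 1 p k l := by
  induction l with
  | nil => rintro (_ | _ | _) k hp hk <;> simp [fin] at * ; omega
  | cons s l ih =>
    intro p k hp hk
    have ih := ih fun s hs => h s (List.mem_cons_of_mem _ hs)
    rcases h s (List.mem_cons_self) with rfl | rfl
    · rw [ok_a]
      refine ⟨?_, ih _ _ (by simp) le_rfl⟩
      rcases p with _ | _ | _ <;> simp [tr] at *; omega
    · rw [ok_b]; exact ih _ _ hp (by simp; omega)

lemma X_base {v : F2} (h : v ∈ Submonoid.closure {ga, gb⁻¹}) : X 1 v := by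
  have : ∃ l : List Lt, v = mk l ∧ ∀ s ∈ l, s = (0, true) ∨ s = (1, false) := by
    induction h using Submonoid.closure_induction with
    | mem x hx =>
      rcases hx with rfl | hx
      · exact ⟨[(0, true)], rfl, by simp⟩
      · rw [Set.mem_singleton_iff] at hx
        exact ⟨[(1, false)], by simp [hx, of, invRev], by simp⟩
    | one => exact ⟨[], rfl, by simp⟩
    | mul x y _ _ hx hy =>
      obtain ⟨l, rfl, hl⟩ := hx
      obtain ⟨m, rfl, hm⟩ := hy
      exact ⟨l ++ m, by rw [mul_mk], by
        intro s hs; rcases List.mem_append.1 hs with h | h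
        · exact hl s h
        · exact hm s h⟩
  obtain ⟨l, rfl, hl⟩ := this
  exact X_of _ _ (ok_base l hl _ _ (by simp) le_rfl)

lemma PP_base {v : F2} (h : v ∈ Submonoid.closure {ga, gb⁻¹}) : PP v :=
  ⟨1, le_rfl, Or.inl fun k => X_base (Submonoid.pow_mem _ h k)⟩

def Nice (w : F2) : Prop := ∃ (g : F2) (f : Equiv.Perm Lt) (v : F2) (N : ℤ), IsSym f ∧ 1 ≤ N ∧
  w = g * symHom f v * g⁻¹ ∧ ∀ k : ℕ, X N (v ^ k)

lemma PP.nice {v : F2} (h : PP v) : Nice v := by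
  obtain ⟨N, hN, h | h⟩ := h
  · exact ⟨1, 1, v, N, isSym_one, hN, by simp [symHom_one], h⟩
  · exact ⟨1, sg, symHom sg v, N, sg_sym, hN, by simp [sg_sg], by simpa using h⟩

lemma Nice.conj {w : F2} (h : Nice w) (g : F2) : Nice (g * w * g⁻¹) := by
  obtain ⟨g', f, v, N, hf, hN, rfl, h⟩ := h
  exact ⟨g * g', f, v, N, hf, hN, by group, h⟩

lemma Nice.sym {w : F2} (h : Nice w) (f : Equiv.Perm Lt) (hf : IsSym f) : Nice (symHom f w) := by
  obtain ⟨g', f', v, N, hf', hN, rfl, h⟩ := h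
  exact ⟨symHom f g', f * f', v, N, hf.mul hf', hN, by simp [symHom_comp hf hf'], h⟩

lemma clos_map (f : F2 →* F2) (x y w : F2) (h : w ∈ Submonoid.closure {f x, f y}) :
    ∃ v ∈ Submonoid.closure {x, y}, f v = w := by
  have : ({f x, f y} : Set F2) = f '' {x, y} := by simp [Set.image_pair]
  rw [this, ← MonoidHom.map_mclosure] at h
  exact h

lemma clos_conj (g x y w : F2) (h : w ∈ Submonoid.closure {g * x * g⁻¹, g * y * g⁻¹}) :
    ∃ v ∈ Submonoid.closure {x, y}, w = g * v * g⁻¹ := by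
  obtain ⟨v, hv, h⟩ := clos_map (MulAut.conj g).toMonoidHom x y w (by simpa using h)
  exact ⟨v, hv, by rw [← h]; simp⟩

def C (x y : F2) : Prop := ∀ w ∈ Submonoid.closure {x, y}, Nice w

lemma PM_io {f : F2 →* F2} (hf : PM f) : ∃ g : F2, (f ga)⁻¹ = g * symHom io (f ga) * g⁻¹ ∧
    (f gb)⁻¹ = g * symHom io (f gb) * g⁻¹ := by
  induction hf with
  | id => exact ⟨1, by simp [io_a], by simp [io_b]⟩
  | L f _ ih =>
    obtain ⟨g, h1, h2⟩ := ih
    have e1 : symHom io (f ga) = g⁻¹ * (f ga)⁻¹ * g := by rw [h1]; group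
    have e2 : symHom io (f gb) = g⁻¹ * (f gb)⁻¹ * g := by rw [h2]; group
    refine ⟨(f ga) * g, ?_, ?_⟩
    · simp only [MonoidHom.comp_apply, Lh_a, e1]; group
    · simp only [MonoidHom.comp_apply, Lh_b, _root_.map_mul, e1, e2]; group
  | R f _ ih =>
    obtain ⟨g, h1, h2⟩ := ih
    have e1 : symHom io (f ga) = g⁻¹ * (f ga)⁻¹ * g := by rw [h1]; group
    have e2 : symHom io (f gb) = g⁻¹ * (f gb)⁻¹ * g := by rw [h2]; group
    refine ⟨(f gb)⁻¹ * g, ?_, ?_⟩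
    · simp only [MonoidHom.comp_apply, Rh_a, _root_.map_mul, e1, e2]; group
    · simp only [MonoidHom.comp_apply, Rh_b, e2]; group

lemma C_conj {x y : F2} (g : F2) (h : C x y) : C (g * x * g⁻¹) (g * y * g⁻¹) := by
  intro w hw
  obtain ⟨v, hv, rfl⟩ := clos_conj g x y w hw
  exact (h v hv).conj g

lemma C_sym {x y : F2} (f : Equiv.Perm Lt) (hf : IsSym f) (h : C x y) :
    C (symHom f x) (symHom f y) := by
  intro w hw
  obtain ⟨v, hv, rfl⟩ := clos_map _ x y w hw
  exact (h v hv).sym f hf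

lemma C_swap {x y : F2} (h : C x y) : C y x := by
  intro w hw; rw [Set.pair_comm] at hw; exact h w hw

lemma C_base {f : F2 →* F2} (hf : PM f) : C (f ga) (f gb)⁻¹ := by
  intro w hw
  rw [← _root_.map_inv] at hw
  obtain ⟨v, hv, rfl⟩ := clos_map _ _ _ w hw
  exact (PP_PM hf v (PP_base hv)).nice

lemma PM_pos {f : F2 →* F2} (hf : PM f) : f ga ∈ Submonoid.closure {ga, gb} ∧
    f gb ∈ Submonoid.closure {ga, gb} := by
  induction hf with
  | id => exact ⟨Submonoid.subset_closure (by simp), Submonoid.subset_closure (by simp)⟩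
  | L f _ ih => simp; exact ⟨ih.1, Submonoid.mul_mem _ ih.1 ih.2⟩
  | R f _ ih => simp; exact ⟨Submonoid.mul_mem _ ih.1 ih.2, ih.2⟩

lemma C_pos {f : F2 →* F2} (hf : PM f) : C (f ga) (f gb) := by
  intro w hw
  have h1 : w ∈ Submonoid.closure {ga, gb} := by
    refine (Submonoid.closure_le.2 ?_) hw
    rintro x (rfl | rfl)
    · exact (PM_pos hf).1
    · exact (PM_pos hf).2
  have h2 : w ∈ Submonoid.closure {symHom tb ga, symHom tb gb⁻¹} := by
    simpa [tb_a, tb_b] using h1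
  obtain ⟨v, hv, rfl⟩ := clos_map _ _ _ w h2
  exact (PP_base hv).nice.sym tb tb_sym

lemma good_C {x y : F2} (h : Good x y) : C x y ∧ C x⁻¹ y⁻¹ ∧ C x y⁻¹ ∧ C x⁻¹ y := by
  induction h with
  | base f hf =>
    obtain ⟨g, h1, h2⟩ := PM_io hf
    have h2' : f gb = g * symHom io (f gb)⁻¹ * g⁻¹ := by
      have e2 : symHom io (f gb) = g⁻¹ * (f gb)⁻¹ * g := by rw [h2]; group
      rw [_root_.map_inv, e2]; group
    refine ⟨C_pos hf, ?_, C_base hf, ?_⟩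
    · rw [h1, h2]; exact C_conj g (C_sym io io_sym (C_pos hf))
    · rw [h1]
      have := C_conj g (C_sym io io_sym (C_base hf))
      rwa [← h2'] at this
  | conj g x y _ ih =>
    obtain ⟨c1, c2, c3, c4⟩ := ih
    have := C_conj g c1; have := C_conj g c2; have := C_conj g c3; have := C_conj g c4
    simp only [conj_inv] at *
    refine ⟨?_, ?_, ?_, ?_⟩ <;> assumption
  | swap x y _ ih =>
    obtain ⟨c1, c2, c3, c4⟩ := ih
    exact ⟨C_swap c1, C_swap c2, C_swap c4, C_swap c3⟩
  | inv x y _ ih =>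
    obtain ⟨c1, c2, c3, c4⟩ := ih
    rw [inv_inv]
    exact ⟨c4, c3, c2, c1⟩
  | sym f x y hf _ ih =>
    obtain ⟨c1, c2, c3, c4⟩ := ih
    simp only [← _root_.map_inv]
    exact ⟨C_sym f hf c1, C_sym f hf c2, C_sym f hf c3, C_sym f hf c4⟩

theorem nice_of_potPos {w : F2} (h : PotPos2 w) : Nice w := by
  obtain ⟨φ, h⟩ := h
  unfold Positive2 at h
  have hr : Set.range (FreeGroup.of : Fin 2 → F2) = {φ (φ.symm ga), φ (φ.symm gb)} := by
    ext x; simp [Fin.exists_fin_two, eq_comm]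
  rw [hr] at h
  obtain ⟨v, hv, hvw⟩ := clos_map φ.toMonoidHom _ _ _ h
  have : v = w := φ.injective hvw
  subst this
  refine (good_C (good_of_gen ?_)).1 v hv
  intro H h1 h2
  rw [eq_top_iff]
  intro z _
  have h3 : Subgroup.closure (Set.range (FreeGroup.of : Fin 2 → F2)) ≤ H.comap φ.symm.toMonoidHom := by
    rw [Subgroup.closure_le]
    rintro _ ⟨i, rfl⟩
    fin_cases i
    · exact h1
    · exact h2
  rw [FreeGroup.closure_range_of] at h3
  have : φ z ∈ H.comap φ.symm.toMonoidHom := h3 trivial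
  simpa using this

end PPG

namespace PPG
open FreeGroup

lemma red_left (M : List Lt) (H : List Lt) : ∀ D : List Lt, H.length ≤ D.length →
    FreeGroup.IsReduced (D ++ M) →
    ∃ E, D.length ≤ E.length + H.length ∧ reduce (H ++ (D ++ M)) = E ++ M := by
  induction H with
  | nil => intro D _ h; exact ⟨D, by simp, h.reduce_eq⟩
  | cons s H ih =>
    intro D hl h
    simp at hl
    obtain ⟨E, hE, h1⟩ := ih D (by omega) h
    rw [List.cons_append, reduce.cons, h1]
    cases E with
    | nil => simp at hE; omega
    | cons t E =>
      simp only [List.cons_append]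
      split_ifs
      · exact ⟨E, by simp at *; omega, rfl⟩
      · exact ⟨s :: t :: E, by simp at *; omega, rfl⟩

lemma red_both (H D1 M D2 H' : List Lt) (h1 : H.length ≤ D1.length) (h2 : H'.length ≤ D2.length)
    (h : FreeGroup.IsReduced (D1 ++ M ++ D2)) :
    M <:+: reduce (H ++ (D1 ++ M ++ D2) ++ H') := by
  rw [List.append_assoc] at h
  obtain ⟨E, -, hE⟩ := red_left (M ++ D2) H D1 h1 h
  have hr : FreeGroup.IsReduced (E ++ (M ++ D2)) := by
    rw [← hE]; exact isReduced_iff_reduce_eq.2 reduce.idem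
  have e1 : reduce (H ++ (D1 ++ M ++ D2) ++ H') = reduce (E ++ M ++ D2 ++ H') := by
    rw [← reduce_append_reduce_reduce, List.append_assoc D1, hE,
      ← reduce_append_reduce_reduce (L₁ := E ++ M ++ D2), List.append_assoc E M D2, hr.reduce_eq]
  have hr2 : FreeGroup.IsReduced (invRev D2 ++ invRev (E ++ M)) := by
    rw [← invRev_append, isReduced_iff_reduce_eq, reduce_invRev, List.append_assoc, hr.reduce_eq]
  obtain ⟨E', -, hE'⟩ := red_left (invRev (E ++ M)) (invRev H') (invRev D2) (by simpa using h2) hr2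
  have e2 : reduce (E ++ M ++ D2 ++ H') = E ++ M ++ invRev E' := by
    have : invRev (E ++ M ++ D2 ++ H') = invRev H' ++ (invRev D2 ++ invRev (E ++ M)) := by
      simp only [invRev_append, List.append_assoc]
    rw [← invRev_invRev (L₁ := E ++ M ++ D2 ++ H'), this, reduce_invRev, hE', invRev_append,
      invRev_invRev]
  rw [e1, e2]
  exact ⟨E, invRev E', rfl⟩

lemma mk_flatten (c : List Lt) (k : ℕ) : (mk (List.replicate k c).flatten : F2) = mk c ^ k := by
  rw [pow_mk]

theorem core {w : F2} (h : Nice w) : ∃ (p d : List Lt) (f : Equiv.Perm Lt) (N : ℤ) (l : List Lt),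
    1 ≤ N ∧ w.toWord = p ++ d.map f ++ invRev p ∧ FreeGroup.IsReduced l ∧
    ok N none 0 l ∧ d <:+: l := by
  obtain ⟨g, f, v, N, hf, hN, hw, hX⟩ := h
  obtain ⟨p, hp⟩ : ∃ p, p = reduceCyclically.conjugator w.toWord := ⟨_, rfl⟩
  obtain ⟨c, hc⟩ : ∃ c, c = reduceCyclically w.toWord := ⟨_, rfl⟩
  have hwc : w.toWord = p ++ c ++ invRev p := by
    rw [hp, hc]; exact (reduceCyclically.conj_conjugator_reduceCyclically _).symm
  have hcr : IsCyclicallyReduced c := by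
    rw [hc]; exact reduceCyclically.isCyclicallyReduced isReduced_toWord
  have hcf : ∀ k, FreeGroup.IsReduced (List.replicate k c).flatten := fun k =>
    (hcr.flatten_replicate k).isReduced
  let h : F2 := g⁻¹ * mk p
  let m := FreeGroup.norm h
  have key : ∀ k : ℕ, symHom f (v ^ k) = h * mk c ^ k * h⁻¹ := by
    intro k
    have e1 : mk c = (mk p)⁻¹ * w * mk p := by
      rw [← mk_toWord (x := w), hwc, ← mul_mk, ← mul_mk, ← inv_mk]; group
    have e2 : mk c = h⁻¹ * symHom f v * h := by
      rw [e1, hw]; simp only [h]; group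
    have e3 := conj_pow (i := k) (b := symHom f v) (a := h⁻¹)
    rw [e2, map_pow]
    rw [inv_inv] at e3
    rw [e3]; group
  refine ⟨p, c.map (f⁻¹ : Equiv.Perm Lt), f, N, (v ^ (2 * m + 1)).toWord, hN, ?_, isReduced_toWord,
    hX _, ?_⟩
  · rw [hwc]; simp
  · have : c <:+: (symHom f (v ^ (2 * m + 1))).toWord := by
      by_cases hc0 : c = []
      · rw [hc0]; exact ⟨[], _, rfl⟩
      have hl : m ≤ ((List.replicate m c).flatten).length := by
        have : 0 < c.length := List.length_pos_iff.2 hc0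
        simp; nlinarith
      have e : (List.replicate (2 * m + 1) c).flatten =
          (List.replicate m c).flatten ++ c ++ (List.replicate m c).flatten := by
        have : 2 * m + 1 = m + (1 + m) := by ring
        rw [this, List.replicate_add, List.replicate_add, List.flatten_append, List.flatten_append]
        simp
      have := red_both h.toWord _ c (List.replicate m c).flatten (h⁻¹).toWord hl (by
        rw [toWord_inv, invRev_length]; exact hl) (by rw [← e]; exact hcf _)
      rw [← e] at this
      convert this using 1
      rw [key, ← mk_flatten, toWord_mul, toWord_mul, toWord_mk, (hcf _).reduce_eq]
      rw [← reduce_append_reduce_reduce, reduce.idem, reduce_append_reduce_reduce]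
    rw [toWord_symHom hf] at this
    have := this.map (f⁻¹ : Equiv.Perm Lt)
    simpa using this

/-! ### automata -/

section Automata
variable {S : Type*} (al : S → Lt → Prop) (nx : S → Lt → S) (fi : S → Prop)

def acc : S → List Lt → Prop
  | s, [] => fi s
  | s, x :: l => al s x ∧ acc (nx s x) l

open Classical in
noncomputable def words : S → ℕ → Finset (List Lt)
  | s, 0 => if fi s then {[]} else ∅
  | s, n + 1 => Finset.univ.biUnion fun x =>
      if al s x then (words (nx s x) n).image (List.cons x) else ∅

lemma mem_words (l : List Lt) : ∀ (s : S) (n : ℕ), l ∈ words al nx fi s n ↔ l.length = n ∧ acc al nx fi s l := by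
  induction l with
  | nil =>
    intro s n
    cases n with
    | zero => by_cases h : fi s <;> simp [words, acc, h]
    | succ n =>
      simp only [words, Finset.mem_biUnion]
      constructor
      · rintro ⟨x, -, hx⟩; split_ifs at hx <;> simp at hx
      · rintro ⟨h, -⟩; simp at h
  | cons y l ih =>
    intro s n
    cases n with
    | zero => by_cases h : fi s <;> simp [words, h]
    | succ n =>
      simp only [words, Finset.mem_biUnion, acc]
      constructor
      · rintro ⟨x, -, hx⟩
        split_ifs at hx with ha
        · rw [Finset.mem_image] at hx
          obtain ⟨l', h1, h2⟩ := hx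
          obtain ⟨rfl, rfl⟩ := List.cons.inj h2
          rw [ih] at h1
          exact ⟨by simp [h1.1], ha, h1.2⟩
        · simp at hx
      · rintro ⟨h, ha, h2⟩
        refine ⟨y, Finset.mem_univ _, ?_⟩
        rw [if_pos ha, Finset.mem_image]
        exact ⟨l, (ih _ _).2 ⟨by simpa using h, h2⟩, rfl⟩

open Classical in
lemma card_words_succ (s : S) (n : ℕ) : (words al nx fi s (n + 1)).card =
    ∑ x, if al s x then (words al nx fi (nx s x) n).card else 0 := by
  rw [words, Finset.card_biUnion]
  · refine Finset.sum_congr rfl fun x _ => ?_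
    split_ifs
    · exact Finset.card_image_of_injective _ (List.cons_injective)
    · rfl
  · intro x _ y _ hxy
    rw [Function.onFun, Finset.disjoint_left]
    intro l h1 h2
    split_ifs at h1 h2
    · rw [Finset.mem_image] at h1 h2
      obtain ⟨l1, -, rfl⟩ := h1
      obtain ⟨l2, -, h2⟩ := h2
      exact hxy (List.cons.inj h2).1.symm
    all_goals simp at h1 h2

open Classical in
lemma card_words_le (I : S → Prop) (B : S → ℕ → ℝ) (hI : ∀ s x, I s → al s x → I (nx s x))
    (h0 : ∀ s, I s → 0 ≤ B s 0) (h0' : ∀ s, I s → fi s → 1 ≤ B s 0)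
    (h1 : ∀ s n, I s → (∑ x, if al s x then B (nx s x) n else 0) ≤ B s (n + 1)) :
    ∀ n s, I s → ((words al nx fi s n).card : ℝ) ≤ B s n := by
  intro n
  induction n with
  | zero =>
    intro s hs
    by_cases h : fi s
    · simpa [words, h] using h0' s hs h
    · simpa [words, h] using h0 s hs
  | succ n ih =>
    intro s hs
    rw [card_words_succ]
    refine le_trans ?_ (h1 s n hs)
    push_cast
    refine Finset.sum_le_sum fun x _ => ?_
    split_ifs with h
    · exact ih _ (hI s x hs h)
    · exact le_rfl

open Classical in
lemma card_words_ge (I : S → Prop) (B : S → ℕ → ℝ) (hI : ∀ s x, I s → al s x → I (nx s x))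
    (h0 : ∀ s, I s → fi s ∧ B s 0 ≤ 1)
    (h1 : ∀ s n, I s → B s (n + 1) ≤ (∑ x, if al s x then B (nx s x) n else 0)) :
    ∀ n s, I s → B s n ≤ ((words al nx fi s n).card : ℝ) := by
  intro n
  induction n with
  | zero =>
    intro s hs
    simpa [words, (h0 s hs).1] using (h0 s hs).2
  | succ n ih =>
    intro s hs
    rw [card_words_succ]
    refine le_trans (h1 s n hs) ?_
    push_cast
    refine Finset.sum_le_sum fun x _ => ?_
    split_ifs with h
    · exact ih _ (hI s x hs h)
    · exact le_rfl

end Automata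

abbrev St := Bool × Option Bool × ℤ

def alA (Q : ℤ → Prop) : Option Bool → ℤ → Bool → Prop
  | none, _, _ => True
  | some true, _, true => True
  | some true, k, false => k < 0
  | some false, k, true => k < 0
  | some false, k, false => Q k

def alB (P : ℤ → Prop) : Option Bool → ℤ → Bool → Prop
  | none, k, true => 0 ≤ k
  | none, k, false => k ≤ 0
  | some true, k, true => 0 ≤ k ∧ P k
  | some true, k, false => k ≤ 0
  | some false, _, true => False
  | some false, _, false => True

def alw (P Q : ℤ → Prop) (s : St) (x : Lt) : Prop :=
  if x.1 = 0 then alA Q s.2.1 s.2.2 x.2 else alB P s.2.1 s.2.2 x.2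

def nxt (s : St) (x : Lt) : St :=
  if x.1 = 0 then (s.1 || (decide (s.2.1 = some false) && !x.2), some x.2, 0)
    else (s.1, s.2.1, s.2.2 + bs x.2)

@[simp] lemma alw_a (P Q fl p k e) : alw P Q (fl, p, k) (0, e) = alA Q p k e := rfl
@[simp] lemma alw_b (P Q fl p k e) : alw P Q (fl, p, k) (1, e) = alB P p k e := rfl
@[simp] lemma nxt_a (fl p k e) : nxt (fl, p, k) (0, e) =
  (fl || (decide (p = some false) && !e), some e, 0) := rfl
@[simp] lemma nxt_b (fl p k e) : nxt (fl, p, k) (1, e) = (fl, p, k + bs e) := rfl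

abbrev accT (N : ℤ) (fi : St → Prop) := acc (alw (fun k => k ≤ N) (fun k => k ≤ -N)) nxt fi
abbrev accL := acc (alw (fun _ => True) (fun _ => False)) nxt (fun _ => True)

lemma ok_pos_bound {N : ℤ} (l : List Lt) : ∀ (k : ℤ), 0 < k →
    FreeGroup.IsReduced ((1, true) :: l) → ok N (some true) k l → k ≤ N + 1 := by
  induction l with
  | nil => intro k hk _; simp [fin]
  | cons s l ih =>
    intro k hk hl h
    rcases lt_cases s with ⟨e, rfl⟩ | ⟨e, rfl⟩
    · cases e <;> simp [tr] at h <;> omega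
    · rw [isReduced_cons_cons] at hl
      simp at hl
      obtain ⟨rfl, hl⟩ := hl
      have := ih (k + 1) (by omega) hl (by simpa using h)
      omega

lemma acc_of_ok {N : ℤ} (hN : 1 ≤ N) (suf : List Lt) (l : List Lt) : ∀ fl s p k p' k',
    cmp s p k → (p = none ∨ (p = p' ∧ k = k')) → ok N p' k' (l ++ suf) →
    FreeGroup.IsReduced (s :: (l ++ suf)) → accT N (fun _ => True) (fl, p, k) l := by
  induction l with
  | nil => intros; trivial
  | cons t l ih =>
    intro fl s p k p' k' hc hp h hr
    rw [List.cons_append, isReduced_cons_cons] at hr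
    obtain ⟨h1, h2, h3⟩ := hc
    obtain ⟨hst, hr⟩ := hr
    rw [List.cons_append] at h
    rcases lt_cases t with ⟨e, rfl⟩ | ⟨e, rfl⟩
    · rw [ok_a] at h
      refine ⟨?_, ih _ _ _ _ _ _ ⟨by simp, by simp, by simp⟩ (Or.inr ⟨rfl, rfl⟩) h.2 hr⟩
      clear ih
      obtain ⟨h, -⟩ := h
      rcases hp with rfl | ⟨rfl, rfl⟩
      · simp [alA, alB]
      · rcases p with _ | _ | _ <;> cases e <;> simp [alA, tr] at * <;> omega
    · rw [ok_b] at h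
      have hsg : cmp (1, e) p (k + bs e) ∧ (e = true → 0 ≤ k) ∧ (e = false → k ≤ 0) := by
        rcases lt_cases s with ⟨e', rfl⟩ | ⟨e', rfl⟩
        · simp at h1; obtain ⟨rfl, rfl⟩ := h1; cases e <;> simp [cmp]
        · simp at hst; subst hst; cases e' <;> simp [cmp] at * <;> omega
      refine ⟨?_, ih _ _ _ _ _ _ hsg.1 (hp.imp id fun hp => ⟨hp.1, by rw [hp.2]⟩) h hr⟩
      obtain ⟨-, g1, g2⟩ := hsg
      clear ih
      rcases hp with rfl | ⟨rfl, rfl⟩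
      · cases e <;> simp [alA, alB] at * <;> omega
      · rcases p with _ | _ | _ <;> cases e <;> simp [alA, alB] at * <;> try omega
        · exact ok_neg_pos hN (k + 1) (by omega) _ hr h
        · exact ⟨g1, by have := ok_pos_bound _ (k + 1) (by omega) hr h; omega⟩

lemma acc_start {N : ℤ} (hN : 1 ≤ N) {d l : List Lt} (hr : FreeGroup.IsReduced l)
    (h : ok N none 0 l) (hd : d <:+: l) : accT N (fun _ => True) (false, none, 0) d := by
  obtain ⟨pre, suf, rfl⟩ := hd
  have h2 : ∃ p k, ok N p k (d ++ suf) := by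
    rw [List.append_assoc] at h
    clear hr
    revert h
    generalize (none : Option Bool) = p
    generalize (0 : ℤ) = k
    induction pre generalizing p k with
    | nil => intro h; exact ⟨p, k, h⟩
    | cons s pre ih =>
      intro h
      rw [List.cons_append] at h
      rcases lt_cases s with ⟨e, rfl⟩ | ⟨e, rfl⟩
      · rw [ok_a] at h; exact ih _ _ h.2
      · rw [ok_b] at h; exact ih _ _ h
  obtain ⟨p, k, h2⟩ := h2
  have hr2 : FreeGroup.IsReduced (d ++ suf) := red_sub hr ⟨pre, [], by simp⟩
  cases d with
  | nil => trivial
  | cons s d =>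
    rw [List.cons_append] at h2 hr2
    rcases lt_cases s with ⟨e, rfl⟩ | ⟨e, rfl⟩
    · rw [ok_a] at h2
      refine ⟨by simp [alA, alB], acc_of_ok hN suf d _ _ _ _ _ _ ⟨by simp, by simp, by simp⟩ (Or.inr ⟨rfl, rfl⟩) h2.2 hr2⟩
    · rw [ok_b] at h2
      refine ⟨by cases e <;> simp [alA, alB], acc_of_ok hN suf d _ _ _ _ _ _ ⟨by simp, ?_, ?_⟩ (Or.inl rfl) h2 hr2⟩
      · rintro - h; simp at h; simp [h]
      · rintro - h; simp at h; simp [h]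

lemma acc_flag {N : ℤ} (l : List Lt) : ∀ p k, accT N (fun _ => True) (true, p, k) l →
    accT N (fun s => s.1 = true) (true, p, k) l := by
  induction l with
  | nil => intros; rfl
  | cons s l ih =>
    rintro p k ⟨h1, h2⟩
    refine ⟨h1, ?_⟩
    rcases lt_cases s with ⟨e, rfl⟩ | ⟨e, rfl⟩
    · exact ih _ _ h2
    · exact ih _ _ h2

lemma acc_split {N : ℤ} (l : List Lt) : ∀ p k, accT N (fun _ => True) (false, p, k) l →
    accT N (fun s => s.1 = true) (false, p, k) l ∨ accL (false, p, k) l := by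
  induction l with
  | nil => intros; right; trivial
  | cons s l ih =>
    rintro p k ⟨h1, h2⟩
    rcases lt_cases s with ⟨e, rfl⟩ | ⟨e, rfl⟩
    · by_cases hpe : p = some false ∧ e = false
      · obtain ⟨rfl, rfl⟩ := hpe
        left
        exact ⟨h1, acc_flag _ _ _ h2⟩
      · have hn : nxt (false, p, k) (0, e) = (false, some e, 0) := by
          rcases p with _ | _ | _ <;> cases e <;> simp [nxt] at *
        unfold accT at *
        rw [hn] at h2
        rcases ih _ _ h2 with h | h
        · left; exact ⟨h1, by rw [hn]; exact h⟩
        · right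
          refine ⟨?_, by rw [hn]; exact h⟩
          rcases p with _ | _ | _ <;> cases e <;> simp [alA, alB] at * <;> exact h1
    · rcases ih _ _ h2 with h | h
      · left; exact ⟨h1, h⟩
      · right
        refine ⟨?_, h⟩
        rcases p with _ | _ | _ <;> cases e <;> simp [alA, alB] at * <;> omega

lemma acc_len {N : ℤ} (l : List Lt) : ∀ p k, accT N (fun s => s.1 = true) (false, p, k) l →
    N ≤ l.length + max 0 (-k) := by
  induction l with
  | nil => intro p k h; simp [accT, acc] at h
  | cons s l ih =>
    rintro p k ⟨h1, h2⟩
    rcases lt_cases s with ⟨e, rfl⟩ | ⟨e, rfl⟩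
    · by_cases hpe : p = some false ∧ e = false
      · obtain ⟨rfl, rfl⟩ := hpe
        simp [alA, alB] at h1
        simp; omega
      · have hn : nxt (false, p, k) (0, e) = (false, some e, 0) := by
          rcases p with _ | _ | _ <;> cases e <;> simp [nxt] at *
        rw [hn] at h2
        have := ih _ _ h2
        simp at *; omega
    · have := ih _ _ h2
      cases e <;> simp at * <;> omega

theorem structure_pp {w : F2} (h : PotPos2 w) : ∃ (p d : List Lt) (f : Equiv.Perm Lt),
    w.toWord = p ++ d.map f ++ invRev p ∧ (accL (false, none, 0) d ∨
      ∃ N : ℕ, 1 ≤ N ∧ N ≤ d.length ∧ accT N (fun s => s.1 = true) (false, none, 0) d) := by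
  obtain ⟨p, d, f, N, l, hN, hw, hr, hok, hd⟩ := core (nice_of_potPos h)
  refine ⟨p, d, f, hw, ?_⟩
  rcases acc_split _ _ _ (acc_start hN hr hok hd) with h | h
  · right
    have := acc_len _ _ _ h
    simp at this
    lift N to ℕ using by omega
    exact ⟨N, by omega, by omega, h⟩
  · left; exact h

end PPG

namespace PPG
open FreeGroup

lemma sum_lt (f : Lt → ℝ) : ∑ x, f x = f (0, true) + f (0, false) + f (1, true) + f (1, false) := by
  rw [Fintype.sum_prod_type]
  simp [Fin.sum_univ_two]
  ring

noncomputable def VL (x : ℝ) : Option Bool → ℤ → ℝ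
  | some true, k => if k = 0 then 1 else if 0 < k then x / (1 - x) else
      x * (1 + x ^ 2 / (1 - x)) / (1 - x)
  | some false, k => if k = 0 then x ^ 2 / (1 - x) else x / (1 - x)
  | none, k => (if k = 0 then 1 + x else 1) * (x * (1 + x ^ 2 / (1 - x)) / (1 - x))

def Inv (s : St) : Prop := s.2.1 = some false → s.2.2 ≤ 0

lemma Inv_nxt {P Q} (s : St) (x : Lt) (h : Inv s) (ha : alw P Q s x) : Inv (nxt s x) := by
  obtain ⟨fl, p, k⟩ := s
  obtain ⟨e, rfl⟩ | ⟨e, rfl⟩ := lt_cases x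
  · simp [Inv]
  · simp only [Inv, nxt_b, alw_b] at *
    intro hp
    subst hp
    have := h rfl
    cases e <;> simp [alB] at *
    omega

open Classical in
lemma VL_step {x : ℝ} (hx0 : 0 < x) (hx1 : x < 1) (hx : 1 - 3 * x + x ^ 2 + x ^ 3 - x ^ 4 = 0)
    (s : St) (hs : Inv s) :
    x * (∑ y, if alw (fun _ => True) (fun _ => False) s y then
      VL x (nxt s y).2.1 (nxt s y).2.2 else 0) = VL x s.2.1 s.2.2 := by
  obtain ⟨fl, p, k⟩ := s
  rw [sum_lt]
  have h1 : 1 - x ≠ 0 := by linarith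
  rcases p with _ | _ | _
  · simp only [alw_a, alw_b, nxt_a, nxt_b, alA, alB, VL]
    rcases lt_trichotomy k 0 with hk | hk | hk
    · have a1 : k ≠ 0 := by omega
      have a2 : ¬ 0 ≤ k := by omega
      have a3 : k ≤ 0 := by omega
      have a4 : k + -1 ≠ 0 := by omega
      simp [a1, a2, a3, a4]
      field_simp
      ring
    · subst hk
      simp
      field_simp
      ring
    · have a1 : k ≠ 0 := by omega
      have a2 : 0 ≤ k := by omega
      have a3 : ¬ k ≤ 0 := by omega
      have a4 : k + 1 ≠ 0 := by omega
      simp [a1, a2, a3, a4]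
      field_simp
      ring
  · simp only [alw_a, alw_b, nxt_a, nxt_b, alA, alB, VL]
    have hk : k ≤ 0 := hs rfl
    rcases hk.lt_or_eq with hk | hk
    · have a1 : k ≠ 0 := by omega
      have a4 : k + -1 ≠ 0 := by omega
      simp [a1, a4, hk]
      field_simp
      ring
    · subst hk
      simp
      field_simp
  · simp only [alw_a, alw_b, nxt_a, nxt_b, alA, alB, VL]
    rcases lt_trichotomy k 0 with hk | hk | hk
    · have a1 : k ≠ 0 := by omega
      have a2 : ¬ 0 ≤ k := by omega
      have a3 : k ≤ 0 := by omega
      have a4 : k + -1 ≠ 0 := by omega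
      have a5 : ¬ 0 < k + -1 := by omega
      have a6 : ¬ 0 < k := by omega
      simp [a1, a2, a3, a4, a5, a6, hk]
      field_simp
      ring
    · subst hk
      simp
      field_simp
      linear_combination -hx
    · have a1 : k ≠ 0 := by omega
      have a2 : 0 ≤ k := by omega
      have a3 : ¬ k ≤ 0 := by omega
      have a4 : k + 1 ≠ 0 := by omega
      have a5 : 0 < k + 1 := by omega
      have a6 : ¬ k < 0 := by omega
      simp [a1, a2, a3, a4, a5, a6, hk]
      field_simp
      ring

lemma VL_bounds {x : ℝ} (hx0 : 0 < x) (hx1 : x ≤ 401 / 1000) (p k) : x ^ 2 ≤ VL x p k ∧ VL x p k ≤ 2 := by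
  have h1 : 0 < 1 - x := by linarith
  have e1 : x ≤ x / (1 - x) := by rw [le_div_iff₀ h1]; nlinarith
  have e2 : x / (1 - x) ≤ 67/100 := by rw [div_le_iff₀ h1]; nlinarith
  have e3 : x ^ 2 / (1 - x) = x * (x / (1 - x)) := by ring
  have e5 : x * (1 + x ^ 2 / (1 - x)) / (1 - x) = (1 + x * (x / (1 - x))) * (x / (1 - x)) := by ring
  generalize hy : x / (1 - x) = y at *
  have q1 : x ^ 2 ≤ x := by nlinarith
  have q2 : x ^ 2 ≤ x * y := by nlinarith
  have q3 : x * y ≤ 27/100 := by nlinarith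
  have q4 : y ≤ (1 + x * y) * y := by nlinarith
  have q5 : (1 + x * y) * y ≤ 1 := by nlinarith
  rcases p with _ | _ | _ <;> simp only [VL] <;> split_ifs <;>
    (first | rw [e5] | rw [e3] | rw [hy] | skip) <;> constructor <;> nlinarith

/-- counting 𝓛 words, both bounds -/
lemma L_upper {x : ℝ} (hx0 : 0 < x) (hx1 : x ≤ 401 / 1000)
    (hx : 1 - 3 * x + x ^ 2 + x ^ 3 - x ^ 4 = 0) (n : ℕ) :
    ((words (alw (fun _ => True) (fun _ => False)) nxt (fun _ => True) (false, none, 0) n).card : ℝ)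
      ≤ 2 / x ^ 2 * (x⁻¹) ^ n := by
  have h := card_words_le (alw (fun _ => True) (fun _ => False)) nxt (fun _ => True) Inv
    (fun s n => VL x s.2.1 s.2.2 / x ^ 2 * (x⁻¹) ^ n) (fun s x h ha => Inv_nxt s x h ha)
    (fun s _ => by
      have := (VL_bounds hx0 hx1 s.2.1 s.2.2).1
      have : 0 ≤ VL x s.2.1 s.2.2 := le_trans (by positivity) this
      positivity)
    (fun s _ _ => by
      have := (VL_bounds hx0 hx1 s.2.1 s.2.2).1
      simp only [pow_zero, mul_one]
      rwa [one_le_div (by positivity)])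
    (fun s n hs => by
      apply le_of_eq
      rw [← VL_step hx0 (by linarith) hx s hs]
      simp only [sum_lt, pow_succ]
      have hx' := hx0.ne'
      split_ifs <;> field_simp <;> ring) n (false, none, 0) (by simp [Inv])
  refine h.trans ?_
  have := (VL_bounds hx0 hx1 none 0).2
  gcongr

lemma L_lower {x : ℝ} (hx0 : 0 < x) (hx1 : x ≤ 401 / 1000)
    (hx : 1 - 3 * x + x ^ 2 + x ^ 3 - x ^ 4 = 0) (n : ℕ) :
    1 / 2 * (x⁻¹) ^ n ≤
    ((words (alw (fun _ => True) (fun _ => False)) nxt (fun _ => True) (false, some true, 0) n).card : ℝ) := by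
  have h := card_words_ge (alw (fun _ => True) (fun _ => False)) nxt (fun _ => True) Inv
    (fun s n => VL x s.2.1 s.2.2 / 2 * (x⁻¹) ^ n) (fun s x h ha => Inv_nxt s x h ha)
    (fun s _ => ⟨trivial, by
      have := (VL_bounds hx0 hx1 s.2.1 s.2.2).2
      simp only [pow_zero, mul_one]
      linarith⟩)
    (fun s n hs => by
      apply le_of_eq
      rw [← VL_step hx0 (by linarith) hx s hs]
      simp only [sum_lt, pow_succ]
      have hx' := hx0.ne'
      split_ifs <;> field_simp <;> ring) n (false, some true, 0) (by simp [Inv])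
  refine le_trans (le_of_eq ?_) h
  simp [VL]

end PPG

namespace PPG
open FreeGroup

noncomputable def wT (x : ℝ) (N : ℕ) : ℝ := x ^ 2 / (1 - x - x ^ (N + 1))

noncomputable def VT (x : ℝ) (N : ℕ) : Option Bool → ℤ → ℝ
  | some true, k => if k = 0 then 1 else if 0 < k then (x - x ^ (N + 3 - k : ℤ).toNat) / (1 - x) else
      x * (1 + wT x N) / (1 - x)
  | some false, k => if k = 0 then wT x N else x / (1 - x) * (1 + x ^ (N + k : ℤ).toNat * wT x N)
  | none, k => (if k = 0 then 1 + x else 1) * (x * (1 + wT x N) / (1 - x))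

def InvT (N : ℕ) (s : St) : Prop := (s.2.1 = some false → s.2.2 ≤ 0) ∧ (s.2.1 = some true → s.2.2 ≤ N + 1)

lemma InvT_nxt {N : ℕ} {Q} (s : St) (x : Lt) (h : InvT N s) (ha : alw (fun k => k ≤ (N : ℤ)) Q s x) :
    InvT N (nxt s x) := by
  obtain ⟨fl, p, k⟩ := s
  obtain ⟨e, rfl⟩ | ⟨e, rfl⟩ := lt_cases x
  · simp [InvT]; intro; omega
  · simp only [InvT, nxt_b, alw_b] at *
    constructor
    · intro hp
      subst hp
      have := h.1 rfl
      cases e <;> simp [alB] at *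
      omega
    · intro hp
      subst hp
      have := h.2 rfl
      cases e <;> simp [alB] at *
      all_goals omega

lemma toNat_step {x : ℝ} {m : ℤ} (h : 0 < m) : x ^ m.toNat = x * x ^ (m - 1).toNat := by
  obtain ⟨j, rfl⟩ : ∃ j : ℕ, m = j + 1 := ⟨(m - 1).toNat, by omega⟩
  rw [show ((j : ℤ) + 1).toNat = j + 1 by omega, show ((j : ℤ) + 1 - 1).toNat = j by omega]
  ring

structure TP (x : ℝ) (N : ℕ) : Prop where
  x0 : 0 < x
  x1 : x ≤ 401 / 1000
  hN : 1 ≤ N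
  hT : x ^ 4 ≤ (1 - 2 * x - x ^ 2 + x ^ (N + 3)) * (1 - x - x ^ (N + 1))

lemma TP.pow {x : ℝ} {N : ℕ} (h : TP x N) : x ^ (N + 1) ≤ x ^ 2 :=
  pow_le_pow_of_le_one h.x0.le (by linarith [h.x1]) (by linarith [h.hN])

lemma TP.den {x : ℝ} {N : ℕ} (h : TP x N) : 43 / 100 < 1 - x - x ^ (N + 1) := by
  have := h.pow
  nlinarith [h.x0, h.x1]

lemma TP.w {x : ℝ} {N : ℕ} (h : TP x N) : x ^ 2 ≤ wT x N ∧ wT x N ≤ 2 / 5 := by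
  have h1 := h.den
  have h2 : 0 < x ^ (N + 1) := by have := h.x0; positivity
  have := h.x0
  have := h.x1
  unfold wT
  rw [le_div_iff₀ (by linarith), div_le_iff₀ (by linarith)]
  constructor <;> nlinarith

lemma TP.weq {x : ℝ} {N : ℕ} (h : TP x N) : wT x N * (1 - x - x * x ^ N) = x ^ 2 := by
  have h1 := h.den
  unfold wT
  rw [← pow_succ']
  field_simp

open Classical in
lemma VT_step {x : ℝ} {N : ℕ} (h : TP x N) (s : St) (hs : InvT N s) :
    x * (∑ y, if alw (fun k => k ≤ (N : ℤ)) (fun k => k ≤ -(N : ℤ)) s y then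
      VT x N (nxt s y).2.1 (nxt s y).2.2 else 0) ≤ VT x N s.2.1 s.2.2 := by
  obtain ⟨fl, p, k⟩ := s
  rw [sum_lt]
  have h1 : 0 < 1 - x := by linarith [h.x1]
  have hN := h.hN
  have hw := h.weq
  have hx0 := h.x0
  rcases p with _ | _ | _
  · apply le_of_eq
    simp only [alw_a, alw_b, nxt_a, nxt_b, alA, alB, VT]
    rcases lt_trichotomy k 0 with hk | hk | hk
    · have a1 : k ≠ 0 := by omega
      have a2 : ¬ 0 ≤ k := by omega
      have a3 : k ≤ 0 := by omega
      have a4 : k + -1 ≠ 0 := by omega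
      simp [a1, a2, a3, a4]
      field_simp
      ring
    · subst hk
      simp
      field_simp
      ring
    · have a1 : k ≠ 0 := by omega
      have a2 : 0 ≤ k := by omega
      have a3 : ¬ k ≤ 0 := by omega
      have a4 : k + 1 ≠ 0 := by omega
      simp [a1, a2, a3, a4]
      field_simp
      ring
  · apply le_of_eq
    simp only [alw_a, alw_b, nxt_a, nxt_b, alA, alB, VT]
    have hk : k ≤ 0 := hs.1 rfl
    rcases hk.lt_or_eq with hk | hk
    · have a1 : k ≠ 0 := by omega
      have a4 : k + -1 ≠ 0 := by omega
      by_cases hkN : k ≤ -N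
      · have b1 : ((N : ℤ) + k).toNat = 0 := by omega
        have b2 : ((N : ℤ) + (k + -1)).toNat = 0 := by omega
        simp [a1, a4, hk, hkN, b1, b2]
        field_simp
        ring
      · have b1 := toNat_step (x := x) (m := N + k) (by omega)
        rw [show (N : ℤ) + k - 1 = N + (k + -1) by ring] at b1
        simp [a1, a4, hk, hkN, b1]
        field_simp
        ring
    · subst hk
      have b1 : ¬ (N : ℤ) ≤ 0 := by omega
      obtain ⟨M, rfl⟩ : ∃ M, N = M + 1 := ⟨N - 1, by omega⟩
      have b2 : ¬ (M : ℤ) ≤ -1 := by omega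
      simp [b2]
      field_simp
      linear_combination -hw
  · simp only [alw_a, alw_b, nxt_a, nxt_b, alA, alB, VT]
    rcases lt_trichotomy k 0 with hk | hk | hk
    · apply le_of_eq
      have a1 : k ≠ 0 := by omega
      have a2 : ¬ 0 ≤ k := by omega
      have a3 : k ≤ 0 := by omega
      have a4 : k + -1 ≠ 0 := by omega
      have a5 : ¬ 0 < k + -1 := by omega
      have a6 : ¬ 0 < k := by omega
      simp [a1, a2, a3, a4, a5, a6, hk]
      field_simp
      ring
    · subst hk
      have b1 : ((N : ℤ) + 3 - 1).toNat = N + 2 := by omega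
      simp [b1]
      have hd := h.den
      have hT := h.hT
      have : wT x N = x ^ 2 / (1 - x - x ^ (N + 1)) := rfl
      have h3 : x ^ 2 * wT x N ≤ 1 - 2 * x - x ^ 2 + x ^ (N + 3) := by
        rw [this, ← mul_div_assoc, div_le_iff₀ (by linarith)]
        linarith
      have : x * (1 + (x - x ^ (N + 2)) / (1 - x) + x * (1 + wT x N) / (1 - x)) =
        (x * (1 - x) + x * (x - x ^ (N + 2)) + x ^ 2 * (1 + wT x N)) / (1 - x) := by
        field_simp
      rw [this, div_le_one h1]
      have : x ^ (N + 3) = x * x ^ (N + 2) := by ring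
      nlinarith
    · apply le_of_eq
      have a1 : k ≠ 0 := by omega
      have a2 : 0 ≤ k := by omega
      have a3 : ¬ k ≤ 0 := by omega
      have a4 : k + 1 ≠ 0 := by omega
      have a5 : 0 < k + 1 := by omega
      have a6 : ¬ k < 0 := by omega
      have hkN := hs.2 rfl
      simp only at hkN
      by_cases hk2 : k ≤ N
      · have b1 := toNat_step (x := x) (m := N + 3 - k) (by omega)
        rw [show (N : ℤ) + 3 - k - 1 = N + 3 - (k + 1) by ring] at b1
        simp [a1, a2, a3, a4, a5, a6, hk, hk2, b1]
        field_simp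
        ring
      · have b1 : ((N : ℤ) + 3 - k).toNat = 2 := by omega
        simp [a1, a2, a3, a4, a5, a6, hk, hk2, b1]
        field_simp

lemma VT_bounds {x : ℝ} {N : ℕ} (h : TP x N) (s : St) (hs : InvT N s) :
    x ^ 2 ≤ VT x N s.2.1 s.2.2 ∧ VT x N s.2.1 s.2.2 ≤ 2 := by
  have hx0 := h.x0
  have hx1 := h.x1
  have hw := h.w
  have h1 : 0 < 1 - x := by linarith
  have e1 : x ≤ x / (1 - x) := by rw [le_div_iff₀ h1]; nlinarith
  have e2 : x / (1 - x) ≤ 67/100 := by rw [div_le_iff₀ h1]; nlinarith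
  have e5 : x * (1 + wT x N) / (1 - x) = (1 + wT x N) * (x / (1 - x)) := by ring
  have q1 : x ^ 2 ≤ x := by nlinarith
  obtain ⟨fl, p, k⟩ := s
  rcases p with _ | _ | _ <;> simp only [VT]
  · rw [e5]
    generalize x / (1 - x) = y at *
    split_ifs <;> constructor
    · nlinarith [mul_nonneg hx0.le (by nlinarith : 0 ≤ (1 + wT x N) * y)]
    · have : (1 + wT x N) * y ≤ 1 := by nlinarith
      nlinarith [mul_nonneg hx0.le (by nlinarith : 0 ≤ (1 + wT x N) * y)]
    · nlinarith
    · nlinarith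
  · split_ifs
    · constructor <;> linarith
    · have p1 : x ^ ((N : ℤ) + k).toNat ≤ 1 := pow_le_one₀ hx0.le (by linarith)
      have p2 : 0 < x ^ ((N : ℤ) + k).toNat := by positivity
      have p3 : 0 ≤ x ^ ((N : ℤ) + k).toNat * wT x N := by nlinarith
      have p4 : x ^ ((N : ℤ) + k).toNat * wT x N ≤ 1 := by nlinarith
      constructor <;> nlinarith
  · split_ifs with c1 c2
    · constructor <;> nlinarith
    · have := hs.2 rfl
      simp only at this
      have p1 : x ^ ((N : ℤ) + 3 - k).toNat ≤ x ^ 2 :=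
        pow_le_pow_of_le_one hx0.le (by linarith) (by omega)
      have p2 : 0 < x ^ ((N : ℤ) + 3 - k).toNat := by positivity
      rw [le_div_iff₀ h1, div_le_iff₀ h1]
      constructor <;> nlinarith
    · rw [e5]
      constructor <;> nlinarith

noncomputable def eT (x : ℝ) (N : ℕ) : ℝ := x * wT x N / (1 - x)

noncomputable def ET (x : ℝ) (N : ℕ) (s : St) : ℝ :=
  if s.1 = true then VT x N s.2.1 s.2.2 else
  if s.2.1 = some false then x ^ (N + s.2.2 : ℤ).toNat * eT x N else 0

lemma TP.e {x : ℝ} {N : ℕ} (h : TP x N) : 0 ≤ eT x N ∧ eT x N ≤ 1 := by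
  have hw := h.w
  have := h.x0
  have := h.x1
  have h0 : 0 ≤ wT x N := le_trans (by positivity) hw.1
  unfold eT
  rw [div_le_one (by linarith)]
  exact ⟨div_nonneg (by positivity) (by linarith), by nlinarith⟩

lemma TP.v {x : ℝ} {N : ℕ} (h : TP x N) : x ≤ x * (1 + wT x N) / (1 - x) := by
  have hw := h.w
  have := h.x0
  have := h.x1
  have h0 : 0 ≤ wT x N := le_trans (by positivity) hw.1
  rw [le_div_iff₀ (by linarith)]
  nlinarith [mul_nonneg h.x0.le h0]

open Classical in
lemma ET_step {x : ℝ} {N : ℕ} (h : TP x N) (s : St) (hs : InvT N s) :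
    x * (∑ y, if alw (fun k => k ≤ (N : ℤ)) (fun k => k ≤ -(N : ℤ)) s y then
      ET x N (nxt s y) else 0) ≤ x ^ N * VT x N s.2.1 s.2.2 + ET x N s := by
  have hV := (VT_bounds h s hs).1
  have hstep := VT_step h s hs
  obtain ⟨fl, p, k⟩ := s
  rw [sum_lt] at *
  have h1 : 0 < 1 - x := by linarith [h.x1]
  have hN := h.hN
  have hx0 := h.x0
  have he := h.e
  have hv := h.v
  have h00 : 0 ≤ x ^ N * VT x N p k := mul_nonneg (by positivity) (le_trans (by positivity) hV)
  cases fl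
  · have key : x * (x ^ N * eT x N) ≤ x ^ N * (x * (1 + wT x N) / (1 - x)) := by
      have : 0 < x ^ N := by positivity
      calc x * (x ^ N * eT x N) ≤ x * (x ^ N * 1) := by gcongr; exact he.2
        _ = x ^ N * x := by ring
        _ ≤ _ := by gcongr
    rcases p with _ | _ | _
    · simp [alw_a, alw_b, nxt_a, nxt_b, alA, alB, ET]
      refine key.trans ?_
      simp only [VT]
      refine mul_le_mul_of_nonneg_left ?_ (by positivity)
      split_ifs
      · nlinarith
      · simp
    · simp only [alw_a, alw_b, nxt_a, nxt_b, alA, alB, ET]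
      have hk : k ≤ 0 := hs.1 rfl
      by_cases hkN : k ≤ -N
      · have b1 : ((N : ℤ) + k).toNat = 0 := by omega
        have b2 : ((N : ℤ) + (k + -1)).toNat = 0 := by omega
        simp [b1, b2, hkN]
        have : x * (wT x N + eT x N) = eT x N := by
          unfold eT
          field_simp
          ring
        simp only [VT] at *
        simp at *
        rw [this]
        linarith
      · have b1 := toNat_step (x := x) (m := N + k) (by omega)
        rw [show (N : ℤ) + k - 1 = N + (k + -1) by ring] at b1
        simp [hkN, b1]
        linarith
    · simp only [alw_a, alw_b, nxt_a, nxt_b, alA, alB, ET]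
      by_cases hk : k < 0
      · simp [hk]
        have a1 : k ≠ 0 := by omega
        have a2 : ¬ 0 < k := by omega
        simpa [VT, a1, a2] using key
      · simp [hk]
        linarith
  · have e : ∀ y, ET x N (nxt (true, p, k) y) =
        VT x N (nxt (true, p, k) y).2.1 (nxt (true, p, k) y).2.2 := by
      intro y
      rw [ET, if_pos]
      obtain ⟨e, rfl⟩ | ⟨e, rfl⟩ := lt_cases y <;> simp
    have e' : ET x N (true, p, k) = VT x N p k := by simp [ET]
    simp only [e, e']
    simp only at hstep
    linarith

open Classical in
/-- Bound for the number of D_N words -/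
lemma D_upper {x : ℝ} {N : ℕ} (h : TP x N) (n : ℕ) :
    ((words (alw (fun k => k ≤ (N : ℤ)) (fun k => k ≤ -(N : ℤ))) nxt (fun s => s.1 = true)
      (false, none, 0) n).card : ℝ) ≤ 2 / x ^ 2 * (n * x ^ N * (x⁻¹) ^ n) := by
  have hx0 := h.x0
  have hx' := hx0.ne'
  have hb := card_words_le (alw (fun k => k ≤ (N : ℤ)) (fun k => k ≤ -(N : ℤ))) nxt
    (fun s => s.1 = true) (InvT N)
    (fun s n => (n * x ^ N * VT x N s.2.1 s.2.2 + ET x N s) / x ^ 2 * (x⁻¹) ^ n)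
    (fun s x h ha => InvT_nxt s x h ha)
    (fun s hs => by
      have h1 := (VT_bounds h s hs).1
      have h2 : 0 ≤ VT x N s.2.1 s.2.2 := le_trans (by positivity) h1
      have h3 : 0 ≤ ET x N s := by
        have := h.e.1
        unfold ET
        split_ifs <;> positivity
      positivity)
    (fun s hs hf => by
      have h1 := (VT_bounds h s hs).1
      have h2 : ET x N s = VT x N s.2.1 s.2.2 := by rw [ET, if_pos hf]
      simp only [pow_zero, mul_one, h2, Nat.cast_zero, zero_mul, zero_add]
      rwa [one_le_div (by positivity)])
    (fun s n hs => by
      have h1 := VT_step h s hs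
      have h2 := ET_step h s hs
      have h3 : x * ((n * x ^ N) * (∑ y, if alw (fun k => k ≤ (N : ℤ)) (fun k => k ≤ -(N : ℤ)) s y then
        VT x N (nxt s y).2.1 (nxt s y).2.2 else 0)) + x * (∑ y, if alw (fun k => k ≤ (N : ℤ)) (fun k => k ≤ -(N : ℤ)) s y then
        ET x N (nxt s y) else 0) ≤ (((n + 1 : ℕ) : ℝ) * x ^ N * VT x N s.2.1 s.2.2 + ET x N s) := by
        have := mul_le_mul_of_nonneg_left h1 (by positivity : 0 ≤ (n : ℝ) * x ^ N)
        push_cast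
        linarith
      have h4 : 0 ≤ (x⁻¹) ^ (n + 1) / x ^ 2 := by positivity
      have h5 := mul_le_mul_of_nonneg_right h3 h4
      refine le_trans (le_of_eq ?_) (h5.trans (le_of_eq ?_))
      · simp only [sum_lt, pow_succ]
        split_ifs <;> field_simp <;> ring
      · ring) n (false, none, 0) (by simp [InvT])
  refine hb.trans ?_
  have := (VT_bounds h (false, none, 0) (by simp [InvT])).2
  simp only [ET] at *
  simp only [Bool.false_eq_true, if_false, reduceCtorEq, add_zero]
  have h6 : 0 ≤ n * x ^ N * (x⁻¹) ^ n / x ^ 2 := by positivity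
  calc _ = VT x N none 0 * (n * x ^ N * (x⁻¹) ^ n / x ^ 2) := by ring
    _ ≤ 2 * (n * x ^ N * (x⁻¹) ^ n / x ^ 2) := by gcongr
    _ = _ := by ring

end PPG

namespace PPG
open FreeGroup

lemma TP_of {z : ℝ} (h0 : 398 / 1000 < z) (h1 : z < 4 / 10)
    (hz : 1 - 3 * z + z ^ 2 + z ^ 3 - z ^ 4 = 0) {N : ℕ} (hN : 1 ≤ N) :
    TP (z * (1 + 1 / 200 * z ^ N)) N := by
  have hz0 : 0 < z := by linarith
  have hq : 0 < z ^ N := by positivity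
  have hq1 : z ^ N ≤ z := by
    calc z ^ N ≤ z ^ 1 := pow_le_pow_of_le_one hz0.le (by linarith) hN
      _ = z := pow_one z
  obtain ⟨x, hx⟩ : ∃ x, x = z * (1 + 1 / 200 * z ^ N) := ⟨_, rfl⟩
  rw [← hx]
  have hzx : z ≤ x := by rw [hx]; nlinarith [mul_pos hz0 hq]
  have hx1 : x ≤ 401 / 1000 := by
    rw [hx]; nlinarith [mul_pos hz0 hq]
  have hx0 : 0 < x := by linarith
  have hd : x - z ≤ 1 / 200 * x ^ (N + 1) := by
    have : z ^ (N + 1) ≤ x ^ (N + 1) := by gcongr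
    have e : x - z = 1 / 200 * z ^ (N + 1) := by rw [hx]; ring
    rw [e]; linarith
  refine ⟨hx0, hx1, hN, ?_⟩
  have hP : -3 * (x - z) ≤ 1 - 3 * x + x ^ 2 + x ^ 3 - x ^ 4 := by
    have hh : 0 ≤ (x + z) + (x ^ 2 + x * z + z ^ 2) - (x ^ 3 + x ^ 2 * z + x * z ^ 2 + z ^ 3) := by
      have : x ^ 3 ≤ x := by nlinarith [pow_pos hx0 2, pow_pos hx0 3]
      have : z ^ 3 ≤ z := by nlinarith [pow_pos hz0 2, pow_pos hz0 3]
      have : x ^ 2 * z ≤ x ^ 2 := by nlinarith [pow_pos hx0 2]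
      have : x * z ^ 2 ≤ z ^ 2 := by nlinarith [pow_pos hz0 2]
      nlinarith [mul_pos hx0 hz0]
    have := mul_nonneg (by linarith : 0 ≤ x - z) hh
    nlinarith
  have hx3 : x ^ (N + 3) ≤ x ^ 4 := pow_le_pow_of_le_one hx0.le (by linarith) (by omega)
  have hx2 : (398 / 1000) ^ 2 ≤ x ^ 2 := by gcongr; linarith
  have hx2' : x ^ 2 ≤ (401 / 1000) ^ 2 := by gcongr
  have hb : 15 / 1000 ≤ x ^ 2 * (1 - x) - (1 - 2 * x - x ^ 2) - x ^ (N + 3) := by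
    nlinarith
  have hp : 0 < x ^ (N + 1) := by positivity
  have h5 := mul_le_mul_of_nonneg_left hb hp.le
  have e : x ^ (N + 3) = x ^ 2 * x ^ (N + 1) := by ring
  rw [e] at h5 ⊢
  nlinarith

lemma tele {z t : ℝ} (hz0 : 0 < z) (hz1 : z < 1) (ht : 0 ≤ t) (n : ℕ) :
    (1 - z) * ∑ N ∈ Finset.range n, t * z ^ N / (1 + t * z ^ N) ^ 2 ≤ 1 / (1 + t * z ^ n) - 1 / (1 + t) := by
  induction n with
  | zero => simp
  | succ n ih =>
    rw [Finset.sum_range_succ, mul_add]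
    have : (1 - z) * (t * z ^ n / (1 + t * z ^ n) ^ 2) ≤
        1 / (1 + t * z ^ (n + 1)) - 1 / (1 + t * z ^ n) := by
      have hq : 0 ≤ t * z ^ n := by positivity
      rw [show t * z ^ (n + 1) = t * z ^ n * z by ring]
      generalize t * z ^ n = q at *
      have a1 : 0 < 1 + q := by linarith
      have a2 : 0 < 1 + q * z := by nlinarith
      rw [div_sub_div _ _ a2.ne' a1.ne', ← mul_div_assoc, div_le_div_iff₀ (by positivity) (by positivity)]
      have : 0 ≤ (1 - z) * q * (1 + q) * (q * (1 - z)) := by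
        have : 0 ≤ 1 - z := by linarith
        positivity
      nlinarith
    linarith

lemma term_bound {z : ℝ} (h0 : 398 / 1000 < z) (h1 : z < 4 / 10) (N n : ℕ) (hNn : N ≤ n) :
    (n : ℝ) * (z * (1 + 1 / 200 * z ^ N)) ^ N * ((z * (1 + 1 / 200 * z ^ N))⁻¹) ^ n ≤
      1800 * (z⁻¹) ^ n * ((n / 600 : ℝ) * z ^ N / (1 + (n / 600 : ℝ) * z ^ N) ^ 2) := by
  have hz0 : 0 < z := by linarith
  have hq : 0 < z ^ N := by positivity
  have hq1 : z ^ N ≤ 1 := pow_le_one₀ hz0.le (by linarith)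
  have hNq : N * z ^ N ≤ 1 := by
    have a : (N : ℝ) ≤ 2 ^ N := by exact_mod_cast Nat.lt_two_pow_self.le
    calc N * z ^ N ≤ 2 ^ N * z ^ N := by gcongr
      _ = (2 * z) ^ N := by rw [mul_pow]
      _ ≤ 1 := pow_le_one₀ (by linarith) (by linarith)
  have hA : (1 + 1 / 200 * z ^ N) ^ N ≤ 3 := by
    calc (1 + 1 / 200 * z ^ N) ^ N ≤ (Real.exp (1 / 200 * z ^ N)) ^ N := by
          gcongr
          linarith [Real.add_one_le_exp (1 / 200 * z ^ N)]
      _ = Real.exp (N * (1 / 200 * z ^ N)) := by rw [← Real.exp_nat_mul]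
      _ ≤ Real.exp 1 := by
          apply Real.exp_le_exp.mpr
          nlinarith
      _ ≤ 3 := by linarith [Real.exp_one_lt_d9]
  have hB : (1 + (n / 600 : ℝ) * z ^ N) ^ 2 ≤ (1 + 1 / 200 * z ^ N) ^ n := by
    have b1 := one_add_mul_le_pow (a := 1 / 600 * z ^ N) (by linarith) n
    calc (1 + (n / 600 : ℝ) * z ^ N) ^ 2 = (1 + n * (1 / 600 * z ^ N)) ^ 2 := by ring
      _ ≤ ((1 + 1 / 600 * z ^ N) ^ n) ^ 2 := by gcongr
      _ = ((1 + 1 / 600 * z ^ N) ^ 2) ^ n := by rw [← pow_mul, ← pow_mul, mul_comm n 2]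
      _ ≤ _ := by
        gcongr
        nlinarith
  generalize 1 + 1 / 200 * z ^ N = r at *
  have hD : 0 < (1 + (n / 600 : ℝ) * z ^ N) ^ 2 := by positivity
  have hr : 0 < r ^ n := lt_of_lt_of_le hD hB
  calc (n : ℝ) * (z * r) ^ N * ((z * r)⁻¹) ^ n = (z⁻¹) ^ n * (n * z ^ N) * (r ^ N / r ^ n) := by
        rw [mul_pow, mul_inv, mul_pow, inv_pow r]; ring
    _ ≤ (z⁻¹) ^ n * (n * z ^ N) * (3 / (1 + (n / 600 : ℝ) * z ^ N) ^ 2) := by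
        gcongr
    _ = _ := by ring

lemma D_sum {z : ℝ} (h0 : 398 / 1000 < z) (h1 : z < 4 / 10)
    (hz : 1 - 3 * z + z ^ 2 + z ^ 3 - z ^ 4 = 0) (n : ℕ) :
    (∑ N ∈ Finset.Icc 1 n, ((words (alw (fun k => k ≤ (N : ℤ)) (fun k => k ≤ -(N : ℤ))) nxt (fun s => s.1 = true)
      (false, none, 0) n).card : ℝ)) ≤ 50000 * (z⁻¹) ^ n := by
  have hz0 : 0 < z := by linarith
  have step : ∀ N ∈ Finset.Icc 1 n, ((words (alw (fun k => k ≤ (N : ℤ)) (fun k => k ≤ -(N : ℤ))) nxt (fun s => s.1 = true)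
      (false, none, 0) n).card : ℝ) ≤ 13 * (1800 * (z⁻¹) ^ n) *
        ((n / 600 : ℝ) * z ^ N / (1 + (n / 600 : ℝ) * z ^ N) ^ 2) := by
    intro N hN
    rw [Finset.mem_Icc] at hN
    have hT := TP_of h0 h1 hz hN.1
    refine (D_upper hT n).trans ?_
    have hb := term_bound h0 h1 N n hN.2
    have hx : (398 / 1000) ≤ z * (1 + 1 / 200 * z ^ N) := by
      have : 0 < z ^ N := by positivity
      nlinarith
    generalize z * (1 + 1 / 200 * z ^ N) = x at *
    have h13 : 2 / x ^ 2 ≤ 13 := by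
      rw [div_le_iff₀ (by positivity)]
      nlinarith
    rw [mul_assoc 13]
    have : 0 ≤ (n : ℝ) * x ^ N * x⁻¹ ^ n := by positivity
    exact mul_le_mul h13 hb this (by norm_num)
  refine (Finset.sum_le_sum step).trans ?_
  rw [← Finset.mul_sum]
  have h2 := tele hz0 (by linarith : z < 1) (by positivity : (0 : ℝ) ≤ n / 600) (n + 1)
  have h3 : 1 / (1 + (n / 600 : ℝ) * z ^ (n + 1)) ≤ 1 := by
    rw [div_le_one (by positivity)]
    have : 0 ≤ (n / 600 : ℝ) * z ^ (n + 1) := by positivity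
    linarith
  have h3' : 0 ≤ 1 / (1 + (n / 600 : ℝ)) := by positivity
  have h4 : ∑ N ∈ Finset.Icc 1 n, (n / 600 : ℝ) * z ^ N / (1 + (n / 600 : ℝ) * z ^ N) ^ 2 ≤
      ∑ N ∈ Finset.range (n + 1), (n / 600 : ℝ) * z ^ N / (1 + (n / 600 : ℝ) * z ^ N) ^ 2 := by
    refine Finset.sum_le_sum_of_subset_of_nonneg ?_ fun i _ _ => by positivity
    intro i hi
    simp at hi ⊢
    omega
  generalize ∑ N ∈ Finset.range (n + 1), (n / 600 : ℝ) * z ^ N / (1 + (n / 600 : ℝ) * z ^ N) ^ 2 = S at *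
  generalize ∑ N ∈ Finset.Icc 1 n, (n / 600 : ℝ) * z ^ N / (1 + (n / 600 : ℝ) * z ^ N) ^ 2 = S' at *
  have h5 : S' ≤ 2 := by nlinarith
  have : 0 ≤ (z⁻¹) ^ n := by positivity
  nlinarith

lemma lam_facts (lam : ℝ)
    (hroot : lam ^ 4 - 3 * lam ^ 3 + lam ^ 2 + lam - 1 = 0)
    (hmax : ∀ x : ℝ, x ^ 4 - 3 * x ^ 3 + x ^ 2 + x - 1 = 0 → x ≤ lam) :
    398 / 1000 < lam⁻¹ ∧ lam⁻¹ < 4 / 10 ∧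
      1 - 3 * lam⁻¹ + lam⁻¹ ^ 2 + lam⁻¹ ^ 3 - lam⁻¹ ^ 4 = 0 := by
  have h1 : (25 / 10 : ℝ) < lam := by
    have hc : ContinuousOn (fun x : ℝ => x ^ 4 - 3 * x ^ 3 + x ^ 2 + x - 1) (Set.Icc (2501 / 1000) 3) := by
      fun_prop
    obtain ⟨x, hx, hx0⟩ := intermediate_value_Icc (by norm_num) hc
      (show (0 : ℝ) ∈ Set.Icc _ _ by constructor <;> norm_num)
    have := hmax x hx0
    have := hx.1
    linarith
  have h2 : lam < 251 / 100 := by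
    by_contra hc
    push Not at hc
    have : lam ^ 4 - 3 * lam ^ 3 + lam ^ 2 + lam - 1 =
      (lam - 251 / 100) * (lam ^ 3 - 49 / 100 * lam ^ 2 - 2299/10000 * lam + 422951/1000000) + (422951 * 251 / 100000000 - 1) := by ring
    have : 0 ≤ lam ^ 3 - 49 / 100 * lam ^ 2 - 2299/10000 * lam + 422951/1000000 := by nlinarith [sq_nonneg lam]
    nlinarith
  have h0 : 0 < lam := by linarith
  refine ⟨?_, ?_, ?_⟩
  · rw [← one_div, lt_div_iff₀ h0]; linarith
  · rw [← one_div, div_lt_iff₀ h0]; linarith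
  · field_simp
    linear_combination hroot

end PPG

namespace PPG
open FreeGroup

open Classical in
noncomputable def UU (n : ℕ) : Finset (List Lt) :=
  words (alw (fun _ => True) (fun _ => False)) nxt (fun _ => True) (false, none, 0) n ∪
  (Finset.Icc 1 n).biUnion fun N : ℕ =>
    words (alw (fun k => k ≤ (N : ℤ)) (fun k => k ≤ -(N : ℤ))) nxt (fun s => s.1 = true) (false, none, 0) n

lemma UU_card {z : ℝ} (h0 : 398 / 1000 < z) (h1 : z < 4 / 10)
    (hz : 1 - 3 * z + z ^ 2 + z ^ 3 - z ^ 4 = 0) (n : ℕ) :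
    ((UU n).card : ℝ) ≤ 60000 * (z⁻¹) ^ n := by
  classical
  have hz0 : 0 < z := by linarith
  have a1 := L_upper hz0 (by linarith) hz n
  have a2 := D_sum h0 h1 hz n
  have h13 : 2 / z ^ 2 ≤ 13 := by
    rw [div_le_iff₀ (by positivity)]
    nlinarith
  have a3 : (UU n).card ≤ (words (alw (fun _ => True) (fun _ => False)) nxt (fun _ => True) (false, none, 0) n).card + ∑ N ∈ Finset.Icc 1 n, (words (alw (fun k => k ≤ (N : ℤ)) (fun k => k ≤ -(N : ℤ))) nxt (fun s => s.1 = true) (false, none, 0) n).card :=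
    (Finset.card_union_le _ _).trans (by gcongr; exact Finset.card_biUnion_le)
  have a3' := (Nat.cast_le (α := ℝ)).mpr a3
  push_cast at a3'
  have : 0 ≤ (z⁻¹) ^ n := by positivity
  nlinarith

open Classical in
noncomputable def TT (n : ℕ) : Finset (List Lt) :=
  (Finset.range (n / 2 + 1)).biUnion fun j =>
    ((Finset.univ : Finset (Fin j → Lt)) ×ˢ UU (n - 2 * j) ×ˢ (Finset.univ : Finset (Equiv.Perm Lt))).image
      fun q => List.ofFn q.1 ++ q.2.1.map q.2.2 ++ invRev (List.ofFn q.1)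

lemma TT_card_nat (n : ℕ) : (TT n).card ≤ ∑ j ∈ Finset.range (n / 2 + 1), 4 ^ j * ((UU (n - 2 * j)).card * 24) := by
  classical
  refine Finset.card_biUnion_le.trans (Finset.sum_le_sum fun j _ => ?_)
  refine Finset.card_image_le.trans ?_
  rw [Finset.card_product, Finset.card_product, Finset.card_univ, Finset.card_univ,
    Fintype.card_perm, Fintype.card_fun]
  simp [Nat.factorial]

lemma TT_card {z : ℝ} (h0 : 398 / 1000 < z) (h1 : z < 4 / 10)
    (hz : 1 - 3 * z + z ^ 2 + z ^ 3 - z ^ 4 = 0) (n : ℕ) :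
    ((TT n).card : ℝ) ≤ 5000000 * (z⁻¹) ^ n := by
  have hz0 : 0 < z := by linarith
  have a1 := (Nat.cast_le (α := ℝ)).mpr (TT_card_nat n)
  push_cast at a1
  refine a1.trans ?_
  have a2 : ∀ j ∈ Finset.range (n / 2 + 1), (4 : ℝ) ^ j * ((UU (n - 2 * j)).card * 24) ≤
      (60000 * 24) * (z⁻¹) ^ n * (64 / 100 : ℝ) ^ j := by
    intro j hj
    rw [Finset.mem_range] at hj
    have a3 := UU_card h0 h1 hz (n - 2 * j)
    have a4 : (z⁻¹) ^ (n - 2 * j) = (z⁻¹) ^ n * (z ^ 2) ^ j := by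
      have : (z⁻¹) ^ n = (z⁻¹) ^ (n - 2 * j) * (z⁻¹) ^ (2 * j) := by
        rw [← pow_add]; congr 1; omega
      rw [this, mul_assoc, ← pow_mul, ← mul_pow, inv_mul_cancel₀ hz0.ne']
      simp
    rw [a4] at a3
    calc (4 : ℝ) ^ j * ((UU (n - 2 * j)).card * 24) ≤
        4 ^ j * (60000 * ((z⁻¹) ^ n * (z ^ 2) ^ j) * 24) := by gcongr
      _ = (60000 * 24) * (z⁻¹) ^ n * (4 * z ^ 2) ^ j := by rw [mul_pow]; ring
      _ ≤ _ := by
        gcongr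
        nlinarith
  refine (Finset.sum_le_sum a2).trans ?_
  rw [← Finset.mul_sum]
  have a5 : ∑ j ∈ Finset.range (n / 2 + 1), (64 / 100 : ℝ) ^ j ≤ 3 := by
    rw [geom_sum_eq (by norm_num)]
    have : (0 : ℝ) ≤ (64 / 100) ^ (n / 2 + 1) := by positivity
    rw [show (64 / 100 - 1 : ℝ) = -(36 / 100) by norm_num, div_neg, ← neg_div,
      div_le_iff₀ (by norm_num)]
    linarith
  have : 0 ≤ (z⁻¹) ^ n := by positivity
  nlinarith

lemma mem_TT {w : F2} (h : PotPos2 w) : w.toWord ∈ TT (FreeGroup.norm w) := by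
  classical
  obtain ⟨p, d, f, hw, hd⟩ := structure_pp h
  have hn : FreeGroup.norm w = d.length + 2 * p.length := by
    rw [FreeGroup.norm, hw]
    simp
    omega
  rw [TT, Finset.mem_biUnion]
  refine ⟨p.length, by simp; omega, ?_⟩
  rw [Finset.mem_image]
  refine ⟨(p.get, d, f), ?_, by simp [hw]⟩
  simp only [Finset.mem_product, Finset.mem_univ, true_and, and_true]
  rw [show FreeGroup.norm w - 2 * p.length = d.length by omega, UU, Finset.mem_union]
  rcases hd with hd | ⟨N, h1, h2, hd⟩
  · left
    rw [mem_words]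
    exact ⟨rfl, hd⟩
  · right
    rw [Finset.mem_biUnion]
    exact ⟨N, by simp; omega, by rw [mem_words]; exact ⟨rfl, hd⟩⟩

lemma growth_upper (n : ℕ) : growth2 {w | PotPos2 w} n ≤ (TT n).card := by
  have e : Nat.card {l // l ∈ TT n} = (TT n).card := by simp
  rw [growth2, ← e]
  refine Nat.card_le_card_of_injective
    (fun w => ⟨w.1.toWord, by obtain ⟨w, h1, h2⟩ := w; subst h2; exact mem_TT h1⟩) ?_
  intro a b h
  simp only [Subtype.mk.injEq] at h
  exact Subtype.ext (toWord_injective h)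

end PPG

namespace PPG
open FreeGroup

noncomputable def psi (N : ℕ) : F2 →* F2 :=
  FreeGroup.lift (fun i => if i = 0 then ga * gb ^ N else (gb⁻¹) ^ (N + 1) * ga⁻¹)

noncomputable def theta (N : ℕ) : F2 →* F2 :=
  FreeGroup.lift (fun i => if i = 0 then ga * (gb * ga) ^ N else ga⁻¹ * gb⁻¹)

lemma psi_a (N) : psi N ga = ga * gb ^ N := by simp [psi]
lemma psi_b (N) : psi N gb = (gb⁻¹) ^ (N + 1) * ga⁻¹ := by simp [psi]
lemma theta_a (N) : theta N ga = ga * (gb * ga) ^ N := by simp [theta]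
lemma theta_b (N) : theta N gb = (gb * ga)⁻¹ := by simp [theta]

lemma psi_ba (N) : psi N gb * psi N ga = gb⁻¹ := by
  rw [psi_a, psi_b, pow_succ']
  simp [mul_assoc]

noncomputable def psiE (N : ℕ) : F2 ≃* F2 :=
  MonoidHom.toMulEquiv (psi N) (theta N)
    (by
      refine FreeGroup.ext_hom _ _ fun i => ?_
      fin_cases i
      · change theta N (psi N ga) = ga
        rw [psi_a, _root_.map_mul, _root_.map_pow, theta_a, theta_b, inv_pow, mul_inv_cancel_right]
      · change theta N (psi N gb) = gb
        rw [psi_b, _root_.map_mul, _root_.map_pow, _root_.map_inv, _root_.map_inv, theta_a, theta_b, pow_succ']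
        simp)
    (by
      refine FreeGroup.ext_hom _ _ fun i => ?_
      fin_cases i
      · change psi N (theta N ga) = ga
        rw [theta_a, _root_.map_mul, _root_.map_pow, _root_.map_mul, psi_ba, psi_a]
        simp
      · change psi N (theta N gb) = gb
        rw [theta_b, _root_.map_inv, _root_.map_mul, psi_ba]
        simp)

noncomputable def MM (N : ℕ) : Submonoid F2 :=
  (Submonoid.closure (Set.range (FreeGroup.of : Fin 2 → F2))).map (psi N)

lemma potPos_of_MM {N : ℕ} {w : F2} (h : w ∈ MM N) : PotPos2 w := by
  obtain ⟨v, hv, rfl⟩ := h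
  refine ⟨(psiE N).symm, ?_⟩
  have : (psiE N).symm (psi N v) = v := (psiE N).symm_apply_apply v
  rw [this]
  exact hv

lemma MM_a (N) : ga * gb ^ N ∈ MM N :=
  ⟨ga, Submonoid.subset_closure ⟨0, rfl⟩, psi_a N⟩
lemma MM_b (N) : (gb⁻¹) ^ (N + 1) * ga⁻¹ ∈ MM N :=
  ⟨gb, Submonoid.subset_closure ⟨1, rfl⟩, psi_b N⟩
lemma MM_B (N) : gb⁻¹ ∈ MM N := by
  rw [← psi_ba N, psi_a, psi_b]
  exact mul_mem (MM_b N) (MM_a N)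
lemma MM_z (N : ℕ) {k : ℤ} (hk : k ≤ 0) : gb ^ k ∈ MM N := by
  obtain ⟨j, rfl⟩ : ∃ j : ℕ, k = -j := ⟨(-k).toNat, by omega⟩
  rw [zpow_neg, zpow_natCast, ← inv_pow]
  exact pow_mem (MM_B N) j

lemma MM_b' (N : ℕ) : gb ^ (-(N + 1) : ℤ) * ga⁻¹ ∈ MM N := by
  have := MM_b N
  rw [inv_pow] at this
  rw [zpow_neg]
  exact_mod_cast this

lemma MM_ab (N : ℕ) {k : ℤ} (hk : k ≤ N) : ga * gb ^ k ∈ MM N := by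
  have : ga * gb ^ k = (ga * gb ^ N) * gb ^ (k - N) := by
    rw [mul_assoc, ← zpow_natCast, ← zpow_add]; congr 2; ring
  rw [this]
  exact mul_mem (MM_a N) (MM_z N (by omega))

lemma mk_a (e : Bool) : (mk [(0, e)] : F2) = if e then ga else ga⁻¹ := by
  cases e <;> simp [ga, of, inv_mk, invRev]
lemma mk_b (e : Bool) : (mk [(1, e)] : F2) = gb ^ bs e := by
  cases e <;> simp [gb, of, inv_mk, invRev]

lemma acc_MM (N : ℕ) (l : List Lt) : ∀ fl k,
    (accL (fl, some true, k) l → k + l.length ≤ N → l.length ≤ N → ga * gb ^ k * mk l ∈ MM N) ∧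
    (accL (fl, some false, k) l → k ≤ 0 → l.length ≤ N →
      gb ^ (-(N + 1) : ℤ) * ga⁻¹ * gb ^ k * mk l ∈ MM N) := by
  induction l with
  | nil =>
    intro fl k
    refine ⟨fun _ h _ => ?_, fun _ h _ => ?_⟩
    · rw [← one_eq_mk, mul_one]
      exact MM_ab N (by simpa using h)
    · rw [← one_eq_mk, mul_one]
      exact mul_mem (MM_b' N) (MM_z N h)
  | cons x l ih =>
    intro fl k
    refine ⟨fun h hl hl' => ?_, fun h hk hl => ?_⟩
    · obtain ⟨h1, h2⟩ := h
      simp only [List.length_cons] at hl hl'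
      push_cast at hl
      rw [mk_cons]
      obtain ⟨e, rfl⟩ | ⟨e, rfl⟩ := lt_cases x
      · rw [nxt_a] at h2
        rw [alw_a] at h1
        rw [mk_a]
        cases e
        · simp only [alA] at h1
          have := (ih _ _).2 h2 le_rfl (by omega)
          have e : ga * gb ^ k * ((if false = true then ga else ga⁻¹) * mk l) =
            (ga * gb ^ (k + N + 1)) * (gb ^ (-(N + 1) : ℤ) * ga⁻¹ * gb ^ (0 : ℤ) * mk l) := by
            have : gb ^ k = gb ^ (k + N + 1) * gb ^ (-(N + 1) : ℤ) := by
              rw [← zpow_add]; congr 1; ring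
            rw [this]; simp [mul_assoc]
          rw [e]
          exact mul_mem (MM_ab N (by omega)) this
        · have := (ih _ _).1 h2 (by omega) (by omega)
          have e : ga * gb ^ k * ((if true = true then ga else ga⁻¹) * mk l) =
            (ga * gb ^ k) * (ga * gb ^ (0 : ℤ) * mk l) := by simp
          rw [e]
          exact mul_mem (MM_ab N (by omega)) this
      · rw [nxt_b] at h2
        rw [mk_b, mul_assoc, ← mul_assoc (gb ^ k), ← zpow_add, ← mul_assoc]
        exact (ih _ _).1 h2 (by cases e <;> simp <;> omega) (by omega)
    · obtain ⟨h1, h2⟩ := h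
      simp only [List.length_cons] at hl
      rw [mk_cons]
      obtain ⟨e, rfl⟩ | ⟨e, rfl⟩ := lt_cases x
      · rw [nxt_a] at h2
        rw [alw_a] at h1
        rw [mk_a]
        cases e
        · simp only [alA] at h1
        · have := (ih _ _).1 h2 (by omega) (by omega)
          have e : gb ^ (-(N + 1) : ℤ) * ga⁻¹ * gb ^ k * ((if true = true then ga else ga⁻¹) * mk l) =
            (gb ^ (-(N + 1) : ℤ) * ga⁻¹) * gb ^ k * (ga * gb ^ (0 : ℤ) * mk l) := by simp [mul_assoc]
          rw [e]
          exact mul_mem (mul_mem (MM_b' N) (MM_z N hk)) this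
      · rw [nxt_b] at h2
        rw [alw_b] at h1
        cases e
        · rw [mk_b, mul_assoc, ← mul_assoc (gb ^ k), ← zpow_add, ← mul_assoc]
          exact (ih _ _).2 h2 (by simp; omega) (by omega)
        · simp only [alB] at h1

lemma acc_red (l : List Lt) : ∀ fl e k, (e = false → k ≤ 0) → accL (fl, some e, k) l →
    FreeGroup.IsReduced ((if k = 0 then ((0, e) : Lt) else (1, decide (0 < k))) :: l) := by
  induction l with
  | nil => intros; simp
  | cons x l ih =>
    intro fl e k he h
    obtain ⟨h1, h2⟩ := h
    rw [FreeGroup.isReduced_cons_cons]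
    obtain ⟨e', rfl⟩ | ⟨e', rfl⟩ := lt_cases x
    · rw [nxt_a] at h2
      rw [alw_a] at h1
      have := ih _ _ _ (by simp) h2
      refine ⟨?_, by simpa using this⟩
      split_ifs with hk
      · subst hk
        cases e <;> cases e' <;> simp [alA] at *
      · simp
    · rw [nxt_b] at h2
      rw [alw_b] at h1
      have hb : (e = false → k + bs e' ≤ 0) := by
        cases e <;> cases e' <;> simp [alB] at *; omega
      have := ih _ _ _ hb h2
      have h3 : (if k + bs e' = 0 then ((0, e) : Lt) else (1, decide (0 < k + bs e'))) = (1, e') := by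
        cases e <;> cases e' <;> simp [alB] at * <;> (try rw [if_neg (by omega)]) <;> simp <;> omega
      rw [h3] at this
      refine ⟨?_, this⟩
      split_ifs with hk
      · simp
      · cases e <;> cases e' <;> simp [alB] at * <;> omega

lemma growth_lower (n : ℕ) :
    (words (alw (fun _ => True) (fun _ => False)) nxt (fun _ => True) (false, some true, 0) n).card ≤
      growth2 {w | PotPos2 w} (n + 1) := by
  set W := words (alw (fun _ => True) (fun _ => False)) nxt (fun _ => True) (false, some true, 0) n with hW
  have e : Nat.card {l // l ∈ W} = W.card := by simp
  rw [growth2, ← e]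
  have : Finite {w : F2 // w ∈ {w | PotPos2 w} ∧ FreeGroup.norm w = n + 1} := by
    have hf : Finite ((TT (n + 1) : Finset (List Lt)) : Set (List Lt)) := (TT (n + 1)).finite_toSet
    have hm : ∀ w : {w : F2 // w ∈ {w | PotPos2 w} ∧ FreeGroup.norm w = n + 1},
        w.1.toWord ∈ ((TT (n + 1) : Finset (List Lt)) : Set (List Lt)) := by
      intro w
      have := mem_TT w.2.1
      rw [w.2.2] at this
      exact this
    refine Finite.of_injective (fun w => (⟨w.1.toWord, hm w⟩ : ((TT (n + 1) : Finset (List Lt)) : Set (List Lt)))) ?_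
    intro a b h
    exact Subtype.ext (toWord_injective (congrArg Subtype.val h))
  have hred : ∀ l ∈ W, (mk ((0, true) :: l) : F2).toWord = (0, true) :: l := by
    intro l hl
    rw [hW, mem_words] at hl
    have := acc_red l _ _ _ (by simp) hl.2
    simp at this
    rw [toWord_mk, this.reduce_eq]
  refine Nat.card_le_card_of_injective
    (fun l => ⟨mk ((0, true) :: l.1), ?_, ?_⟩) ?_
  · obtain ⟨l, hl⟩ := l
    rw [hW, mem_words] at hl
    have := (acc_MM n l false 0).1 hl.2 (by simp; omega) (by omega)
    simp only [zpow_zero, mul_one] at this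
    change PotPos2 (mk ((0, true) :: l))
    rw [mk_cons]
    exact potPos_of_MM this
  · rw [FreeGroup.norm, hred _ l.2]
    have := ((mem_words _ _ _ _ _ _).mp l.2).1
    simp [this]
  · intro a b h
    simp only [Subtype.mk.injEq] at h
    have := congrArg toWord h
    rw [hred _ a.2, hred _ b.2] at this
    exact Subtype.ext (List.cons.inj this).2

end PPG

theorem pp_growth_F2 (lam : ℝ)
    (hroot : lam ^ 4 - 3 * lam ^ 3 + lam ^ 2 + lam - 1 = 0)
    (hmax : ∀ x : ℝ, x ^ 4 - 3 * x ^ 3 + x ^ 2 + x - 1 = 0 → x ≤ lam) :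
    ∃ c > (0 : ℝ), ∃ C > (0 : ℝ), ∃ m : ℕ, ∀ n ≥ m,
      c * lam ^ n ≤ (growth2 {w | PotPos2 w} n : ℝ) ∧
      (growth2 {w | PotPos2 w} n : ℝ) ≤ C * lam ^ n := by
  obtain ⟨h0, h1, hz⟩ := PPG.lam_facts lam hroot hmax
  have hl : 0 < lam := by
    have : 0 < lam⁻¹ := by linarith
    simpa using this
  refine ⟨1 / 2 * lam⁻¹, by positivity, 5000000, by norm_num, 1, fun n hn => ⟨?_, ?_⟩⟩
  · obtain ⟨k, rfl⟩ : ∃ k, n = k + 1 := ⟨n - 1, by omega⟩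
    have a1 := PPG.L_lower (by linarith) (by linarith) hz k
    have a2 := (Nat.cast_le (α := ℝ)).mpr (PPG.growth_lower k)
    rw [inv_inv] at a1
    refine le_trans (le_of_eq ?_) (a1.trans a2)
    field_simp
    ring
  · have a1 := PPG.TT_card h0 h1 hz n
    have a2 := (Nat.cast_le (α := ℝ)).mpr (PPG.growth_upper n)
    rw [inv_inv] at a1
    exact a2.trans a1
end

section
/- (Goldstein's Criterion) Let w ∈ F₂ be cyclically reduced and potentially positive. Then there exist letters x, y ∈ {a, a⁻¹, b, b⁻¹} such that, viewing w as a cyclic word, every occurrence of x is immediately preceded by y and immediately followed by y; equivalently, for every letter z ≠ y, neither the two-letter list [z, x] nor [x, z] occurs as a cyclic subword of w. -/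
def CyclicallyReduced2 (w : F2) : Prop :=
  ∀ x ∈ w.toWord.head?, ∀ y ∈ w.toWord.getLast?, x ≠ (y.1, !y.2)

/-- `u` occurs as a cyclic subword of `w`. -/
def CyclicSubword2 (u : List (Fin 2 × Bool)) (w : F2) : Prop :=
  u.length ≤ w.toWord.length ∧ u <:+: (w.toWord ++ w.toWord)

section Metric
open FreeGroup

/-- Length of the longest common prefix. -/
def lcpLen {α : Type*} [DecidableEq α] : List α → List α → ℕ
  | x :: l, y :: m => if x = y then lcpLen l m + 1 else 0
  | _, _ => 0

theorem lcpLen_ultra {α : Type*} [DecidableEq α] (x y z : List α) :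
    min (lcpLen x y) (lcpLen y z) ≤ lcpLen x z := by
  induction y generalizing x z with
  | nil => simp [lcpLen]
  | cons b y ih =>
    cases x with
    | nil => simp [lcpLen]
    | cons a x =>
      cases z with
      | nil => simp [lcpLen]
      | cons c z =>
        have := ih x z
        simp only [lcpLen]
        split_ifs <;> simp_all

theorem lcpLen_spec {α : Type*} [DecidableEq α] (x y : List α) (i : ℕ) (h : i < lcpLen x y) :
    x[i]? = y[i]? := by
  induction x generalizing y i with
  | nil => simp [lcpLen] at h
  | cons a x ih =>
    cases y with
    | nil => simp [lcpLen] at h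
    | cons b y =>
      simp only [lcpLen] at h
      split_ifs at h with hab
      · cases i with
        | zero => simp [hab]
        | succ i => simpa using ih y i (by omega)
      · omega

theorem norm_mk_reduced {L : List (Fin 2 × Bool)} (h : IsReduced L) :
    FreeGroup.norm (FreeGroup.mk L) = L.length := by
  simp [FreeGroup.norm, h.reduce_eq]

theorem invRev_reduced {L : List (Fin 2 × Bool)} (h : IsReduced L) : IsReduced (invRev L) := by
  rw [isReduced_iff_reduce_eq, reduce_invRev, h.reduce_eq]

theorem norm_lcp_aux (L M : List (Fin 2 × Bool)) (hL : IsReduced L) (hM : IsReduced M) :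
    FreeGroup.norm ((FreeGroup.mk L)⁻¹ * FreeGroup.mk M) + 2 * lcpLen L M
      = L.length + M.length := by
  induction L generalizing M with
  | nil => simp [lcpLen, ← one_eq_mk, norm_mk_reduced hM]
  | cons p L ih =>
    cases M with
    | nil => simp [lcpLen, ← one_eq_mk, norm_mk_reduced hL, norm_inv_eq, -inv_mk]
    | cons q M =>
      by_cases h : p = q
      · subst h
        have := ih M (hL.infix ⟨[p], [], by simp⟩) (hM.infix ⟨[p], [], by simp⟩)
        have e : (FreeGroup.mk (p :: L))⁻¹ * FreeGroup.mk (p :: M)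
            = (FreeGroup.mk L)⁻¹ * FreeGroup.mk M := by
          have h1 : ∀ N, FreeGroup.mk (p :: N) = FreeGroup.mk [p] * FreeGroup.mk N := by
            intro N; simp [mul_mk]
          rw [h1 L, h1 M]; group
        rw [e]; simp only [lcpLen, if_true, List.length_cons]; omega
      · simp only [lcpLen, h, if_false, inv_mk, mul_mk]
        rw [norm_mk_reduced]
        · simp
        · have h1 := invRev_reduced hL
          unfold FreeGroup.IsReduced at *
          rw [List.isChain_append]
          refine ⟨h1, hM, ?_⟩
          intro x hx y hy
          simp [invRev] at hx hy
          subst hx; subst hy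
          intro h2
          rcases p with ⟨p, s⟩; rcases q with ⟨q, t⟩
          simp at h2 h ⊢
          have := h h2
          cases s <;> cases t <;> simp_all

theorem norm_lcp (x y : F2) :
    FreeGroup.norm (x⁻¹ * y) + 2 * lcpLen x.toWord y.toWord
      = FreeGroup.norm x + FreeGroup.norm y := by
  have := norm_lcp_aux x.toWord y.toWord isReduced_toWord isReduced_toWord
  simp only [mk_toWord] at this
  exact this

theorem four_point (x y z : F2) :
    FreeGroup.norm (x⁻¹ * z) + FreeGroup.norm y ≤
      max (FreeGroup.norm (x⁻¹ * y) + FreeGroup.norm z)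
        (FreeGroup.norm (y⁻¹ * z) + FreeGroup.norm x) := by
  have h1 := norm_lcp x y
  have h2 := norm_lcp y z
  have h3 := norm_lcp x z
  have := lcpLen_ultra x.toWord y.toWord z.toWord
  omega

theorem norm_symm (x y : F2) : FreeGroup.norm (x⁻¹ * y) = FreeGroup.norm (y⁻¹ * x) := by
  rw [← norm_inv_eq]; simp

theorem norm_parity (x y : F2) :
    ∃ k, FreeGroup.norm (x * y) + 2 * k = FreeGroup.norm x + FreeGroup.norm y := by
  have := norm_lcp x⁻¹ y
  rw [norm_inv_eq, inv_inv] at this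
  exact ⟨_, this⟩

theorem norm_sq (y : F2) (hy : y ≠ 1) : FreeGroup.norm y < FreeGroup.norm (y * y) := by
  have h := norm_lcp y⁻¹ y
  rw [norm_inv_eq, inv_inv, toWord_inv] at h
  have hne : y.toWord ≠ [] := by simpa using hy
  have hpos : 0 < y.toWord.length := List.length_pos_iff.2 hne
  have hn : FreeGroup.norm y = y.toWord.length := rfl
  have hr : IsReduced y.toWord := isReduced_toWord
  generalize y.toWord = L at *
  by_contra hc
  have hk : (L.length - 1) / 2 < lcpLen (invRev L) L := by omega
  have := lcpLen_spec _ _ _ hk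
  have hi : (L.length - 1) / 2 < L.length := by omega
  have hj : L.length - 1 - (L.length - 1) / 2 < L.length := by omega
  rw [List.getElem?_eq_getElem (by simpa using hi), List.getElem?_eq_getElem hi] at this
  simp [invRev] at this
  rcases Nat.even_or_odd' L.length with ⟨c, hc' | hc'⟩
  · have e : L.length - 1 - (L.length - 1) / 2 = (L.length - 1) / 2 + 1 := by omega
    simp only [e] at this
    have h2 := (List.isChain_iff_getElem.1 hr) ((L.length - 1) / 2) (by omega)
    rw [← this] at h2
    simp at h2
  · have e : L.length - 1 - (L.length - 1) / 2 = (L.length - 1) / 2 := by omega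
    simp only [e] at this
    have := congrArg Prod.snd this
    simp at this

theorem half_prefix (v : F2) (h : ℕ) (hv : FreeGroup.norm v = 2 * h) :
    ∃ p : F2, FreeGroup.norm p = h ∧ FreeGroup.norm (p⁻¹ * v) = h := by
  refine ⟨FreeGroup.mk (v.toWord.take h), ?_, ?_⟩
  · have hr : IsReduced (v.toWord.take h) :=
      isReduced_toWord.infix (List.take_prefix h v.toWord).isInfix
    rw [norm_mk_reduced hr, List.length_take]
    change v.toWord.length = _ at hv
    omega
  · have hr : IsReduced (v.toWord.drop h) :=
      isReduced_toWord.infix (List.drop_suffix h v.toWord).isInfix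
    have : v = FreeGroup.mk (v.toWord.take h) * FreeGroup.mk (v.toWord.drop h) := by
      rw [mul_mk, List.take_append_drop, mk_toWord]
    have e : (FreeGroup.mk (v.toWord.take h))⁻¹ * v = FreeGroup.mk (v.toWord.drop h) := by
      rw [inv_mul_eq_iff_eq_mul]; exact this
    rw [e]
    rw [norm_mk_reduced hr, List.length_drop]
    change v.toWord.length = _ at hv
    omega

end Metric

section Auts
open FreeGroup hiding map_mul map_inv map_one norm_eq_zero norm

abbrev ga : F2 := FreeGroup.of 0
abbrev gb : F2 := FreeGroup.of 1

theorem hom_ext2 {G : Type*} [Group G] {f g : F2 →* G} (ha : f ga = g ga) (hb : f gb = g gb) :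
    f = g := by
  ext i
  fin_cases i
  · exact ha
  · exact hb

theorem aut_ext {f g : MulAut F2} (ha : f ga = g ga) (hb : f gb = g gb) : f = g := by
  have : f.toMonoidHom = g.toMonoidHom := hom_ext2 ha hb
  ext x
  exact DFunLike.congr_fun this x

def homOf (u v : F2) : F2 →* F2 := FreeGroup.lift ![u, v]

@[simp] theorem homOf_a (u v : F2) : homOf u v (FreeGroup.of 0) = u := by simp [homOf]
@[simp] theorem homOf_b (u v : F2) : homOf u v (FreeGroup.of 1) = v := by simp [homOf]

def autOf (u v u' v' : F2) (h1 : homOf u' v' u = ga) (h2 : homOf u' v' v = gb)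
    (h3 : homOf u v u' = ga) (h4 : homOf u v v' = gb) : MulAut F2 :=
  MonoidHom.toMulEquiv (homOf u v) (homOf u' v')
    (hom_ext2 (by simpa using h1) (by simpa using h2))
    (hom_ext2 (by simpa using h3) (by simpa using h4))

theorem autOf_apply (u v u' v' : F2) (h1 h2 h3 h4) (x : F2) :
    autOf u v u' v' h1 h2 h3 h4 x = homOf u v x := rfl

/-- a ↦ ab -/
def tauA : MulAut F2 := autOf (ga * gb) gb (ga * gb⁻¹) gb
  (by simp) (by simp) (by simp) (by simp)
/-- b ↦ ba -/
def tauB : MulAut F2 := autOf ga (gb * ga) ga (gb * ga⁻¹)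
  (by simp) (by simp) (by simp) (by simp)
/-- b ↦ b⁻¹ -/
def sB : MulAut F2 := autOf ga gb⁻¹ ga gb⁻¹ (by simp) (by simp) (by simp) (by simp)
/-- a ↦ a⁻¹ -/
def sA : MulAut F2 := autOf ga⁻¹ gb ga⁻¹ gb (by simp) (by simp) (by simp) (by simp)
def swp : MulAut F2 := autOf gb ga gb ga (by simp) (by simp) (by simp) (by simp)

@[simp] theorem tauA_a : tauA (FreeGroup.of 0) = ga * gb := (autOf_apply _ _ _ _ _ _ _ _ _).trans (homOf_a _ _)
@[simp] theorem tauA_b : tauA (FreeGroup.of 1) = gb := (autOf_apply _ _ _ _ _ _ _ _ _).trans (homOf_b _ _)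
@[simp] theorem tauB_a : tauB (FreeGroup.of 0) = ga := (autOf_apply _ _ _ _ _ _ _ _ _).trans (homOf_a _ _)
@[simp] theorem tauB_b : tauB (FreeGroup.of 1) = gb * ga := (autOf_apply _ _ _ _ _ _ _ _ _).trans (homOf_b _ _)
@[simp] theorem sB_a : sB (FreeGroup.of 0) = ga := (autOf_apply _ _ _ _ _ _ _ _ _).trans (homOf_a _ _)
@[simp] theorem sB_b : sB (FreeGroup.of 1) = gb⁻¹ := (autOf_apply _ _ _ _ _ _ _ _ _).trans (homOf_b _ _)
@[simp] theorem sA_a : sA (FreeGroup.of 0) = ga⁻¹ := (autOf_apply _ _ _ _ _ _ _ _ _).trans (homOf_a _ _)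
@[simp] theorem sA_b : sA (FreeGroup.of 1) = gb := (autOf_apply _ _ _ _ _ _ _ _ _).trans (homOf_b _ _)
@[simp] theorem swp_a : swp (FreeGroup.of 0) = gb := (autOf_apply _ _ _ _ _ _ _ _ _).trans (homOf_a _ _)
@[simp] theorem swp_b : swp (FreeGroup.of 1) = ga := (autOf_apply _ _ _ _ _ _ _ _ _).trans (homOf_b _ _)

/-- The subgroup generated by elementary and inner automorphisms. -/
def HH : Subgroup (MulAut F2) :=
  Subgroup.closure ({tauA, sB, swp} ∪ Set.range (MulAut.conj : F2 → MulAut F2))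

theorem tauA_mem : tauA ∈ HH := Subgroup.subset_closure (by simp)
theorem sB_mem : sB ∈ HH := Subgroup.subset_closure (by simp)
theorem swp_mem : swp ∈ HH := Subgroup.subset_closure (by simp)
theorem conj_mem (c : F2) : MulAut.conj c ∈ HH := Subgroup.subset_closure (by simp)
theorem sA_mem : sA ∈ HH := by
  have : sA = swp * sB * swp := aut_ext (by simp) (by simp)
  rw [this]
  exact mul_mem (mul_mem swp_mem sB_mem) swp_mem

def NN (φ : MulAut F2) : ℕ := FreeGroup.norm (φ ga) + FreeGroup.norm (φ gb)

/-- Nielsen-minimal automorphisms. -/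
def MinAut (φ : MulAut F2) : Prop :=
  ∀ (c : F2), ∀ h ∈ HH, NN φ ≤ NN (MulAut.conj c * φ * h)

theorem MinAut.le {φ : MulAut F2} (m : MinAut φ) {h : MulAut F2} (hh : h ∈ HH) :
    NN φ ≤ NN (φ * h) := by
  simpa using m 1 h hh

theorem MinAut.mul {φ : MulAut F2} (m : MinAut φ) {h : MulAut F2} (hh : h ∈ HH)
    (e : NN (φ * h) = NN φ) : MinAut (φ * h) := by
  intro c k hk
  rw [e]
  simpa [mul_assoc] using m c (h * k) (mul_mem hh hk)

theorem MinAut.sB {φ : MulAut F2} (m : MinAut φ) : MinAut (φ * sB) :=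
  m.mul sB_mem (by simp [NN, norm_inv_eq])
theorem MinAut.sA {φ : MulAut F2} (m : MinAut φ) : MinAut (φ * sA) :=
  m.mul sA_mem (by simp [NN, norm_inv_eq])
theorem MinAut.swp {φ : MulAut F2} (m : MinAut φ) : MinAut (φ * swp) :=
  m.mul swp_mem (by simp [NN, add_comm])

theorem MinAut.n1 {φ : MulAut F2} (m : MinAut φ) :
    FreeGroup.norm (φ ga) ≤ FreeGroup.norm (φ ga * φ gb) := by
  have := m.le tauA_mem
  simpa [NN] using this

theorem MinAut.n1' {φ : MulAut F2} (m : MinAut φ) :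
    FreeGroup.norm (φ gb) ≤ FreeGroup.norm (φ ga * φ gb) := by
  have := (m.sA.sB.swp).n1
  simp at this
  rw [← norm_inv_eq, ← norm_inv_eq (x := φ ga * φ gb)]
  simpa using this

theorem gb_ne (φ : MulAut F2) : φ gb ≠ 1 := by
  simp

theorem MinAut.n2 {φ : MulAut F2} (m : MinAut φ)
    (h1 : FreeGroup.norm (φ ga * φ gb) = FreeGroup.norm (φ ga))
    (h2 : FreeGroup.norm (φ gb * φ ga) = FreeGroup.norm (φ ga)) : False := by
  have hb : φ gb ≠ 1 := gb_ne φ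
  have h0 := m.n1'
  obtain ⟨h, hh⟩ : ∃ h, FreeGroup.norm (φ gb) = 2 * h := by
    obtain ⟨k, hk⟩ := norm_parity (φ ga) (φ gb)
    exact ⟨k, by omega⟩
  obtain ⟨p, hp, hq⟩ := half_prefix _ _ hh
  have hm := m p⁻¹ (MulAut.conj gb * tauA) (mul_mem (conj_mem _) tauA_mem)
  have hpos : 0 < FreeGroup.norm (φ gb) := by
    rw [Nat.pos_iff_ne_zero]; simpa [FreeGroup.norm_eq_zero] using hb
  simp only [NN, MulAut.mul_apply, MulAut.conj_apply, tauA_a, tauA_b] at hm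
  simp only [map_mul, map_inv, inv_inv] at hm
  generalize φ ga = u at *
  generalize φ gb = v at *
  have e1 : p⁻¹ * (v * (u * v) * v⁻¹) * p = (p⁻¹ * v) * (u * p) := by group
  have e2 : p⁻¹ * (v * v * v⁻¹) * p = (p⁻¹ * v) * p := by group
  rw [e1, e2] at hm
  obtain ⟨q, hqd⟩ : ∃ q, q = p⁻¹ * v := ⟨_, rfl⟩
  rw [← hqd] at hm hq
  have hv : v = p * q := by rw [hqd]; group
  have f1 := four_point u⁻¹ v p
  have f2 := four_point q⁻¹ v⁻¹ u
  have f3 := four_point q⁻¹ u (u * p)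
  have f4 := norm_mul_le q p
  have e3 : FreeGroup.norm (v⁻¹ * p) = h := by rw [norm_symm, ← hqd, hq]
  have e4 : q * v⁻¹ = p⁻¹ := by rw [hv]; group
  simp only [inv_inv, norm_inv_eq, e4, inv_mul_cancel_left, e3] at f1 f2 f3
  omega

theorem MinAut.n3 {φ : MulAut F2} (_m : MinAut φ)
    (h1 : FreeGroup.norm (φ ga * φ gb) = FreeGroup.norm (φ ga))
    (h2 : FreeGroup.norm (φ gb * (φ ga)⁻¹) = FreeGroup.norm (φ ga)) : False := by
  have hb : φ gb ≠ 1 := gb_ne φ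
  have := norm_sq _ hb
  have h := four_point (φ gb) ((φ ga)⁻¹) ((φ gb)⁻¹)
  have e1 := norm_symm (φ gb) ((φ ga)⁻¹)
  have e2 := norm_inv_eq (x := (φ gb)⁻¹ * (φ gb)⁻¹)
  have e3 := norm_inv_eq (x := (φ ga * (φ gb)⁻¹))
  simp [norm_inv_eq] at *
  omega

/-- image of a letter -/
def XX (φ : MulAut F2) (l : Fin 2 × Bool) : F2 := φ (FreeGroup.mk [l])

theorem XX_inv (φ : MulAut F2) (i : Fin 2) (s : Bool) : XX φ (i, !s) = (XX φ (i, s))⁻¹ := by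
  unfold XX
  rw [← map_inv, inv_mk]
  simp [invRev]

theorem XX_true (φ : MulAut F2) (i : Fin 2) : XX φ (i, true) = φ (FreeGroup.of i) := rfl
theorem XX_false (φ : MulAut F2) (i : Fin 2) : XX φ (i, false) = (φ (FreeGroup.of i))⁻¹ :=
  XX_inv φ i true

theorem MinAut.pair {φ : MulAut F2} (m : MinAut φ) (x y : Fin 2 × Bool) (h : x.1 ≠ y.1) :
    ∃ ψ : MulAut F2, MinAut ψ ∧ ψ ga = XX φ x ∧ ψ gb = XX φ y := by
  rcases x with ⟨x, s⟩; rcases y with ⟨y, t⟩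
  fin_cases x <;> fin_cases y <;> cases s <;> cases t <;> simp at h
  · exact ⟨_, m.sA.sB, by simp [XX_true, XX_false]⟩
  · exact ⟨_, m.sA, by simp [XX_true, XX_false]⟩
  · exact ⟨_, m.sB, by simp [XX_true, XX_false]⟩
  · exact ⟨_, m, by simp [XX_true]⟩
  · exact ⟨_, m.swp.sA.sB, by simp [XX_true, XX_false]⟩
  · exact ⟨_, m.swp.sA, by simp [XX_true, XX_false]⟩
  · exact ⟨_, m.swp.sB, by simp [XX_true, XX_false]⟩
  · exact ⟨_, m.swp, by simp [XX_true]⟩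

theorem XX_ne (φ : MulAut F2) (x : Fin 2 × Bool) : XX φ x ≠ 1 := by
  rcases x with ⟨x, s⟩
  cases s <;> simp [XX_true, XX_false]

theorem eq_or_ne_fst {x y : Fin 2 × Bool} (h : x.1 = y.1 → x.2 = y.2) : x = y ∨ x.1 ≠ y.1 := by
  by_cases e : x.1 = y.1
  · exact Or.inl (Prod.ext e (h e))
  · exact Or.inr e

theorem MinAut.N1 {φ : MulAut F2} (m : MinAut φ) {x y : Fin 2 × Bool}
    (h : x.1 = y.1 → x.2 = y.2) :
    FreeGroup.norm (XX φ x) ≤ FreeGroup.norm (XX φ x * XX φ y) ∧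
    FreeGroup.norm (XX φ y) ≤ FreeGroup.norm (XX φ x * XX φ y) := by
  rcases eq_or_ne_fst h with rfl | h
  · have := norm_sq _ (XX_ne φ x)
    omega
  · obtain ⟨ψ, mψ, e1, e2⟩ := m.pair x y h
    rw [← e1, ← e2]
    exact ⟨mψ.n1, mψ.n1'⟩

theorem MinAut.N2 {φ : MulAut F2} (m : MinAut φ) {x y z : Fin 2 × Bool}
    (h : x.1 = y.1 → x.2 = y.2) (h' : y.1 = z.1 → y.2 = z.2) :
    FreeGroup.norm (XX φ x) + FreeGroup.norm (XX φ z) <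
      FreeGroup.norm (XX φ x * XX φ y) + FreeGroup.norm (XX φ y * XX φ z) := by
  have a1 := m.N1 h
  have a2 := m.N1 h'
  rcases eq_or_ne_fst h with rfl | h
  · have := norm_sq _ (XX_ne φ x)
    omega
  rcases eq_or_ne_fst h' with rfl | h'
  · have := norm_sq _ (XX_ne φ y)
    omega
  by_contra hc
  obtain ⟨ψ, mψ, e1, e2⟩ := m.pair x y h
  have hz : z = x ∨ z = (x.1, !x.2) := by
    rcases x with ⟨x, s⟩; rcases y with ⟨y, t⟩; rcases z with ⟨z, r⟩
    simp at h h' ⊢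
    have : z = x := by omega
    cases s <;> cases r <;> simp [this]
  rcases hz with rfl | rfl
  · have := mψ.n2
    rw [e1, e2] at this
    exact this (by omega) (by omega)
  · rw [XX_inv, norm_inv_eq] at *
    change FreeGroup.norm (XX φ x) ≤ _ ∧ _ at a1
    change _ ∧ FreeGroup.norm (XX φ x) ≤ FreeGroup.norm (XX φ y * (XX φ x)⁻¹) at a2
    change ¬ (FreeGroup.norm (XX φ x) + FreeGroup.norm (XX φ x) < FreeGroup.norm _ +
      FreeGroup.norm (XX φ y * (XX φ x)⁻¹)) at hc
    have := mψ.n3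
    rw [e1, e2] at this
    exact this (by omega) (by omega)

theorem MinAut.len {φ : MulAut F2} (m : MinAut φ) (L : List (Fin 2 × Bool)) :
    ∀ x y : Fin 2 × Bool, FreeGroup.IsReduced (x :: y :: L) →
    FreeGroup.norm (φ (FreeGroup.mk (x :: y :: L))) + FreeGroup.norm (XX φ y) =
      FreeGroup.norm (φ (FreeGroup.mk (y :: L))) + FreeGroup.norm (XX φ x * XX φ y) := by
  have hcons : ∀ x N, φ (FreeGroup.mk (x :: N)) = XX φ x * φ (FreeGroup.mk N) := by
    intro x N; rw [XX, ← map_mul, mul_mk]; rfl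
  induction L with
  | nil =>
    intro x y h
    rw [hcons]
    simp only [XX]
    omega
  | cons z L ih =>
    intro x y h
    rw [isReduced_cons_cons] at h
    have hyz := (isReduced_cons_cons.1 h.2).1
    have i := ih y z h.2
    have n2 := m.N2 h.1 hyz
    rw [hcons x]
    have ey : φ (FreeGroup.mk (z :: L)) = (XX φ y)⁻¹ * φ (FreeGroup.mk (y :: z :: L)) := by
      rw [hcons y]; simp
    rw [ey] at i
    generalize φ (FreeGroup.mk (y :: z :: L)) = W at *
    have f1 := four_point (XX φ x)⁻¹ (XX φ y) W
    have f2 := four_point (XX φ x)⁻¹ W (XX φ y)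
    have s := norm_symm W (XX φ y)
    rw [norm_inv_eq, inv_inv] at f1 f2
    omega

theorem MinAut.base {φ : MulAut F2} (m : MinAut φ) (g : F2) (hg : FreeGroup.norm g = 1) :
    ∃ x, XX φ x = g := by
  have main : ∀ (L : List (Fin 2 × Bool)), ∀ x, FreeGroup.IsReduced (x :: L) →
      FreeGroup.norm (φ (FreeGroup.mk (x :: L))) ≤ 1 →
      L = [] ∧ FreeGroup.norm (XX φ x) = 1 := by
    intro L
    induction L with
    | nil =>
      intro x _ h
      refine ⟨rfl, ?_⟩
      have := XX_ne φ x
      rw [← (FreeGroup.norm_eq_zero (α := Fin 2)).ne] at this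
      change FreeGroup.norm (XX φ x) ≤ 1 at h
      omega
    | cons y L ih =>
      intro x h hn
      exfalso
      have l := m.len L x y h
      rw [isReduced_cons_cons] at h
      have n1 := m.N1 h.1
      obtain ⟨rfl, h1⟩ := ih y h.2 (by omega)
      change _ = FreeGroup.norm (XX φ y) + _ at l
      have hx : FreeGroup.norm (XX φ x) ≠ 0 := (FreeGroup.norm_eq_zero (α := Fin 2)).ne.2 (XX_ne φ x)
      have hp := norm_parity (XX φ x) (XX φ y)
      omega
  have hm : φ (FreeGroup.mk (φ.symm g).toWord) = g := by
    rw [mk_toWord]; exact φ.apply_symm_apply g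
  have hr : FreeGroup.IsReduced (φ.symm g).toWord := isReduced_toWord
  generalize (φ.symm g).toWord = L at *
  cases L with
  | nil =>
    rw [← one_eq_mk, map_one] at hm
    subst hm
    simp at hg
  | cons x L =>
    obtain ⟨rfl, -⟩ := main L x hr (by rw [hm, hg])
    exact ⟨x, hm⟩

theorem norm_letter (x : Fin 2 × Bool) : FreeGroup.norm (FreeGroup.mk [x]) = 1 := rfl

theorem MinAut.mem_HH {φ : MulAut F2} (m : MinAut φ) : φ ∈ HH := by
  obtain ⟨x, hx⟩ := m.base ga rfl
  obtain ⟨y, hy⟩ := m.base gb rfl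
  have key : ∃ h ∈ HH, φ * h = 1 := by
    rcases x with ⟨x, s⟩; rcases y with ⟨y, t⟩
    have hne : x ≠ y := by
      rintro rfl
      have hab : gb = ga ∨ gb = ga⁻¹ := by
        by_cases e : s = t
        · subst e; left; rw [← hx, ← hy]
        · right
          have : t = !s := by cases s <;> cases t <;> simp_all
          subst this
          rw [← hx, ← hy, XX_inv]
      rcases hab with h | h
      · have := congrArg toWord h
        simp at this
      · have := congrArg toWord h
        simp [toWord_inv, invRev] at this
    have hs : _root_.sA ∈ HH := sA_mem
    have ht : _root_.sB ∈ HH := sB_mem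
    have hw : _root_.swp ∈ HH := swp_mem
    fin_cases x <;> fin_cases y <;> cases s <;> cases t <;>
      simp [XX_true, XX_false] at hx hy hne
    · exact ⟨_root_.sA * _root_.sB, mul_mem hs ht, aut_ext (by simp [hx, hy]) (by simp [hx, hy])⟩
    · exact ⟨_root_.sA, hs, aut_ext (by simp [hx, hy]) (by simp [hx, hy])⟩
    · exact ⟨_root_.sB, ht, aut_ext (by simp [hx, hy]) (by simp [hx, hy])⟩
    · exact ⟨1, one_mem _, aut_ext (by simp [hx, hy]) (by simp [hx, hy])⟩
    · exact ⟨_root_.swp * _root_.sA * _root_.sB, mul_mem (mul_mem hw hs) ht,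
        aut_ext (by simp [hx, hy]) (by simp [hx, hy])⟩
    · exact ⟨_root_.swp * _root_.sA, mul_mem hw hs, aut_ext (by simp [hx, hy]) (by simp [hx, hy])⟩
    · exact ⟨_root_.swp * _root_.sB, mul_mem hw ht, aut_ext (by simp [hx, hy]) (by simp [hx, hy])⟩
    · exact ⟨_root_.swp, hw, aut_ext (by simp [hx, hy]) (by simp [hx, hy])⟩
  obtain ⟨h, hh, e⟩ := key
  rw [mul_eq_one_iff_eq_inv] at e
  rw [e]
  exact inv_mem hh

theorem all_mem (φ : MulAut F2) : φ ∈ HH := by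
  induction hn : NN φ using Nat.strong_induction_on generalizing φ with
  | _ n ih =>
    by_cases m : MinAut φ
    · exact m.mem_HH
    · unfold MinAut at m
      push Not at m
      obtain ⟨c, h, hh, hlt⟩ := m
      have := ih (NN (MulAut.conj c * φ * h)) (by omega) _ rfl
      rw [mul_mem_cancel_right hh, mul_mem_cancel_left (conj_mem c)] at this
      exact this

end Auts

section NormalForm
open FreeGroup hiding map_mul map_inv map_one norm_eq_zero norm

def SG : Set (MulAut F2) := {1, sA, sB, sA * sB}
def DI : Subgroup (MulAut F2) := Subgroup.closure {sB, swp}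
def PP : Submonoid (MulAut F2) := Submonoid.closure {tauA, tauB}

def TT (φ : MulAut F2) : Prop :=
  ∃ c : F2, ∃ s ∈ SG, ∃ θ ∈ PP, ∃ t ∈ DI, φ = MulAut.conj c * s * θ * t

theorem mul_conj (φ : MulAut F2) (c : F2) : φ * MulAut.conj c = MulAut.conj (φ c) * φ := by
  ext x; simp

theorem sB_DI : sB ∈ DI := Subgroup.subset_closure (by simp)
theorem swp_DI : swp ∈ DI := Subgroup.subset_closure (by simp)
theorem tauA_PP : tauA ∈ PP := Submonoid.subset_closure (by simp)
theorem tauB_PP : tauB ∈ PP := Submonoid.subset_closure (by simp)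

theorem TT.conj {φ : MulAut F2} (h : TT φ) (d : F2) : TT (MulAut.conj d * φ) := by
  obtain ⟨c, s, hs, θ, hθ, t, ht, rfl⟩ := h
  exact ⟨d * c, s, hs, θ, hθ, t, ht, by simp [mul_assoc]⟩

theorem TT.of_conj {φ : MulAut F2} {d : F2} (h : TT (MulAut.conj d * φ)) : TT φ := by
  have := h.conj d⁻¹
  simpa using this

theorem TT.left_of_core {ρ : MulAut F2}
    (h : ∀ s ∈ SG, ∀ θ ∈ PP, ∀ t ∈ DI, TT (ρ * (s * θ * t))) {φ : MulAut F2} (hφ : TT φ) :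
    TT (ρ * φ) := by
  obtain ⟨c, s, hs, θ, hθ, t, ht, rfl⟩ := hφ
  have := (h s hs θ hθ t ht).conj (ρ c)
  rw [← mul_assoc, ← mul_conj] at this
  simpa only [mul_assoc] using this

theorem sBsB : sB * sB = 1 := aut_ext (by simp) (by simp)
theorem sAsA : sA * sA = 1 := aut_ext (by simp) (by simp)
theorem sBsA : sB * sA = sA * sB := aut_ext (by simp) (by simp)
theorem swp_swp : swp * swp = 1 := aut_ext (by simp) (by simp)
theorem swp_sA : swp * sA = sB * swp := aut_ext (by simp) (by simp)
theorem swp_sB : swp * sB = sA * swp := aut_ext (by simp) (by simp)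
theorem swp_tauA : swp * tauA = tauB * swp := aut_ext (by simp) (by simp)
theorem swp_tauB : swp * tauB = tauA * swp := aut_ext (by simp) (by simp)

theorem SG_sB {s : MulAut F2} (hs : s ∈ SG) : sB * s ∈ SG := by
  rcases hs with rfl | rfl | rfl | rfl
  · simp [SG]
  · simp [SG, sBsA]
  · simp [SG, sBsB]
  · rw [← mul_assoc, sBsA, mul_assoc, sBsB]; simp [SG]

theorem SG_sA {s : MulAut F2} (hs : s ∈ SG) : sA * s ∈ SG := by
  rcases hs with rfl | rfl | rfl | rfl
  · simp [SG]
  · simp [SG, sAsA]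
  · simp [SG]
  · rw [← mul_assoc, sAsA]; simp [SG]

theorem SG_swp {s : MulAut F2} (hs : s ∈ SG) : ∃ s' ∈ SG, swp * s = s' * swp := by
  rcases hs with rfl | rfl | rfl | rfl
  · exact ⟨1, by simp [SG], by simp⟩
  · exact ⟨sB, by simp [SG], swp_sA⟩
  · exact ⟨sA, by simp [SG], swp_sB⟩
  · exact ⟨sA * sB, by simp [SG], aut_ext (by simp) (by simp)⟩

theorem PP_swp {θ : MulAut F2} (hθ : θ ∈ PP) : ∃ θ' ∈ PP, swp * θ = θ' * swp := by
  induction hθ using Submonoid.closure_induction_left with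
  | one => exact ⟨1, one_mem _, by simp⟩
  | mul_left x hx y hy ih =>
    obtain ⟨θ', h1, h2⟩ := ih
    rcases hx with rfl | rfl
    · exact ⟨tauB * θ', mul_mem tauB_PP h1, by rw [← mul_assoc, swp_tauA, mul_assoc, h2, mul_assoc]⟩
    · exact ⟨tauA * θ', mul_mem tauA_PP h1, by rw [← mul_assoc, swp_tauB, mul_assoc, h2, mul_assoc]⟩

theorem TT.sB {φ : MulAut F2} (h : TT φ) : TT (sB * φ) := by
  refine TT.left_of_core ?_ h
  intro s hs θ hθ t ht
  exact ⟨1, _, SG_sB hs, θ, hθ, t, ht, by simp [mul_assoc]⟩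

theorem TT.sA {φ : MulAut F2} (h : TT φ) : TT (sA * φ) := by
  refine TT.left_of_core ?_ h
  intro s hs θ hθ t ht
  exact ⟨1, _, SG_sA hs, θ, hθ, t, ht, by simp [mul_assoc]⟩

theorem TT.swp {φ : MulAut F2} (h : TT φ) : TT (swp * φ) := by
  refine TT.left_of_core ?_ h
  intro s hs θ hθ t ht
  obtain ⟨s', hs', e1⟩ := SG_swp hs
  obtain ⟨θ', hθ', e2⟩ := PP_swp hθ
  refine ⟨1, s', hs', θ', hθ', _root_.swp * t, mul_mem swp_DI ht, ?_⟩
  rw [← mul_assoc, ← mul_assoc, e1, mul_assoc s', e2]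
  simp [mul_assoc]

theorem TT.tauA_inv_core {θ t : MulAut F2} (hθ : θ ∈ PP) (ht : t ∈ DI) :
    TT (tauA⁻¹ * (θ * t)) := by
  have e0 : tauA⁻¹ = _root_.sB * tauA * _root_.sB := by
    rw [inv_eq_iff_mul_eq_one]
    exact aut_ext (by simp) (by simp)
  induction hθ using Submonoid.closure_induction_left with
  | one =>
    have : TT (tauA * (_root_.sB * t)) :=
      ⟨1, 1, by simp [SG], tauA, tauA_PP, _, mul_mem sB_DI ht, by simp⟩
    rw [e0, one_mul]
    simpa only [mul_assoc] using this.sB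
  | mul_left x hx y hy ih =>
    rcases hx with rfl | rfl
    · exact ⟨1, 1, by simp [SG], y, hy, t, ht, by simp [mul_assoc]⟩
    · have e1 : tauA⁻¹ * tauB = MulAut.conj gb * (_root_.sB * (_root_.swp * tauA)) := by
        rw [inv_mul_eq_iff_eq_mul]
        exact aut_ext (by simp) (by simp [mul_assoc])
      have : TT (tauA * y * t) :=
        ⟨1, 1, by simp [SG], tauA * y, mul_mem tauA_PP hy, t, ht, by simp⟩
      have := this.swp.sB.conj gb
      rw [mul_assoc, ← mul_assoc, e1]
      simpa only [mul_assoc] using this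

theorem TT.tauA {φ : MulAut F2} (h : TT φ) : TT (tauA * φ) := by
  refine TT.left_of_core ?_ h
  intro s hs θ hθ t ht
  have e1 : _root_.tauA * _root_.sB = _root_.sB * _root_.tauA⁻¹ := by
    rw [eq_mul_inv_iff_mul_eq]
    exact aut_ext (by simp) (by simp)
  have e2 : _root_.tauA * (_root_.sA * _root_.sB) =
      MulAut.conj gb⁻¹ * (_root_.sA * (_root_.sB * _root_.tauA)) :=
    aut_ext (by simp [mul_assoc]) (by simp)
  have e3 : _root_.tauA * _root_.sA =
      MulAut.conj gb⁻¹ * (_root_.sA * _root_.tauA⁻¹) := by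
    rw [← mul_assoc, eq_mul_inv_iff_mul_eq]
    exact aut_ext (by simp) (by simp)
  have hpos : TT (_root_.tauA * (θ * t)) :=
    ⟨1, 1, by simp [SG], _root_.tauA * θ, mul_mem tauA_PP hθ, t, ht, by simp [mul_assoc]⟩
  have hneg := TT.tauA_inv_core hθ ht
  rw [mul_assoc s, ← mul_assoc]
  rcases hs with rfl | rfl | rfl | rfl
  · simpa using hpos
  · rw [e3]
    simpa only [mul_assoc] using hneg.sA.conj gb⁻¹
  · rw [e1]
    simpa only [mul_assoc] using hneg.sB
  · rw [e2]
    simpa only [mul_assoc] using hpos.sB.sA.conj gb⁻¹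

theorem TT_all (φ : MulAut F2) : TT φ := by
  have e0 : tauA⁻¹ = sB * tauA * sB := by
    rw [inv_eq_iff_mul_eq_one]
    exact aut_ext (by simp) (by simp)
  have h := all_mem φ
  unfold HH at h
  induction h using Subgroup.closure_induction_left with
  | one => exact ⟨1, 1, by simp [SG], 1, one_mem _, 1, one_mem _, by simp⟩
  | mul_left x hx y hy ih =>
    rcases hx with (rfl | rfl | rfl) | ⟨c, rfl⟩
    · exact ih.tauA
    · exact ih.sB
    · exact ih.swp
    · exact ih.conj c
  | inv_mul_cancel x hx y hy ih =>
    rcases hx with (rfl | rfl | rfl) | ⟨c, rfl⟩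
    · rw [e0]
      simpa only [mul_assoc] using ih.sB.tauA.sB
    · rw [inv_eq_iff_mul_eq_one.2 sBsB]; exact ih.sB
    · rw [inv_eq_iff_mul_eq_one.2 swp_swp]; exact ih.swp
    · rw [← map_inv]; exact ih.conj _

end NormalForm

section Cyclic
open FreeGroup hiding map_mul map_inv map_one norm_eq_zero norm

abbrev Letter := Fin 2 × Bool

def Red2 (p q : Letter) : Prop := p.1 = q.1 → p.2 = q.2

/-- Reduced adjacency in which `x` has only `y` as neighbours. -/
def RelXY (x y p q : Letter) : Prop := Red2 p q ∧ (p = x → q = y) ∧ (q = x → p = y)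

instance (x y p q : Letter) : Decidable (RelXY x y p q) := by
  unfold RelXY Red2; infer_instance

/-- Cyclic chains. -/
def CC {α : Type*} (R : α → α → Prop) (L : List α) : Prop := List.IsChain R (L ++ L)

theorem CC.triple {α : Type*} {R : α → α → Prop} {L : List α} (h : CC R L) :
    List.IsChain R (L ++ L ++ L) := by
  by_cases hL : L = []
  · simp [hL]
  · exact List.IsChain.append_overlap h h hL

theorem CC.rot {α : Type*} {R : α → α → Prop} {M N : List α} (h : CC R (M ++ N)) :
    CC R (N ++ M) :=
  h.triple.infix ⟨M, N, by simp⟩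

theorem CC.isRotated {α : Type*} {R : α → α → Prop} {M N : List α} (h : CC R M)
    (r : M ~r N) : CC R N := by
  obtain ⟨n, rfl⟩ := r
  rw [List.rotate_eq_drop_append_take_mod]
  apply CC.rot
  rwa [List.take_append_drop]

theorem CC.reduced {L : List Letter} (h : CC Red2 L) : FreeGroup.IsReduced L :=
  List.IsChain.left_of_append h

theorem CC.red {x y : Letter} {L : List Letter} (h : CC (RelXY x y) L) : CC Red2 L :=
  List.IsChain.imp (fun _ _ h => h.1) h

theorem mk_cons (x : Letter) (L : List Letter) :
    FreeGroup.mk (x :: L) = FreeGroup.mk [x] * FreeGroup.mk L := by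
  rw [mul_mk]; rfl

theorem mk_snoc (x : Letter) (L : List Letter) :
    FreeGroup.mk (L ++ [x]) = FreeGroup.mk L * FreeGroup.mk [x] := by
  rw [mul_mk]

theorem mk_inv_letter (x : Letter) : FreeGroup.mk [(x.1, !x.2)] = (FreeGroup.mk [x])⁻¹ := by
  rw [inv_mk]; rfl

theorem mk_inj_reduced {L M : List Letter} (hL : FreeGroup.IsReduced L)
    (hM : FreeGroup.IsReduced M) (h : FreeGroup.mk L = FreeGroup.mk M) : L = M := by
  have := reduce.sound h
  rwa [hL.reduce_eq, hM.reduce_eq] at this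

theorem rot_of_conj (C : List Letter) (L₂ : List Letter) (h2 : CC Red2 L₂) :
    ∀ L₁, FreeGroup.IsReduced C → CC Red2 L₁ →
    FreeGroup.mk L₂ = FreeGroup.mk C * FreeGroup.mk L₁ * (FreeGroup.mk C)⁻¹ → L₁ ~r L₂ := by
  induction C using List.reverseRecOn with
  | nil =>
    intro L₁ _ h1 e
    rw [← one_eq_mk] at e
    simp only [one_mul, inv_one, mul_one] at e
    rw [mk_inj_reduced h2.reduced h1.reduced e]
  | append_singleton C x ih =>
    intro L₁ hC h1 e
    have hC' : FreeGroup.IsReduced C := List.IsChain.left_of_append hC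
    by_cases hnil : L₁ = []
    · subst hnil
      rw [← one_eq_mk] at e
      simp only [mul_one, mul_inv_cancel] at e
      rw [mk_inj_reduced h2.reduced FreeGroup.IsReduced.nil e]
    by_cases hhead : ∃ M, L₁ = (x.1, !x.2) :: M
    · obtain ⟨M, rfl⟩ := hhead
      have r : ((x.1, !x.2) :: M) ~r (M ++ [(x.1, !x.2)]) := ⟨1, by simp⟩
      refine r.trans (ih _ hC' (h1.isRotated r) ?_)
      rw [e, mk_cons, mk_snoc, mk_snoc, mk_inv_letter]
      group
    by_cases hlast : ∃ M, L₁ = M ++ [x]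
    · obtain ⟨M, rfl⟩ := hlast
      have r : (x :: M) ~r (M ++ [x]) := ⟨1, by simp⟩
      refine r.symm.trans (ih _ hC' (h1.isRotated r.symm) ?_)
      rw [e, mk_cons, mk_snoc, mk_snoc]
      group
    exfalso
    rw [inv_mk, mul_mk, mul_mk] at e
    have w1 : FreeGroup.IsReduced (C ++ [x] ++ L₁) := by
      refine List.isChain_append.2 ⟨hC, h1.reduced, ?_⟩
      intro p hp q hq
      simp at hp
      subst hp
      intro hpq
      by_contra hne
      apply hhead
      cases L₁ with
      | nil => simp at hnil
      | cons y M =>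
        simp at hq
        subst hq
        refine ⟨M, ?_⟩
        congr 1
        ext
        · rw [hpq]
        · cases hx : x.2 <;> cases hy : y.2 <;> simp_all
    have w2 : FreeGroup.IsReduced (L₁ ++ invRev (C ++ [x])) := by
      refine List.isChain_append.2 ⟨h1.reduced, invRev_reduced hC, ?_⟩
      intro p hp q hq
      simp [invRev] at hq
      subst hq
      intro hpq
      by_contra hne
      apply hlast
      rw [Option.mem_def, List.getLast?_eq_some_iff] at hp
      obtain ⟨M, rfl⟩ := hp
      refine ⟨M, ?_⟩
      congr 2
      ext
      · simpa using congrArg Fin.val hpq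
      · cases hx : x.2 <;> cases hy : p.2 <;> simp_all
    have w3 := FreeGroup.IsReduced.append_overlap w1 w2 hnil
    have e2 := mk_inj_reduced h2.reduced w3 e
    have h3 := h2
    rw [e2] at h3
    obtain ⟨h, T, hT⟩ : ∃ h T, C ++ [x] = h :: T := by
      cases hc : C ++ [x] with
      | nil => simp at hc
      | cons h T => exact ⟨h, T, rfl⟩
    rw [hT] at h3
    have h4 := (List.isChain_append.1 h3).2.2 (h.1, !h.2) (by
      rw [Option.mem_def, List.getLast?_eq_some_iff]
      exact ⟨(h :: T) ++ L₁ ++ invRev T, by simp [invRev]⟩) h (by simp)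
    have h5 := h4 rfl
    simp at h5

/-- conjugate to a cyclic chain -/
def DD (x y : Letter) (g : F2) : Prop := ∃ L, CC (RelXY x y) L ∧ IsConj g (FreeGroup.mk L)

theorem DD.conj {x y : Letter} {g h : F2} (d : DD x y g) (c : IsConj h g) : DD x y h := by
  obtain ⟨L, h1, h2⟩ := d
  exact ⟨L, h1, c.trans h2⟩

theorem cc_toWord (w : F2) (hcr : CyclicallyReduced2 w) : CC Red2 w.toWord := by
  refine List.isChain_append.2 ⟨isReduced_toWord, isReduced_toWord, ?_⟩
  intro p hp q hq e
  by_contra hne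
  refine hcr q hq p hp ?_
  ext
  · simp [e]
  · cases hx : q.2 <;> cases hy : p.2 <;> simp_all

theorem final_of_DD (w : F2) (hcr : CyclicallyReduced2 w) (x y : Letter) (d : DD x y w)
    (z : Letter) (hz : z ≠ y) :
    ¬ CyclicSubword2 [z, x] w ∧ ¬ CyclicSubword2 [x, z] w := by
  obtain ⟨L, hL, hc⟩ := d
  obtain ⟨c, hc⟩ := isConj_iff.1 hc.symm
  have r : L ~r w.toWord := rot_of_conj c.toWord w.toWord (cc_toWord w hcr) L isReduced_toWord
    hL.red (by simp only [mk_toWord]; exact hc.symm)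
  have h := hL.isRotated r
  constructor
  · rintro ⟨-, h2⟩
    have := List.IsChain.infix h h2
    rw [List.isChain_pair] at this
    exact hz (this.2.2 rfl)
  · rintro ⟨-, h2⟩
    have := List.IsChain.infix h h2
    rw [List.isChain_pair] at this
    exact hz (this.2.1 rfl)

end Cyclic

section Syllables
open FreeGroup hiding map_mul map_inv map_one norm_eq_zero norm

/-- `b`-power block -/
def blk (k : ℤ) : List Letter := List.replicate k.natAbs (1, decide (0 < k))
def flatS (s : Bool × ℤ) : List Letter := (0, s.1) :: blk s.2
def flat (S : List (Bool × ℤ)) : List Letter := S.flatMap flatS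

@[simp] theorem flat_nil : flat [] = [] := rfl
@[simp] theorem flat_cons (s : Bool × ℤ) (S) : flat (s :: S) = flatS s ++ flat S := by simp [flat]
@[simp] theorem flat_append (S T) : flat (S ++ T) = flat S ++ flat T := by simp [flat]

theorem chain_rep {α : Type*} (R : α → α → Prop) (p q r : α) (n : ℕ) :
    List.IsChain R (p :: (List.replicate (n + 1) q ++ [r])) ↔ R p q ∧ R q r ∧ (n = 0 ∨ R q q) := by
  induction n generalizing p with
  | zero => simp
  | succ n ih =>
    rw [List.replicate_succ, List.cons_append, List.isChain_cons_cons, ih]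
    constructor
    · rintro ⟨h1, h2, h3, h4⟩
      exact ⟨h1, h3, Or.inr h2⟩
    · rintro ⟨h1, h2, h3⟩
      have h3 := h3.resolve_left (by simp)
      exact ⟨h1, h3, h2, Or.inr h3⟩

def QA (s : Bool × ℤ) (e : Bool) : Prop :=
  (s.1 ≠ e → s.2 ≠ 0) ∧ ((s.1 = false ∨ e = false) → s.2 < 0)
def QB (s : Bool × ℤ) (e : Bool) : Prop :=
  (s.1 ≠ e → s.2 ≠ 0) ∧ (s.2 ≤ 0 ∨ (s.2 = 1 ∧ s.1 = true ∧ e = true))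

abbrev RA := RelXY (0, false) (1, false)
abbrev RB := RelXY (1, true) (0, true)

theorem int_cases3 (k : ℤ) : k = 0 ∨ (∃ n : ℕ, k = (n : ℤ) + 1) ∨ (∃ n : ℕ, k = -((n : ℤ) + 1)) := by
  rcases lt_trichotomy k 0 with h | h | h
  · exact Or.inr (Or.inr ⟨(-k - 1).toNat, by omega⟩)
  · exact Or.inl h
  · exact Or.inr (Or.inl ⟨(k - 1).toNat, by omega⟩)

theorem blk_pos (n : ℕ) : blk ((n : ℤ) + 1) = List.replicate (n + 1) (1, true) := by
  unfold blk
  congr 1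
  simp
  try omega

theorem blk_neg (n : ℕ) : blk (-((n : ℤ) + 1)) = List.replicate (n + 1) (1, false) := by
  unfold blk
  congr 1
  all_goals first | omega | (simp; done) | (simp; omega)

@[simp] theorem blk_zero : blk 0 = [] := rfl

theorem hQA (s : Bool × ℤ) (e : Bool) : List.IsChain RA (flatS s ++ [(0, e)]) ↔ QA s e := by
  obtain ⟨e', k⟩ := s
  unfold flatS
  rcases int_cases3 k with rfl | ⟨n, rfl⟩ | ⟨n, rfl⟩
  · cases e <;> cases e' <;> simp [QA, RelXY, Red2]
  · simp only [blk_pos, List.cons_append, chain_rep]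
    cases e <;> cases e' <;> simp [QA, RelXY, Red2] <;> omega
  · simp only [blk_neg, List.cons_append, chain_rep]
    cases e <;> cases e' <;> simp [QA, RelXY, Red2] <;> omega

theorem hQB (s : Bool × ℤ) (e : Bool) : List.IsChain RB (flatS s ++ [(0, e)]) ↔ QB s e := by
  obtain ⟨e', k⟩ := s
  unfold flatS
  rcases int_cases3 k with rfl | ⟨n, rfl⟩ | ⟨n, rfl⟩
  · cases e <;> cases e' <;> simp [QB, RelXY, Red2]
  · simp only [blk_pos, List.cons_append, chain_rep]
    cases e <;> cases e' <;> simp [QB, RelXY, Red2] <;> try omega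
  · simp only [blk_neg, List.cons_append, chain_rep]
    cases e <;> cases e' <;> simp [QB, RelXY, Red2] <;> try omega

theorem chain_to_Q {R : Letter → Letter → Prop} {Q : Bool × ℤ → Bool → Prop}
    (hQ : ∀ s e, List.IsChain R (flatS s ++ [(0, e)]) ↔ Q s e) (S : List (Bool × ℤ))
    (h : List.IsChain R (flat S)) : List.IsChain (fun s s' => Q s s'.1) S := by
  induction S with
  | nil => simp
  | cons s S ih =>
    cases S with
    | nil => simp
    | cons s' S =>
      rw [List.isChain_cons_cons]
      constructor
      · rw [← hQ]
        refine h.infix ⟨[], blk s'.2 ++ flat S, ?_⟩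
        simp [flatS]
      · apply ih
        rw [flat_cons] at h
        exact h.right_of_append

theorem chain_of_Q {R : Letter → Letter → Prop} {Q : Bool × ℤ → Bool → Prop}
    (hQ : ∀ s e, List.IsChain R (flatS s ++ [(0, e)]) ↔ Q s e) (S : List (Bool × ℤ)) (t : Bool × ℤ)
    (h : List.IsChain (fun s s' => Q s s'.1) (S ++ [t])) :
    List.IsChain R (flat S ++ [(0, t.1)]) := by
  induction S with
  | nil => simp
  | cons s S ih =>
    cases S with
    | nil =>
      simp at h
      simpa using (hQ _ _).2 h
    | cons s' S =>
      simp only [List.cons_append] at h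
      rw [List.isChain_cons_cons] at h
      have h1 := (hQ _ _).2 h.1
      have h2 := ih h.2
      have := List.IsChain.append_overlap (l₁ := flatS s) (l₂ := [(0, s'.1)])
        (l₃ := blk s'.2 ++ flat S ++ [(0, t.1)]) h1 (by simpa [flatS] using h2) (by simp)
      simpa [flatS] using this

theorem parse (L : List Letter) (h : FreeGroup.IsReduced L) : ∃ n S, L = blk n ++ flat S := by
  induction L with
  | nil => exact ⟨0, [], rfl⟩
  | cons x L ih =>
    obtain ⟨n, S, rfl⟩ := ih (List.IsChain.tail h)
    obtain ⟨i, e⟩ := x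
    have hi : i = 0 ∨ i = 1 := by omega
    rcases hi with rfl | rfl
    · exact ⟨0, (e, n) :: S, by simp [flatS]⟩
    · rcases int_cases3 n with rfl | ⟨m, rfl⟩ | ⟨m, rfl⟩
      · refine ⟨if e then 1 else -1, S, ?_⟩
        cases e <;> rfl
      · have he : e = true := by
          rw [blk_pos, List.replicate_succ, List.cons_append] at h
          exact (List.isChain_cons_cons.1 h).1 rfl
        subst he
        refine ⟨((m + 1 : ℕ) : ℤ) + 1, S, ?_⟩
        rw [blk_pos, blk_pos, List.replicate_succ (n := m + 1)]; rfl
      · have he : e = false := by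
          rw [blk_neg, List.replicate_succ, List.cons_append] at h
          exact (List.isChain_cons_cons.1 h).1 rfl
        subst he
        refine ⟨-(((m + 1 : ℕ) : ℤ) + 1), S, ?_⟩
        rw [blk_neg, blk_neg, List.replicate_succ (n := m + 1)]; rfl

theorem parse0 (e : Bool) (L : List Letter) (h : FreeGroup.IsReduced ((0, e) :: L)) :
    ∃ s S, (0, e) :: L = flat (s :: S) := by
  obtain ⟨n, S, hh⟩ := parse _ (List.IsChain.tail h)
  simp only [List.tail_cons] at hh
  exact ⟨(e, n), S, by simp [flatS, hh]⟩

def pl (e : Bool) : ℤ := if e then 1 else 0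
def mi (e : Bool) : ℤ := if e then 0 else 1
def nxt : List (Bool × ℤ) → Bool → Bool
  | [], f => f
  | s :: _, _ => s.1
def sh : List (Bool × ℤ) → Bool → List (Bool × ℤ)
  | [], _ => []
  | s :: S, f => (s.1, s.2 + pl s.1 - mi (nxt S f)) :: sh S f

theorem sh_append (S T : List (Bool × ℤ)) (f : Bool) :
    sh (S ++ T) f = sh S (nxt T f) ++ sh T f := by
  induction S with
  | nil => rfl
  | cons s S ih =>
    simp only [List.cons_append, sh, ih]
    congr 4
    cases S <;> rfl

theorem sh_chain {Q : Bool × ℤ → Bool → Prop} (hQ : Q = QA ∨ Q = QB)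
    (S : List (Bool × ℤ)) (f : Bool) (h : List.IsChain (fun s s' => Q s s'.1) S) :
    List.IsChain (fun s s' => QA s s'.1) (sh S f) := by
  induction S with
  | nil => simp [sh]
  | cons s S ih =>
    cases S with
    | nil => simp [sh]
    | cons s' S =>
      rw [List.isChain_cons_cons] at h
      have h2 := ih h.2
      have h1 := h.1
      simp only [sh] at h2 ⊢
      rw [List.isChain_cons_cons]
      refine ⟨?_, h2⟩
      obtain ⟨e, k⟩ := s
      obtain ⟨e', k'⟩ := s'
      rcases hQ with rfl | rfl
      · cases e <;> cases e' <;> simp [QA, nxt, pl, mi] at h1 ⊢ <;> omega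
      · cases e <;> cases e' <;> simp [QA, QB, nxt, pl, mi] at h1 ⊢ <;> omega

theorem mk_blk (k : ℤ) : FreeGroup.mk (blk k) = gb ^ k := by
  have key : ∀ (n : ℕ) (x : Letter), FreeGroup.mk (List.replicate n x) = (FreeGroup.mk [x]) ^ n := by
    intro n x
    induction n with
    | zero => rfl
    | succ n ih => rw [List.replicate_succ, mk_cons, ih, pow_succ']
  rcases int_cases3 k with rfl | ⟨n, rfl⟩ | ⟨n, rfl⟩
  · rfl
  · rw [blk_pos, key, ← Nat.cast_succ, zpow_natCast]; rfl
  · rw [blk_neg, key, zpow_neg, ← Nat.cast_succ, zpow_natCast, ← inv_pow]; rfl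

theorem mk_flatS (s : Bool × ℤ) : FreeGroup.mk (flatS s) = FreeGroup.mk [(0, s.1)] * gb ^ s.2 := by
  rw [flatS, mk_cons, mk_blk]

theorem tauA_letter (e : Bool) : tauA (FreeGroup.mk [(0, e)]) =
    gb ^ (- mi e) * FreeGroup.mk [(0, e)] * gb ^ (pl e) := by
  cases e
  · have : (FreeGroup.mk [(0, false)] : F2) = ga⁻¹ := rfl
    rw [this]; simp [mi, pl]
  · have : (FreeGroup.mk [(0, true)] : F2) = ga := rfl
    rw [this]; simp [mi, pl]

theorem tauA_flat (S : List (Bool × ℤ)) (f : Bool) :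
    tauA (FreeGroup.mk (flat S)) =
      gb ^ (- mi (nxt S f)) * FreeGroup.mk (flat (sh S f)) * gb ^ (mi f) := by
  induction S with
  | nil => simp [sh, nxt, ← one_eq_mk]
  | cons s S ih =>
    rw [flat_cons, ← mul_mk, map_mul, ih, mk_flatS, map_mul, tauA_letter, map_zpow, tauA_b]
    rw [sh, flat_cons, ← mul_mk, mk_flatS]
    simp only [nxt]
    rw [sub_eq_add_neg, add_comm s.2, zpow_add, zpow_add]
    simp only [mul_assoc]

end Syllables

section Final
open FreeGroup hiding map_mul map_inv map_one norm_eq_zero norm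

theorem mk_t (i : Fin 2) : (FreeGroup.mk [(i, true)] : F2) = FreeGroup.of i := rfl
theorem mk_f (i : Fin 2) : (FreeGroup.mk [(i, false)] : F2) = (FreeGroup.of i)⁻¹ := rfl

theorem CC.of_all {α : Type*} {R : α → α → Prop} {L : List α}
    (h : ∀ p ∈ L, ∀ q ∈ L, R p q) : CC R L := by
  refine List.Pairwise.isChain (List.pairwise_of_forall_mem_list ?_)
  intro a ha b hb
  exact h a (by simpa using ha) b (by simpa using hb)

theorem CC.not_mem {x y : Letter} {L : List Letter} (h : CC Red2 L) (hx : x ∉ L) :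
    CC (RelXY x y) L := by
  refine List.IsChain.imp_of_mem_imp ?_ h
  intro a b ha hb r
  refine ⟨r, ?_, ?_⟩
  · rintro rfl; exact absurd (by simpa using ha) hx
  · rintro rfl; exact absurd (by simpa using hb) hx

theorem tauA_no0 (L : List Letter) (h : ∀ x ∈ L, x.1 = 1) :
    tauA (FreeGroup.mk L) = FreeGroup.mk L := by
  induction L with
  | nil => exact map_one tauA
  | cons x L ih =>
    rw [mk_cons, map_mul, ih (fun y hy => h y (by simp [hy]))]
    congr 1
    obtain ⟨i, e⟩ := x
    obtain rfl : i = 1 := h (i, e) (by simp)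
    cases e
    · rw [mk_f, map_inv, tauA_b]
    · rw [mk_t, tauA_b]

theorem rot_conj (M N : List Letter) : IsConj (FreeGroup.mk (M ++ N)) (FreeGroup.mk (N ++ M)) := by
  rw [← mul_mk, ← mul_mk]
  exact isConj_iff.2 ⟨(FreeGroup.mk M)⁻¹, by group⟩

theorem aut_isConj (φ : MulAut F2) {g h : F2} (c : IsConj g h) : IsConj (φ g) (φ h) := by
  obtain ⟨d, hd⟩ := isConj_iff.1 c
  exact isConj_iff.2 ⟨φ d, by rw [← hd]; simp⟩

theorem key_gen {x y : Letter} {Q : Bool × ℤ → Bool → Prop}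
    (hQ : ∀ s e, List.IsChain (RelXY x y) (flatS s ++ [(0, e)]) ↔ Q s e)
    (hQ' : Q = QA ∨ Q = QB) {g : F2} (d : DD x y g) :
    DD (0, false) (1, false) (tauA g) := by
  obtain ⟨L, hL, hc⟩ := d
  by_cases h0 : ∃ e, ((0, e) : Letter) ∈ L
  · obtain ⟨e, he⟩ := h0
    obtain ⟨M, N, rfl⟩ := List.append_of_mem he
    have hc2 := hc.trans (rot_conj _ _)
    have hL2 := hL.rot
    obtain ⟨s, S, hS⟩ := parse0 e (N ++ M) hL2.red.reduced
    rw [← List.cons_append] at hS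
    rw [hS] at hc2 hL2
    have ch := hL2.triple
    rw [← flat_append, ← flat_append] at ch
    have ch2 := sh_chain hQ' _ s.1 (chain_to_Q hQ _ ch)
    rw [sh_append, sh_append] at ch2
    simp only [nxt, List.cons_append] at ch2
    refine ⟨flat (sh (s :: S) s.1), ?_, ?_⟩
    · have := chain_of_Q hQA (sh (s :: S) s.1 ++ sh (s :: S) s.1)
        (s.1, s.2 + pl s.1 - mi (nxt S s.1)) (ch2.infix ⟨[], sh S s.1, by simp [sh]⟩)
      rw [flat_append] at this
      exact this.left_of_append
    · refine (aut_isConj tauA hc2).trans ?_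
      rw [tauA_flat _ s.1]
      refine isConj_iff.2 ⟨gb ^ (mi s.1), ?_⟩
      simp only [nxt]
      group
  · have h1 : ∀ p ∈ L, p.1 = 1 := by
      rintro ⟨i, e⟩ hp
      have hi : i = 0 ∨ i = 1 := by omega
      rcases hi with rfl | rfl
      · exact absurd ⟨e, hp⟩ h0
      · rfl
    refine ⟨L, hL.red.not_mem fun hx => h0 ⟨_, hx⟩, ?_⟩
    have := aut_isConj tauA hc
    rwa [tauA_no0 L h1] at this

abbrev DA := DD (0, false) (1, false)
abbrev DB := DD (1, true) (0, true)

theorem keyA {g : F2} (d : DA g ∨ DB g) : DA (tauA g) := by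
  rcases d with d | d
  · exact key_gen hQA (Or.inl rfl) d
  · exact key_gen hQB (Or.inr rfl) d

theorem aut_mk_map (ρ : MulAut F2) (f : Letter → Letter)
    (hρ : ∀ x, ρ (FreeGroup.mk [x]) = FreeGroup.mk [f x]) (L : List Letter) :
    ρ (FreeGroup.mk L) = FreeGroup.mk (L.map f) := by
  induction L with
  | nil => exact map_one ρ
  | cons x L ih => rw [mk_cons, map_mul, ih, hρ, List.map_cons, mk_cons (f x) (L.map f)]

theorem DD.map {x y : Letter} {g : F2} (ρ : MulAut F2) (f : Letter → Letter)
    (hρ : ∀ x, ρ (FreeGroup.mk [x]) = FreeGroup.mk [f x])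
    (hf : Function.Injective f) (hr : ∀ p q, Red2 p q → Red2 (f p) (f q))
    (d : DD x y g) : DD (f x) (f y) (ρ g) := by
  obtain ⟨L, hL, hc⟩ := d
  refine ⟨L.map f, ?_, ?_⟩
  · unfold CC
    rw [← List.map_append]
    refine List.isChain_map_of_isChain f ?_ hL
    rintro a b ⟨h1, h2, h3⟩
    exact ⟨hr _ _ h1, fun h => by rw [h2 (hf h)], fun h => by rw [h3 (hf h)]⟩
  · rw [← aut_mk_map ρ f hρ]
    exact aut_isConj ρ hc

instance (p q : Letter) : Decidable (Red2 p q) := by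
  unfold Red2; infer_instance

def fA (x : Letter) : Letter := (x.1, if x.1 = 0 then !x.2 else x.2)
def fB (x : Letter) : Letter := (x.1, if x.1 = 1 then !x.2 else x.2)
def fS (x : Letter) : Letter := (1 - x.1, x.2)
def fG (x : Letter) : Letter := (1 - x.1, !x.2)

theorem sA_letter (x : Letter) : sA (FreeGroup.mk [x]) = FreeGroup.mk [fA x] := by
  obtain ⟨i, e⟩ := x
  fin_cases i <;> cases e <;> simp [fA, mk_t, mk_f]
theorem sB_letter (x : Letter) : sB (FreeGroup.mk [x]) = FreeGroup.mk [fB x] := by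
  obtain ⟨i, e⟩ := x
  fin_cases i <;> cases e <;> simp [fB, mk_t, mk_f]
theorem swp_letter (x : Letter) : swp (FreeGroup.mk [x]) = FreeGroup.mk [fS x] := by
  obtain ⟨i, e⟩ := x
  fin_cases i <;> cases e <;> simp [fS, mk_t, mk_f]

def io : MulAut F2 := sA * sB
def sg : MulAut F2 := swp * io

theorem sg_a : sg (FreeGroup.of 0) = gb⁻¹ := by simp [sg, io]
theorem sg_b : sg (FreeGroup.of 1) = ga⁻¹ := by simp [sg, io]
theorem io_a : io (FreeGroup.of 0) = ga⁻¹ := by simp [io]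
theorem io_b : io (FreeGroup.of 1) = gb⁻¹ := by simp [io]

theorem sg_letter (x : Letter) : sg (FreeGroup.mk [x]) = FreeGroup.mk [fG x] := by
  obtain ⟨i, e⟩ := x
  fin_cases i <;> cases e <;> simp [fG, mk_t, mk_f, sg_a, sg_b]

theorem tauB_eq : tauB = MulAut.conj ga⁻¹ * sg * tauA * sg :=
  aut_ext (by simp [sg_a, sg_b]) (by simp [sg_a, sg_b])

theorem DA_sg {g : F2} (d : DA g) : DB (sg g) :=
  DD.map (x := (0, false)) (y := (1, false)) sg fG sg_letter (by decide) (by decide) d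
theorem DB_sg {g : F2} (d : DB g) : DA (sg g) :=
  DD.map (x := (1, true)) (y := (0, true)) sg fG sg_letter (by decide) (by decide) d

theorem conj_isConj (c g : F2) : IsConj (MulAut.conj c g) g :=
  (isConj_iff.2 ⟨c, rfl⟩ : IsConj g _).symm

theorem keyB {g : F2} (d : DA g ∨ DB g) : DB (tauB g) := by
  rw [tauB_eq]
  have := DA_sg (keyA (d.symm.imp DB_sg DA_sg))
  exact this.conj (conj_isConj _ _)

theorem pos_of {i : Fin 2} : Positive2 (FreeGroup.of i) := Submonoid.subset_closure ⟨i, rfl⟩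
theorem pos_mul {g h : F2} (hg : Positive2 g) (hh : Positive2 h) : Positive2 (g * h) :=
  Submonoid.mul_mem _ hg hh

theorem pos_map (φ : MulAut F2) (h : ∀ i, Positive2 (φ (FreeGroup.of i))) {g : F2}
    (hg : Positive2 g) : Positive2 (φ g) := by
  induction hg using Submonoid.closure_induction with
  | mem x hx => obtain ⟨i, rfl⟩ := hx; exact h i
  | one => rw [map_one]; exact Submonoid.one_mem _
  | mul x y _ _ hx hy => rw [map_mul]; exact pos_mul hx hy

def EE (g : F2) : Prop := Positive2 g ∨ DA g ∨ DB g

theorem EE_PP {θ : MulAut F2} (hθ : θ ∈ PP) : ∀ {g : F2}, EE g → EE (θ g) := by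
  induction hθ using Submonoid.closure_induction with
  | mem x hx =>
    intro g hg
    rcases hx with rfl | rfl
    · rcases hg with hg | hg
      · refine Or.inl (pos_map _ (fun i => ?_) hg)
        fin_cases i
        · simpa using pos_mul pos_of pos_of
        · simpa using pos_of
      · exact Or.inr (Or.inl (keyA hg))
    · rcases hg with hg | hg
      · refine Or.inl (pos_map _ (fun i => ?_) hg)
        fin_cases i
        · simpa using pos_of
        · simpa using pos_mul pos_of pos_of
      · exact Or.inr (Or.inr (keyB hg))
  | one => intro g hg; exact hg
  | mul x y _ _ hx hy => intro g hg; exact hx (hy hg)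

def MS (s : Fin 2 → Bool) (g : F2) : Prop := ∃ L : List Letter, (∀ x ∈ L, x.2 = s x.1) ∧ g = FreeGroup.mk L

theorem MS.dd {s : Fin 2 → Bool} {g : F2} (h : MS s g) (x y : Letter) (hx : x.2 ≠ s x.1) :
    DD x y g := by
  obtain ⟨L, hL, rfl⟩ := h
  refine ⟨L, CC.not_mem (CC.of_all ?_) (fun h => hx (hL _ h)), IsConj.refl _⟩
  intro p hp q hq e
  rw [hL p hp, hL q hq, e]

theorem pos_MS {g : F2} (h : Positive2 g) : MS (fun _ => true) g := by
  induction h using Submonoid.closure_induction with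
  | mem x hx => obtain ⟨i, rfl⟩ := hx; exact ⟨[(i, true)], by simp, rfl⟩
  | one => exact ⟨[], by simp, rfl⟩
  | mul x y _ _ hx hy =>
    obtain ⟨L, hL, rfl⟩ := hx
    obtain ⟨M, hM, rfl⟩ := hy
    refine ⟨L ++ M, ?_, mul_mk⟩
    intro x hx
    rcases List.mem_append.1 hx with h | h
    · exact hL x h
    · exact hM x h

theorem MS_pos {g : F2} (h : MS (fun _ => true) g) : Positive2 g := by
  obtain ⟨L, hL, rfl⟩ := h
  induction L with
  | nil => exact Submonoid.one_mem _
  | cons x L ih =>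
    rw [mk_cons]
    refine pos_mul ?_ (ih fun y hy => hL y (by simp [hy]))
    obtain ⟨i, e⟩ := x
    obtain rfl : e = true := hL (i, e) (by simp)
    exact pos_of

theorem MS.map {s : Fin 2 → Bool} {g : F2} (h : MS s g) (ρ : MulAut F2) (f : Letter → Letter)
    (s' : Fin 2 → Bool) (hρ : ∀ x, ρ (FreeGroup.mk [x]) = FreeGroup.mk [f x])
    (hf : ∀ x : Letter, x.2 = s x.1 → (f x).2 = s' (f x).1) : MS s' (ρ g) := by
  obtain ⟨L, hL, rfl⟩ := h
  refine ⟨L.map f, ?_, aut_mk_map ρ f hρ L⟩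
  intro x hx
  obtain ⟨y, hy, rfl⟩ := List.mem_map.1 hx
  exact hf y (hL y hy)

def MX (g : F2) : Prop := ∃ s, MS s g

theorem MX_sB {g : F2} (h : MX g) : MX (sB g) := by
  obtain ⟨s, h⟩ := h
  refine ⟨fun i => if i = 1 then !(s i) else s i, h.map sB fB _ sB_letter ?_⟩
  intro x hx
  simp [fB, hx]

theorem MX_swp {g : F2} (h : MX g) : MX (swp g) := by
  obtain ⟨s, h⟩ := h
  refine ⟨fun i => s (1 - i), h.map swp fS _ swp_letter ?_⟩
  intro x hx
  simp [fS, hx]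

theorem MX_DI {t : MulAut F2} (ht : t ∈ DI) :
    (∀ {g : F2}, MX g → MX (t g)) ∧ (∀ {g : F2}, MX g → MX (t⁻¹ g)) := by
  induction ht using Subgroup.closure_induction with
  | mem x hx =>
    rcases hx with rfl | rfl
    · rw [inv_eq_of_mul_eq_one_left sBsB]; exact ⟨MX_sB, MX_sB⟩
    · rw [inv_eq_of_mul_eq_one_left swp_swp]; exact ⟨MX_swp, MX_swp⟩
  | one => rw [inv_one]; exact ⟨fun h => h, fun h => h⟩
  | mul x y _ _ hx hy =>
    rw [mul_inv_rev]; exact ⟨fun h => hx.1 (hy.1 h), fun h => hy.2 (hx.2 h)⟩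
  | inv x _ hx => rw [inv_inv]; exact ⟨hx.2, hx.1⟩

theorem io_PP {θ : MulAut F2} (hθ : θ ∈ PP) : ∃ c, θ * io = MulAut.conj c * io * θ := by
  induction hθ using Submonoid.closure_induction with
  | mem x hx =>
    rcases hx with rfl | rfl
    · exact ⟨gb⁻¹, aut_ext (by simp [io_a, io_b, mul_assoc]) (by simp [io_a, io_b])⟩
    · exact ⟨ga⁻¹, aut_ext (by simp [io_a, io_b]) (by simp [io_a, io_b, mul_assoc])⟩
  | one => exact ⟨1, by simp⟩
  | mul x y _ _ hx hy =>
    obtain ⟨c, hc⟩ := hx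
    obtain ⟨d, hd⟩ := hy
    refine ⟨x d * c, ?_⟩
    rw [mul_assoc x y, hd, ← mul_assoc, ← mul_assoc, mul_conj, mul_assoc (MulAut.conj (x d)), hc,
      map_mul]
    simp only [mul_assoc]

def ZZ (g : F2) : Prop := ∃ x y, DD x y g

theorem ZZ.conj {g : F2} (c : F2) (h : ZZ g) : ZZ (MulAut.conj c g) := by
  obtain ⟨x, y, h⟩ := h
  exact ⟨x, y, h.conj (conj_isConj _ _)⟩

theorem ZZ_sA {g : F2} (h : ZZ g) : ZZ (sA g) := by
  obtain ⟨x, y, h⟩ := h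
  exact ⟨_, _, h.map sA fA sA_letter (by decide) (by decide)⟩

theorem ZZ_sB {g : F2} (h : ZZ g) : ZZ (sB g) := by
  obtain ⟨x, y, h⟩ := h
  exact ⟨_, _, h.map sB fB sB_letter (by decide) (by decide)⟩

theorem EE.zz {g : F2} (h : EE g) : ZZ g := by
  rcases h with h | h | h
  · exact ⟨(0, false), (0, false), (pos_MS h).dd _ _ (by simp)⟩
  · exact ⟨_, _, h⟩
  · exact ⟨_, _, h⟩

theorem MX_EE {g : F2} (h : MX g) : EE g ∨ EE (io g) := by
  obtain ⟨s, h⟩ := h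
  have hio : MS (fun i => !(s i)) (io g) := by
    refine h.map io (fun x => (x.1, !x.2)) _ ?_ ?_
    · rintro ⟨i, e⟩
      fin_cases i <;> cases e <;> simp [mk_t, mk_f, io_a, io_b]
    · intro x hx
      simp [hx]
  rcases h0 : s 0 with _ | _ <;> rcases h1 : s 1 with _ | _
  · right; left
    apply MS_pos
    convert hio using 2 with i
    fin_cases i <;> simp [h0, h1]
  · right; right; left
    exact hio.dd _ _ (by simp [h0])
  · left; right; left
    exact h.dd _ _ (by simp [h0])
  · left; left
    apply MS_pos
    convert h using 2 with i
    fin_cases i <;> simp [h0, h1]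

theorem main_zz {p : F2} (hp : Positive2 p) (ψ : MulAut F2) : ZZ (ψ p) := by
  obtain ⟨c, s, hs, θ, hθ, t, ht, rfl⟩ := TT_all ψ
  have key : ZZ (θ (t p)) := by
    rcases MX_EE ((MX_DI ht).1 ⟨_, pos_MS hp⟩) with h | h
    · exact (EE_PP hθ h).zz
    · obtain ⟨d, hd⟩ := io_PP hθ
      have e : θ (t p) = MulAut.conj d (io (θ (io (t p)))) := by
        have e1 : io * io = 1 := aut_ext (by simp [io_a]) (by simp [io_b])
        have : θ = MulAut.conj d * io * θ * io := by
          rw [← hd, mul_assoc, e1, mul_one]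
        conv_lhs => rw [this]
        rfl
      rw [e]
      exact ((ZZ_sA (ZZ_sB (EE_PP hθ h).zz))).conj d
  have key2 : ZZ (s (θ (t p))) := by
    rcases hs with rfl | rfl | rfl | rfl
    · exact key
    · exact ZZ_sA key
    · exact ZZ_sB key
    · exact ZZ_sA (ZZ_sB key)
  exact key2.conj c

end Final

/-- Goldstein's Criterion. -/
theorem goldstein_criterion (w : F2) (hcr : CyclicallyReduced2 w) (hpp : PotPos2 w) :
    ∃ x y : Fin 2 × Bool, ∀ z : Fin 2 × Bool, z ≠ y →
      ¬ CyclicSubword2 [z, x] w ∧ ¬ CyclicSubword2 [x, z] w := by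
  obtain ⟨φ, hφ⟩ := hpp
  obtain ⟨x, y, h⟩ := main_zz hφ φ.symm
  have e : φ.symm (φ w) = w := φ.symm_apply_apply w
  have h' : DD x y w := by
    rw [← e]; exact h
  exact ⟨x, y, fun z hz => final_of_DD w hcr x y h' z hz⟩
end
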